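/- arXiv:0911.0074 — 3 statements merged into one kernel-verified Lean document; each statement's English description precedes it below -/
import Mathlib

section
/- For every ε > 0 and n ∈ ℕ there exists N = N(ε, n) ∈ ℕ with the following property: for every n-dimensional linear subspace E of H¹_N(δ) there exist pairwise disjoint collections {ℬ_J : J ∈ 𝒟_n} of dyadic intervals from 𝒟_N, each ℬ_J consisting of pairwise disjoint intervals, such that, setting B_J = ⋃_{I∈ℬ_J} I and b_J = ∑_{I∈ℬ_J} h_I: (1) {B_J : J ∈ 𝒟_n} is a dyadic tree and |J|/2 ≤ |B_J|/|B_{[0,1)}| ≤ |J| for all J ∈ 𝒟_n; (2) the orthogonal projection Q(f) = ∑_{J∈𝒟_n} ⟨f, b_J/‖b_J‖₂⟩ b_J/‖b_J‖₂ satisfies ‖Q x‖_{H¹} ≤ 4 ‖x‖_{H¹} for all x; (3) ‖Q(x)‖_{H¹} ≤ ε ‖x‖_{H¹} for every x ∈ E. -/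
open MeasureTheory
open scoped ENNReal

noncomputable section

namespace DyadicH

/-- The index `q = (n, k)` encodes the dyadic interval `[k/2^n, (k+1)/2^n)`; it is a genuine
dyadic subinterval of `[0,1)` iff `k < 2^n`. -/
def IsDyadic (q : ℕ × ℕ) : Prop := q.2 < 2 ^ q.1

/-- The dyadic interval `[k/2^n, (k+1)/2^n)` associated to the index `q = (n, k)`. -/
def dint (q : ℕ × ℕ) : Set ℝ := Set.Ico ((q.2 : ℝ) / 2 ^ q.1) ((q.2 + 1 : ℝ) / 2 ^ q.1)

/-- The length `|I| = 2^{-n}` of the dyadic interval indexed by `q = (n, k)`. -/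
def len (q : ℕ × ℕ) : ℝ := ((2 : ℝ) ^ q.1)⁻¹

/-- The `L^∞`-normalized Haar function `h_I`: `+1` on the left half of `I`, `-1` on the right
half of `I`, `0` outside `I`. -/
def haarFn (q : ℕ × ℕ) : ℝ → ℝ :=
  (Set.Ico ((q.2 : ℝ) / 2 ^ q.1) ((2 * q.2 + 1 : ℝ) / 2 ^ (q.1 + 1))).indicator
      (fun _ => (1 : ℝ))
    - (Set.Ico ((2 * q.2 + 1 : ℝ) / 2 ^ (q.1 + 1)) ((q.2 + 1 : ℝ) / 2 ^ q.1)).indicator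
      (fun _ => (1 : ℝ))

/-- The `L²` inner product on `[0,1)`. -/
def ip (f g : ℝ → ℝ) : ℝ := ∫ t in Set.Ico (0 : ℝ) 1, f t * g t

/-- The Haar coefficient `⟨f, h_I⟩`. -/
def haarCoeff (f : ℝ → ℝ) (q : ℕ × ℕ) : ℝ := ip f (haarFn q)

/-- The type of (indices of) dyadic intervals. -/
def Didx : Type := {q : ℕ × ℕ // IsDyadic q}

/-- The dyadic square function `S(f) = (∑_{I ∈ 𝒟} ⟨f, h_I/|I|⟩² 1_I)^{1/2}`. -/
def sqFn (f : ℝ → ℝ) : ℝ → ℝ := fun t =>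
  Real.sqrt (∑' q : Didx,
    (haarCoeff f q.1 * 2 ^ q.1.1) ^ 2 * (dint q.1).indicator (fun _ => (1 : ℝ)) t)

/-- The dyadic `H¹` norm `‖f‖_{H¹} = ‖S(f)‖_{L¹}`. -/
def H1norm (f : ℝ → ℝ) : ℝ := ∫ t in Set.Ico (0 : ℝ) 1, sqFn f t

/-- The linear span of the Haar system `{h_I : I ∈ 𝒟}`. -/
def haarSpan : Submodule ℝ (ℝ → ℝ) := Submodule.span ℝ (haarFn '' {q | IsDyadic q})

/-- The linear span of `{h_I : I ∈ 𝒟_N}`. -/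
def haarSpanLe (N : ℕ) : Submodule ℝ (ℝ → ℝ) :=
  Submodule.span ℝ (haarFn '' {q | IsDyadic q ∧ q.1 ≤ N})

/-- `𝒟_m = {I ∈ 𝒟 : |I| ≥ 2^{-m}}` as a finite set of indices. -/
def dFinset (m : ℕ) : Finset (ℕ × ℕ) :=
  (Finset.range (m + 1)).biUnion fun n => (Finset.range (2 ^ n)).image fun k => (n, k)

open scoped Classical in
/-- The Carleson constant `⟦G⟧ = sup_{I ∈ G} |I|⁻¹ ∑_{J ∈ G, J ⊆ I} |J|` of a finite
collection of dyadic intervals. -/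
def carleson (G : Finset (ℕ × ℕ)) : ℝ :=
  ⨆ I ∈ G, ((2 : ℝ) ^ I.1 * ∑ J ∈ G, if dint J ⊆ dint I then len J else 0)


/-- The set `B_J = ⋃_{I ∈ ℬ_J} I` determined by a collection `ℬ_J` of dyadic intervals. -/
def blockSet (B : (ℕ × ℕ) → Finset (ℕ × ℕ)) (I : ℕ × ℕ) : Set ℝ := ⋃ J ∈ B I, dint J

/-- The block function `b_J = ∑_{I ∈ ℬ_J} h_I`. -/
def blockFn (B : (ℕ × ℕ) → Finset (ℕ × ℕ)) (I : ℕ × ℕ) : ℝ → ℝ :=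
  fun t => ∑ J ∈ B I, haarFn J t

/-- The orthogonal projection `Q(f) = ∑_{J ∈ 𝒟_n} ⟨f, b_J/‖b_J‖₂⟩ b_J/‖b_J‖₂`. -/
def Qproj (B : (ℕ × ℕ) → Finset (ℕ × ℕ)) (n : ℕ) (f : ℝ → ℝ) : ℝ → ℝ :=
  fun t => ∑ J ∈ dFinset n,
    (ip f (blockFn B J) / ip (blockFn B J) (blockFn B J)) * blockFn B J t

end DyadicH

namespace DyadicH

/-- The left endpoint of the dyadic interval of length `2^{-k}` that contains `t`. -/
def snap (k : ℕ) (t : ℝ) : ℝ := (⌊(2 : ℝ) ^ k * t⌋₊ : ℝ) / 2 ^ k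

/-- `f` is constant on the dyadic subintervals of `[0,1)` of length `2^{-k}`. -/
def ConstAtLevel {α : Type*} (k : ℕ) (f : ℝ → α) : Prop :=
  ∀ t ∈ Set.Ico (0 : ℝ) 1, f (snap k t) = f t

/-- The `k`-th Rademacher function. -/
def rademacher (k : ℕ) (t : ℝ) : ℝ := if ⌊(2 : ℝ) ^ (k + 1) * t⌋₊ % 2 = 0 then 1 else -1

theorem rademacher_mul_self (k : ℕ) (t : ℝ) : rademacher k t * rademacher k t = 1 := by
  unfold rademacher; split_ifs <;> norm_num

theorem mem_dint_iff {q : ℕ × ℕ} {t : ℝ} : t ∈ dint q ↔ 0 ≤ t ∧ ⌊(2 : ℝ) ^ q.1 * t⌋₊ = q.2 := by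
  have h2 : (0 : ℝ) < 2 ^ q.1 := by positivity
  constructor
  · rintro ⟨h, h'⟩
    have ht : 0 ≤ t := le_trans (by positivity) h
    refine ⟨ht, ?_⟩
    rw [Nat.floor_eq_iff (by positivity)]
    rw [div_le_iff₀ h2] at h
    rw [lt_div_iff₀ h2] at h'
    constructor <;> linarith
  · rintro ⟨ht, h⟩
    rw [Nat.floor_eq_iff (by positivity)] at h
    refine ⟨?_, ?_⟩
    · rw [div_le_iff₀ h2]; linarith
    · rw [lt_div_iff₀ h2]; linarith

theorem floor_lt_two_pow (k : ℕ) {t : ℝ} (ht : t ∈ Set.Ico (0 : ℝ) 1) :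
    ⌊(2 : ℝ) ^ k * t⌋₊ < 2 ^ k := by
  rw [Nat.floor_lt (mul_nonneg (by positivity) ht.1)]
  push_cast
  have : (0 : ℝ) < 2 ^ k := by positivity
  nlinarith [ht.2]

theorem floor_two_pow_le {k l : ℕ} (h : k ≤ l) (t : ℝ) :
    ⌊(2 : ℝ) ^ k * t⌋₊ = ⌊(2 : ℝ) ^ l * t⌋₊ / 2 ^ (l - k) := by
  have := Nat.floor_div_natCast ((2 : ℝ) ^ l * t) (2 ^ (l - k))
  rw [← this]
  congr 1
  obtain ⟨d, rfl⟩ := Nat.exists_eq_add_of_le h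
  have : (0 : ℝ) < 2 ^ d := by positivity
  push_cast
  rw [Nat.add_sub_cancel_left, pow_add]
  field_simp

theorem floor_two_pow_snap {k l : ℕ} (h : k ≤ l) (t : ℝ) :
    ⌊(2 : ℝ) ^ k * snap l t⌋₊ = ⌊(2 : ℝ) ^ k * t⌋₊ := by
  rw [floor_two_pow_le h, floor_two_pow_le h t]
  congr 1
  have : (2 : ℝ) ^ l * snap l t = (⌊(2 : ℝ) ^ l * t⌋₊ : ℝ) := by unfold snap; field_simp
  rw [this, Nat.floor_natCast]

theorem snap_mem (k : ℕ) {t : ℝ} (ht : t ∈ Set.Ico (0 : ℝ) 1) :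
    snap k t ∈ Set.Ico (0 : ℝ) 1 := by
  refine ⟨by unfold snap; positivity, ?_⟩
  unfold snap
  rw [div_lt_one (by positivity)]
  exact_mod_cast floor_lt_two_pow k ht

theorem snap_snap {k l : ℕ} (h : k ≤ l) (t : ℝ) : snap k (snap l t) = snap k t := by
  unfold snap
  rw [show (⌊(2 : ℝ) ^ l * t⌋₊ : ℝ) / 2 ^ l = snap l t from rfl, floor_two_pow_snap h t]

theorem natCast_div_mem {k j : ℕ} (hj : j < 2 ^ k) : (j : ℝ) / 2 ^ k ∈ Set.Ico (0 : ℝ) 1 := by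
  refine ⟨by positivity, ?_⟩
  rw [div_lt_one (by positivity)]
  exact_mod_cast hj

theorem floor_natCast_div (k j : ℕ) : ⌊(2 : ℝ) ^ k * ((j : ℝ) / 2 ^ k)⌋₊ = j := by
  rw [mul_div_cancel₀ _ (by positivity), Nat.floor_natCast]

namespace ConstAtLevel

variable {α β γ : Type*} {k l : ℕ}

theorem mono {f : ℝ → α} (hf : ConstAtLevel k f) (h : k ≤ l) : ConstAtLevel l f := by
  intro t ht
  rw [← hf _ (snap_mem l ht), snap_snap h t, hf t ht]

theorem map {f : ℝ → α} (hf : ConstAtLevel k f) (F : α → β) :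
    ConstAtLevel k (fun t => F (f t)) := by
  intro t ht
  simp only [hf t ht]

theorem map₂ {f : ℝ → α} {g : ℝ → β} (hf : ConstAtLevel k f) (hg : ConstAtLevel k g)
    (F : α → β → γ) : ConstAtLevel k (fun t => F (f t) (g t)) := by
  intro t ht
  simp only [hf t ht, hg t ht]

theorem mul {f g : ℝ → ℝ} (hf : ConstAtLevel k f) (hg : ConstAtLevel k g) :
    ConstAtLevel k (fun t => f t * g t) := hf.map₂ hg (· * ·)

theorem add {f g : ℝ → ℝ} (hf : ConstAtLevel k f) (hg : ConstAtLevel k g) :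
    ConstAtLevel k (fun t => f t + g t) := hf.map₂ hg (· + ·)

theorem sum {ι : Type*} {s : Finset ι} {f : ι → ℝ → ℝ} (hf : ∀ i ∈ s, ConstAtLevel k (f i)) :
    ConstAtLevel k (fun t => ∑ i ∈ s, f i t) := fun t ht =>
  Finset.sum_congr rfl fun i hi => hf i hi t ht

theorem const (c : α) : ConstAtLevel k (fun _ => c) := fun _ _ => rfl

end ConstAtLevel

theorem constAtLevel_floor (k : ℕ) : ConstAtLevel k (fun t => ⌊(2 : ℝ) ^ k * t⌋₊) :=
  fun t _ => floor_two_pow_snap le_rfl t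

theorem constAtLevel_rademacher (k : ℕ) : ConstAtLevel (k + 1) (rademacher k) :=
  (constAtLevel_floor (k + 1)).map fun n => if n % 2 = 0 then (1 : ℝ) else -1

theorem measurableSet_dint (q : ℕ × ℕ) : MeasurableSet (dint q) := measurableSet_Ico

theorem dint_subset {k j : ℕ} (hj : j < 2 ^ k) : dint (k, j) ⊆ Set.Ico 0 1 := by
  rintro t ⟨h, h'⟩
  refine ⟨le_trans (by positivity) h, lt_of_lt_of_le h' ?_⟩
  rw [div_le_one (by positivity)]
  exact_mod_cast hj

theorem ConstAtLevel.eqOn_sum {k : ℕ} {f : ℝ → ℝ} (hf : ConstAtLevel k f) :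
    Set.EqOn f (fun t => ∑ j ∈ Finset.range (2 ^ k),
      (dint (k, j)).indicator (fun _ => f ((j : ℝ) / 2 ^ k)) t) (Set.Ico 0 1) := by
  intro t ht
  simp only
  rw [Finset.sum_eq_single_of_mem ⌊(2 : ℝ) ^ k * t⌋₊
    (Finset.mem_range.2 (floor_lt_two_pow k ht))]
  · rw [Set.indicator_of_mem (mem_dint_iff.2 ⟨ht.1, rfl⟩)]
    exact (hf t ht).symm
  · intro j _ hj
    exact Set.indicator_of_notMem (fun h => hj (mem_dint_iff.1 h).2.symm) _

theorem ConstAtLevel.integrableOn {k : ℕ} {f : ℝ → ℝ} (hf : ConstAtLevel k f) :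
    IntegrableOn f (Set.Ico 0 1) := by
  refine IntegrableOn.congr_fun ?_ hf.eqOn_sum.symm measurableSet_Ico
  refine integrable_finsetSum _ fun j _ => ?_
  exact (integrable_const _).indicator (measurableSet_dint _)

theorem ConstAtLevel.setIntegral_eq {k : ℕ} {f : ℝ → ℝ} (hf : ConstAtLevel k f) :
    ∫ t in Set.Ico (0 : ℝ) 1, f t
      = ((2 : ℝ) ^ k)⁻¹ * ∑ j ∈ Finset.range (2 ^ k), f ((j : ℝ) / 2 ^ k) := by
  rw [setIntegral_congr_fun measurableSet_Ico hf.eqOn_sum, integral_finsetSum, Finset.mul_sum]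
  · refine Finset.sum_congr rfl fun j hj => ?_
    rw [setIntegral_indicator (measurableSet_dint _),
      Set.inter_eq_right.2 (dint_subset (Finset.mem_range.1 hj)), setIntegral_const]
    simp only [dint, smul_eq_mul]
    rw [Real.volume_real_Ico_of_le (by gcongr; simp)]
    congr 1
    field_simp
    ring
  · intro j _
    exact (integrable_const _).indicator (measurableSet_dint _)

theorem ConstAtLevel.setIntegral_mul_rademacher {k : ℕ} {f : ℝ → ℝ} (hf : ConstAtLevel k f) :
    ∫ t in Set.Ico (0 : ℝ) 1, f t * rademacher k t = 0 := by
  rw [((hf.mono k.le_succ).mul (constAtLevel_rademacher k)).setIntegral_eq]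
  refine mul_eq_zero_of_right _ ?_
  have key : ∀ M ≤ 2 ^ k, ∑ j ∈ Finset.range (2 * M),
      f ((j : ℝ) / 2 ^ (k + 1)) * rademacher k ((j : ℝ) / 2 ^ (k + 1)) = 0 := by
    intro M
    induction M with
    | zero => simp
    | succ M ih =>
      intro hM
      have e : snap k (((2 * M : ℕ) : ℝ) / 2 ^ (k + 1))
          = snap k (((2 * M + 1 : ℕ) : ℝ) / 2 ^ (k + 1)) := by
        unfold snap
        rw [floor_two_pow_le k.le_succ, floor_two_pow_le k.le_succ (_ / _),
          floor_natCast_div, floor_natCast_div]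
        congr 2
        rw [Nat.succ_sub (le_refl k), Nat.sub_self, pow_succ, pow_zero]
        omega
      have h1 : 2 * M + 1 < 2 ^ (k + 1) := by rw [pow_succ]; omega
      rw [mul_add, mul_one, Finset.sum_range_succ, Finset.sum_range_succ, ih (by omega),
        ← hf _ (natCast_div_mem (k := k + 1) (j := 2 * M) (by omega)),
        ← hf _ (natCast_div_mem (k := k + 1) h1), e]
      unfold rademacher
      rw [floor_natCast_div, floor_natCast_div]
      simp [Nat.add_mod]
  have := key (2 ^ k) le_rfl
  rwa [show 2 * 2 ^ k = 2 ^ (k + 1) by ring] at this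

/-- Rademacher functions with lower-level coefficients are orthogonal. -/
theorem setIntegral_rademacher_mul_rademacher {k l : ℕ} (h : k ≠ l) {u v : ℝ → ℝ}
    (hu : ConstAtLevel k u) (hv : ConstAtLevel l v) :
    ∫ t in Set.Ico (0 : ℝ) 1, (u t * rademacher k t) * (v t * rademacher l t) = 0 := by
  rcases lt_or_gt_of_ne h with h | h
  · have := ConstAtLevel.setIntegral_mul_rademacher
      ((((hu.mono k.le_succ).mul (constAtLevel_rademacher k)).mono h).mul hv)
    simpa only [mul_assoc] using this
  · have := ConstAtLevel.setIntegral_mul_rademacher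
      (hu.mul (((hv.mono l.le_succ).mul (constAtLevel_rademacher l)).mono h))
    simpa only [mul_assoc, mul_comm, mul_left_comm] using this

theorem ip_congr {f f' g g' : ℝ → ℝ} (hf : Set.EqOn f f' (Set.Ico 0 1))
    (hg : Set.EqOn g g' (Set.Ico 0 1)) : ip f g = ip f' g' :=
  setIntegral_congr_fun measurableSet_Ico fun t ht => by simp only [hf ht, hg ht]

theorem ConstAtLevel.integrableOn_rademacher_mul_rademacher {k l : ℕ} {u v : ℝ → ℝ}
    (hu : ConstAtLevel k u) (hv : ConstAtLevel l v) :
    IntegrableOn (fun t => (u t * rademacher k t) * (v t * rademacher l t)) (Set.Ico 0 1) :=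
  ConstAtLevel.integrableOn (k := max (k + 1) (l + 1))
    ((((hu.mono k.le_succ).mul (constAtLevel_rademacher k)).mono (le_max_left _ _)).mul
      (((hv.mono l.le_succ).mul (constAtLevel_rademacher l)).mono (le_max_right _ _)))

section RademacherSum

variable {s : Finset ℕ} {K : ℕ → ℕ} {a : ℕ → ℝ → ℝ} {f w v : ℝ → ℝ} {l : ℕ}

theorem ip_sum_rademacher (ha : ∀ i, ConstAtLevel (K i) (a i))
    (hf : Set.EqOn f (fun t => ∑ i ∈ s, a i t * rademacher (K i) t) (Set.Ico 0 1))
    (hv : ConstAtLevel l v)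
    (hw : Set.EqOn w (fun t => v t * rademacher l t) (Set.Ico 0 1)) :
    ip f w = ∑ i ∈ s, ∫ t in Set.Ico (0 : ℝ) 1,
      (a i t * rademacher (K i) t) * (v t * rademacher l t) := by
  rw [ip_congr hf hw, ip]
  simp only [Finset.sum_mul]
  exact integral_finsetSum _ fun i _ => (ha i).integrableOn_rademacher_mul_rademacher hv

theorem ip_sum_rademacher_of_mem (hK : Function.Injective K) (ha : ∀ i, ConstAtLevel (K i) (a i))
    (hf : Set.EqOn f (fun t => ∑ i ∈ s, a i t * rademacher (K i) t) (Set.Ico 0 1))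
    {i : ℕ} (hi : i ∈ s) (hv : ConstAtLevel (K i) v)
    (hw : Set.EqOn w (fun t => v t * rademacher (K i) t) (Set.Ico 0 1)) :
    ip f w = ∫ t in Set.Ico (0 : ℝ) 1, a i t * v t := by
  rw [ip_sum_rademacher ha hf hv hw, Finset.sum_eq_single_of_mem i hi]
  · congr 1; ext t
    linear_combination a i t * v t * rademacher_mul_self (K i) t
  · intro j _ hj
    exact setIntegral_rademacher_mul_rademacher (fun h => hj (hK h)) (ha j) hv

theorem ip_sum_rademacher_of_notMem (ha : ∀ i, ConstAtLevel (K i) (a i))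
    (hf : Set.EqOn f (fun t => ∑ i ∈ s, a i t * rademacher (K i) t) (Set.Ico 0 1))
    (hl : ∀ i ∈ s, K i ≠ l) (hv : ConstAtLevel l v)
    (hw : Set.EqOn w (fun t => v t * rademacher l t) (Set.Ico 0 1)) :
    ip f w = 0 := by
  rw [ip_sum_rademacher ha hf hv hw]
  exact Finset.sum_eq_zero fun j hj =>
    setIntegral_rademacher_mul_rademacher (hl j hj) (ha j) hv

end RademacherSum

theorem haarFn_apply (q : ℕ × ℕ) {t : ℝ} (ht : 0 ≤ t) :
    haarFn q t = (if ⌊(2 : ℝ) ^ q.1 * t⌋₊ = q.2 then 1 else 0) * rademacher q.1 t := by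
  obtain ⟨k, j⟩ := q
  have h1 : t ∈ Set.Ico ((j : ℝ) / 2 ^ k) ((2 * j + 1 : ℝ) / 2 ^ (k + 1)) ↔
      ⌊(2 : ℝ) ^ (k + 1) * t⌋₊ = 2 * j := by
    have := mem_dint_iff (q := (k + 1, 2 * j)) (t := t)
    simp only [ht, true_and] at this
    rw [← this, dint]
    simp only [Nat.cast_mul, Nat.cast_ofNat]
    rw [show (2 * (j : ℝ)) / 2 ^ (k + 1) = j / 2 ^ k by field_simp; ring]
  have h2 : t ∈ Set.Ico ((2 * j + 1 : ℝ) / 2 ^ (k + 1)) ((j + 1 : ℝ) / 2 ^ k) ↔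
      ⌊(2 : ℝ) ^ (k + 1) * t⌋₊ = 2 * j + 1 := by
    have := mem_dint_iff (q := (k + 1, 2 * j + 1)) (t := t)
    simp only [ht, true_and] at this
    rw [← this, dint]
    simp only [Nat.cast_mul, Nat.cast_ofNat, Nat.cast_add, Nat.cast_one]
    rw [show (2 * (j : ℝ) + 1 + 1) / 2 ^ (k + 1) = (j + 1) / 2 ^ k by field_simp; ring]
  have h3 := floor_two_pow_le k.le_succ t
  rw [Nat.succ_sub (le_refl k), Nat.sub_self, pow_one] at h3
  simp only [haarFn, rademacher, Pi.sub_apply, Set.indicator_apply, h1, h2, h3]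
  set m := ⌊(2 : ℝ) ^ (k + 1) * t⌋₊
  split_ifs <;> first | omega | norm_num

theorem haarFn_eq_zero {q : ℕ × ℕ} (hq : IsDyadic q) {t : ℝ} (ht : t ∉ Set.Ico (0 : ℝ) 1) :
    haarFn q t = 0 := by
  have hd : t ∉ dint q := fun h => ht (dint_subset hq h)
  have hm : (q.2 : ℝ) / 2 ^ q.1 ≤ (2 * q.2 + 1 : ℝ) / 2 ^ (q.1 + 1) := by
    rw [div_le_div_iff₀ (by positivity) (by positivity), pow_succ]
    nlinarith [pow_pos (two_pos : (0 : ℝ) < 2) q.1]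
  have hm' : (2 * q.2 + 1 : ℝ) / 2 ^ (q.1 + 1) ≤ (q.2 + 1 : ℝ) / 2 ^ q.1 := by
    rw [div_le_div_iff₀ (by positivity) (by positivity), pow_succ]
    nlinarith [pow_pos (two_pos : (0 : ℝ) < 2) q.1]
  simp only [haarFn, Pi.sub_apply]
  rw [Set.indicator_of_notMem, Set.indicator_of_notMem, sub_zero]
  · exact fun h => hd ⟨hm.trans h.1, h.2⟩
  · exact fun h => hd ⟨h.1, h.2.trans_le hm'⟩

/-- The coefficient of `f` at the dyadic interval of length `2^{-k}` containing `t`. -/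
def coef (k : ℕ) (f : ℝ → ℝ) (t : ℝ) : ℝ := haarCoeff f (k, ⌊(2 : ℝ) ^ k * t⌋₊) * 2 ^ k

theorem sqFn_eq (f : ℝ → ℝ) {t : ℝ} (ht : t ∈ Set.Ico (0 : ℝ) 1) :
    sqFn f t = Real.sqrt (∑' k, coef k f t ^ 2) := by
  let g : ℕ → Didx := fun k => ⟨(k, ⌊(2 : ℝ) ^ k * t⌋₊), floor_lt_two_pow k ht⟩
  have hg : Function.Injective g := fun k l h => congrArg (fun q : Didx => q.1.1) h
  unfold sqFn
  rw [← hg.tsum_eq]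
  · congr 2
    ext k
    rw [Set.indicator_of_mem (mem_dint_iff.2 ⟨ht.1, rfl⟩), mul_one]
    rfl
  · rintro ⟨⟨k, j⟩, hq⟩ h
    have ht' : t ∈ dint (k, j) := by
      by_contra hn
      refine h ?_
      change _ * (dint (k, j)).indicator (fun _ => (1 : ℝ)) t = 0
      rw [Set.indicator_of_notMem hn, mul_zero]
    refine ⟨k, Subtype.ext ?_⟩
    simp [g, (mem_dint_iff.1 ht').2]

section RademacherSum

variable {s : Finset ℕ} {K : ℕ → ℕ} {a : ℕ → ℝ → ℝ} {f : ℝ → ℝ} {t : ℝ}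

theorem haarFn_eqOn (k j : ℕ) : Set.EqOn (haarFn (k, j))
    (fun t => (if ⌊(2 : ℝ) ^ k * t⌋₊ = j then (1 : ℝ) else 0) * rademacher k t) (Set.Ico 0 1) :=
  fun _ ht => haarFn_apply (k, j) ht.1

theorem constAtLevel_floor_eq (k j : ℕ) :
    ConstAtLevel k (fun t => if ⌊(2 : ℝ) ^ k * t⌋₊ = j then (1 : ℝ) else 0) :=
  (constAtLevel_floor k).map fun m => if m = j then (1 : ℝ) else 0

theorem coef_of_mem (hK : Function.Injective K) (ha : ∀ i, ConstAtLevel (K i) (a i))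
    (hf : Set.EqOn f (fun t => ∑ i ∈ s, a i t * rademacher (K i) t) (Set.Ico 0 1))
    {i : ℕ} (hi : i ∈ s) (ht : t ∈ Set.Ico (0 : ℝ) 1) : coef (K i) f t = a i t := by
  have hj := floor_lt_two_pow (K i) ht
  rw [coef, haarCoeff, ip_sum_rademacher_of_mem hK ha hf hi (constAtLevel_floor_eq _ _)
    (haarFn_eqOn _ _), ((ha i).mul (constAtLevel_floor_eq _ _)).setIntegral_eq,
    Finset.sum_eq_single_of_mem _ (Finset.mem_range.2 hj)]
  · rw [floor_natCast_div, if_pos rfl, mul_one, ← ha i t ht, snap]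
    field_simp
  · intro j _ hne
    rw [floor_natCast_div, if_neg hne, mul_zero]

theorem coef_of_notMem (ha : ∀ i, ConstAtLevel (K i) (a i))
    (hf : Set.EqOn f (fun t => ∑ i ∈ s, a i t * rademacher (K i) t) (Set.Ico 0 1))
    {l : ℕ} (hl : ∀ i ∈ s, K i ≠ l) : coef l f t = 0 := by
  rw [coef, haarCoeff, ip_sum_rademacher_of_notMem ha hf hl (constAtLevel_floor_eq _ _)
    (haarFn_eqOn _ _), zero_mul]

theorem sqFn_sum_rademacher (hK : Function.Injective K) (ha : ∀ i, ConstAtLevel (K i) (a i))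
    (hf : Set.EqOn f (fun t => ∑ i ∈ s, a i t * rademacher (K i) t) (Set.Ico 0 1))
    (ht : t ∈ Set.Ico (0 : ℝ) 1) : sqFn f t = Real.sqrt (∑ i ∈ s, a i t ^ 2) := by
  rw [sqFn_eq f ht, tsum_eq_sum (s := s.image K), Finset.sum_image fun i _ j _ h => hK h]
  · congr 1
    exact Finset.sum_congr rfl fun i hi => by rw [coef_of_mem hK ha hf hi ht]
  · intro l hl
    rw [coef_of_notMem ha hf, zero_pow two_ne_zero]
    exact fun i hi h => hl (Finset.mem_image.2 ⟨i, hi, h⟩)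

theorem H1norm_sum_rademacher (hK : Function.Injective K) (ha : ∀ i, ConstAtLevel (K i) (a i))
    (hf : Set.EqOn f (fun t => ∑ i ∈ s, a i t * rademacher (K i) t) (Set.Ico 0 1)) :
    H1norm f = ∫ t in Set.Ico (0 : ℝ) 1, Real.sqrt (∑ i ∈ s, a i t ^ 2) :=
  setIntegral_congr_fun measurableSet_Ico fun _ ht => sqFn_sum_rademacher hK ha hf ht

end RademacherSum

end DyadicH

namespace DyadicH

theorem sqrt_sum_sq_setIntegral_le {k : ℕ} {s : Finset ℕ} {g : ℕ → ℝ → ℝ}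
    (hg : ∀ i ∈ s, ConstAtLevel k (g i)) :
    Real.sqrt (∑ i ∈ s, (∫ t in Set.Ico (0 : ℝ) 1, g i t) ^ 2)
      ≤ ∫ t in Set.Ico (0 : ℝ) 1, Real.sqrt (∑ i ∈ s, g i t ^ 2) := by
  set v : ℕ → ℝ := fun i => ∫ t in Set.Ico (0 : ℝ) 1, g i t
  set V := Real.sqrt (∑ i ∈ s, v i ^ 2)
  have hV : V * V = ∑ i ∈ s, v i ^ 2 :=
    Real.mul_self_sqrt (Finset.sum_nonneg fun i _ => sq_nonneg _)
  have hV0 : 0 ≤ V := Real.sqrt_nonneg _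
  have hI : 0 ≤ ∫ t in Set.Ico (0 : ℝ) 1, Real.sqrt (∑ i ∈ s, g i t ^ 2) :=
    integral_nonneg fun t => Real.sqrt_nonneg _
  have hsq : ConstAtLevel k (fun t => Real.sqrt (∑ i ∈ s, g i t ^ 2)) :=
    (ConstAtLevel.sum fun i hi => (hg i hi).map (· ^ 2)).map Real.sqrt
  have key : V * V ≤ V * ∫ t in Set.Ico (0 : ℝ) 1, Real.sqrt (∑ i ∈ s, g i t ^ 2) := by
    have e : V * V = ∫ t in Set.Ico (0 : ℝ) 1, ∑ i ∈ s, v i * g i t := by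
      rw [hV, integral_finsetSum _ fun i hi => ((hg i hi).integrableOn.const_mul _)]
      refine Finset.sum_congr rfl fun i _ => ?_
      rw [integral_const_mul, sq]
    rw [e, ← integral_const_mul]
    refine setIntegral_mono ?_ ?_ fun t => ?_
    · exact integrable_finsetSum _ fun i hi => ((hg i hi).integrableOn.const_mul _)
    · exact hsq.integrableOn.const_mul _
    · exact Real.sum_mul_le_sqrt_mul_sqrt s v fun i => g i t
  rcases hV0.eq_or_lt with h | h
  · rw [← h]; exact hI
  · exact le_of_mul_le_mul_left key h

theorem exists_rademacher_expansion {N : ℕ} {f : ℝ → ℝ} (hf : f ∈ haarSpanLe N) :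
    ∃ a : ℕ → ℝ → ℝ, (∀ k, ConstAtLevel k (a k)) ∧
      Set.EqOn f (fun t => ∑ k ∈ Finset.range (N + 1), a k t * rademacher k t)
        (Set.Ico 0 1) := by
  induction hf using Submodule.span_induction with
  | mem f hf =>
    obtain ⟨⟨k, j⟩, ⟨-, hk⟩, rfl⟩ := hf
    refine ⟨fun l t => if l = k then (if ⌊(2 : ℝ) ^ l * t⌋₊ = j then 1 else 0) else 0,
      fun l => (constAtLevel_floor_eq l j).map fun x => if l = k then x else 0, fun t ht => ?_⟩
    simp only
    rw [haarFn_eqOn k j ht,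
      Finset.sum_eq_single_of_mem k (Finset.mem_range.2 (Nat.lt_succ_iff.2 hk))]
    · simp
    · intro l _ hl
      simp [hl]
  | zero => exact ⟨fun _ _ => 0, fun _ => ConstAtLevel.const 0, fun t _ => by simp⟩
  | add f g _ _ hf hg =>
    obtain ⟨a, ha, hf⟩ := hf
    obtain ⟨b, hb, hg⟩ := hg
    refine ⟨fun k t => a k t + b k t, fun k => (ha k).add (hb k), fun t ht => ?_⟩
    simp only [Pi.add_apply, hf ht, hg ht, add_mul, Finset.sum_add_distrib]
  | smul c f _ hf =>
    obtain ⟨a, ha, hf⟩ := hf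
    refine ⟨fun k t => c * a k t, fun k => (ha k).map (c * ·), fun t ht => ?_⟩
    simp only [Pi.smul_apply, smul_eq_mul, hf ht, Finset.mul_sum, mul_assoc]

theorem constAtLevel_coef (k : ℕ) (f : ℝ → ℝ) : ConstAtLevel k (coef k f) :=
  (constAtLevel_floor k).map fun j => haarCoeff f (k, j) * 2 ^ k

section HaarSpan

variable {N : ℕ} {f g : ℝ → ℝ}

theorem eqOn_sum_coef (hf : f ∈ haarSpanLe N) :
    Set.EqOn f (fun t => ∑ k ∈ Finset.range (N + 1), coef k f t * rademacher k t)
      (Set.Ico 0 1) := by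
  obtain ⟨a, ha, h⟩ := exists_rademacher_expansion hf
  intro t ht
  rw [h ht]
  exact Finset.sum_congr rfl fun k hk => by
    rw [coef_of_mem (K := fun k => k) Function.injective_id ha h hk ht]

theorem H1norm_eq (hf : f ∈ haarSpanLe N) :
    H1norm f = ∫ t in Set.Ico (0 : ℝ) 1,
      Real.sqrt (∑ k ∈ Finset.range (N + 1), coef k f t ^ 2) :=
  H1norm_sum_rademacher (K := fun k => k) Function.injective_id (fun k => constAtLevel_coef k f)
    (eqOn_sum_coef hf)

theorem coef_add (hf : f ∈ haarSpanLe N) (hg : g ∈ haarSpanLe N) {k : ℕ}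
    (hk : k ∈ Finset.range (N + 1)) {t : ℝ} (ht : t ∈ Set.Ico (0 : ℝ) 1) :
    coef k (f + g) t = coef k f t + coef k g t := by
  refine coef_of_mem (K := fun k => k) (a := fun k t => coef k f t + coef k g t)
    Function.injective_id
    (fun k => (constAtLevel_coef k f).add (constAtLevel_coef k g)) (fun t ht => ?_) hk ht
  simp only [Pi.add_apply, eqOn_sum_coef hf ht, eqOn_sum_coef hg ht, add_mul,
    Finset.sum_add_distrib]

theorem coef_smul (c : ℝ) (k : ℕ) (t : ℝ) : coef k (c • f) t = c * coef k f t := by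
  simp only [coef, haarCoeff, ip, Pi.smul_apply, smul_eq_mul, mul_assoc, integral_const_mul]

theorem constAtLevel_sqrt_sum_sq {s : Finset ℕ} {K : ℕ} {a : ℕ → ℝ → ℝ}
    (ha : ∀ k ∈ s, ConstAtLevel K (a k)) :
    ConstAtLevel K (fun t => Real.sqrt (∑ k ∈ s, a k t ^ 2)) :=
  (ConstAtLevel.sum fun k hk => (ha k hk).map (· ^ 2)).map Real.sqrt

theorem constAtLevel_coef_of_mem (f : ℝ → ℝ) :
    ∀ k ∈ Finset.range (N + 1), ConstAtLevel N (coef k f) := fun k hk =>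
  (constAtLevel_coef k f).mono (Nat.lt_succ_iff.1 (Finset.mem_range.1 hk))

theorem H1norm_nonneg (f : ℝ → ℝ) : 0 ≤ H1norm f :=
  integral_nonneg fun _ => Real.sqrt_nonneg _

theorem sqrt_sum_add_sq_le (s : Finset ℕ) (a b : ℕ → ℝ) :
    Real.sqrt (∑ i ∈ s, (a i + b i) ^ 2)
      ≤ Real.sqrt (∑ i ∈ s, a i ^ 2) + Real.sqrt (∑ i ∈ s, b i ^ 2) := by
  have := Real.Lp_add_le s a b (p := 2) (by norm_num)
  simpa only [Real.sqrt_eq_rpow, Real.rpow_two, sq_abs] using this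

theorem H1norm_add_le (hf : f ∈ haarSpanLe N) (hg : g ∈ haarSpanLe N) :
    H1norm (f + g) ≤ H1norm f + H1norm g := by
  have hf' := (constAtLevel_sqrt_sum_sq (constAtLevel_coef_of_mem (N := N) f)).integrableOn
  have hg' := (constAtLevel_sqrt_sum_sq (constAtLevel_coef_of_mem (N := N) g)).integrableOn
  rw [H1norm_eq hf, H1norm_eq hg, H1norm_eq (Submodule.add_mem _ hf hg), ← integral_add hf' hg']
  refine setIntegral_mono_on
    (constAtLevel_sqrt_sum_sq (constAtLevel_coef_of_mem (N := N) (f + g))).integrableOn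
    (hf'.add hg') measurableSet_Ico fun t ht => ?_
  rw [Finset.sum_congr rfl fun k hk => by rw [coef_add hf hg hk ht]]
  exact sqrt_sum_add_sq_le _ _ _

theorem H1norm_smul (hf : f ∈ haarSpanLe N) (c : ℝ) : H1norm (c • f) = |c| * H1norm f := by
  rw [H1norm_eq hf, H1norm_eq (Submodule.smul_mem _ c hf), ← integral_const_mul]
  congr 1; ext t
  simp only [coef_smul, mul_pow, ← Finset.mul_sum]
  rw [Real.sqrt_mul (sq_nonneg c), Real.sqrt_sq_eq_abs]

/-- The `L¹` norm of the level-`k` part of `f`. -/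
def levelNorm (k : ℕ) (f : ℝ → ℝ) : ℝ := ∫ t in Set.Ico (0 : ℝ) 1, |coef k f t|

theorem levelNorm_nonneg (k : ℕ) (f : ℝ → ℝ) : 0 ≤ levelNorm k f :=
  integral_nonneg fun _ => abs_nonneg _

theorem levelNorm_add_le (hf : f ∈ haarSpanLe N) (hg : g ∈ haarSpanLe N) {k : ℕ}
    (hk : k ∈ Finset.range (N + 1)) :
    levelNorm k (f + g) ≤ levelNorm k f + levelNorm k g := by
  have hf' := ((constAtLevel_coef k f).map abs).integrableOn
  have hg' := ((constAtLevel_coef k g).map abs).integrableOn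
  rw [levelNorm, levelNorm, levelNorm, ← integral_add hf' hg']
  refine setIntegral_mono_on ((constAtLevel_coef k (f + g)).map abs).integrableOn
    (hf'.add hg') measurableSet_Ico fun t ht => ?_
  rw [coef_add hf hg hk ht]
  exact abs_add_le _ _

theorem levelNorm_smul (c : ℝ) (k : ℕ) : levelNorm k (c • f) = |c| * levelNorm k f := by
  simp only [levelNorm, coef_smul, abs_mul, integral_const_mul]

theorem sum_sq_levelNorm_le (hf : f ∈ haarSpanLe N) :
    ∑ k ∈ Finset.range (N + 1), levelNorm k f ^ 2 ≤ H1norm f ^ 2 := by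
  have := sqrt_sum_sq_setIntegral_le fun k hk => (constAtLevel_coef_of_mem (N := N) f k hk).map abs
  simp only [sq_abs] at this
  rw [← H1norm_eq hf, Real.sqrt_le_left (H1norm_nonneg f)] at this
  exact this

theorem eq_zero_of_H1norm_eq_zero (hf : f ∈ haarSpanLe N) (h : H1norm f = 0) : f = 0 := by
  have hzero : ∀ k ∈ Finset.range (N + 1), levelNorm k f = 0 := by
    intro k hk
    have h1 := sum_sq_levelNorm_le hf
    rw [h, zero_pow two_ne_zero] at h1
    have h2 := Finset.single_le_sum (f := fun k => levelNorm k f ^ 2)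
      (fun k _ => sq_nonneg _) hk
    exact pow_eq_zero_iff two_ne_zero |>.1 (le_antisymm (h2.trans h1) (sq_nonneg _))
  ext t
  by_cases ht : t ∈ Set.Ico (0 : ℝ) 1
  · rw [eqOn_sum_coef hf ht]
    refine Finset.sum_eq_zero fun k hk => ?_
    have h1 := hzero k hk
    rw [levelNorm, ((constAtLevel_coef k f).map abs).setIntegral_eq, mul_eq_zero,
      or_iff_right (by positivity), Finset.sum_eq_zero_iff_of_nonneg fun _ _ => abs_nonneg _] at h1
    have h2 := h1 _ (Finset.mem_range.2 (floor_lt_two_pow k ht))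
    have h3 := constAtLevel_coef k f t ht
    rw [snap] at h3
    rw [← h3, abs_eq_zero.1 h2, zero_mul]
  · have : ∀ f ∈ haarSpanLe N, f t = 0 := by
      intro f hf
      induction hf using Submodule.span_induction with
      | mem f hf =>
        obtain ⟨q, hq, rfl⟩ := hf
        exact haarFn_eq_zero hq.1 ht
      | zero => rfl
      | add f g _ _ hf hg => simp [hf, hg]
      | smul c f _ hf => simp [hf]
    exact this f hf

instance finiteDimensional_haarSpanLe (N : ℕ) : FiniteDimensional ℝ (haarSpanLe N) := by
  refine FiniteDimensional.span_of_finite ℝ (Set.Finite.image _ ?_)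
  refine Set.Finite.subset (Set.finite_Icc ((0, 0) : ℕ × ℕ) (N, 2 ^ N)) ?_
  rintro ⟨k, j⟩ ⟨h, hk⟩
  exact ⟨⟨Nat.zero_le _, Nat.zero_le _⟩, hk,
    h.le.trans (Nat.pow_le_pow_right two_pos hk)⟩

end HaarSpan

theorem exists_maximal_separated (X : Type*) [NormedAddCommGroup X] [NormedSpace ℝ X]
    [FiniteDimensional ℝ X] :
    ∃ T : Finset X, T.card ≤ 5 ^ Module.finrank ℝ X ∧ (∀ c ∈ T, ‖c‖ ≤ 2) ∧
      ∀ y : X, ‖y‖ ≤ 2 → ∃ c ∈ T, ‖y - c‖ ≤ 1 := by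
  classical
  let S : Set (Finset X) := {T | (∀ c ∈ T, ‖c‖ ≤ 2) ∧
    ∀ c ∈ T, ∀ d ∈ T, c ≠ d → 1 ≤ ‖c - d‖}
  have hcard : ∀ T ∈ S, T.card ≤ 5 ^ Module.finrank ℝ X := fun T hT =>
    Besicovitch.card_le_of_separated T hT.1 hT.2
  obtain ⟨T, hT, hmax⟩ := (measure fun T : Finset X => 5 ^ Module.finrank ℝ X - T.card).wf.has_min
    S ⟨∅, by simp [S]⟩
  refine ⟨T, hcard T hT, hT.1, fun y hy => ?_⟩
  by_contra! h
  have hyT : y ∉ T := fun hyT => by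
    have := h y hyT
    simp at this
    linarith
  have hins : insert y T ∈ S := by
    refine ⟨fun c hc => ?_, fun c hc d hd hcd => ?_⟩
    · rcases Finset.mem_insert.1 hc with rfl | hc
      exacts [hy, hT.1 c hc]
    · rcases Finset.mem_insert.1 hc with hcy | hcT <;>
        rcases Finset.mem_insert.1 hd with hdy | hdT
      · exact absurd (hcy.trans hdy.symm) hcd
      · rw [hcy]; exact (h d hdT).le
      · rw [hdy, norm_sub_rev]; exact (h c hcT).le
      · exact hT.2 c hcT d hdT hcd
  have h1 := hcard _ hins
  have h2 := hmax _ hins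
  rw [Finset.card_insert_of_notMem hyT] at h1
  refine h2 ?_
  change 5 ^ Module.finrank ℝ X - (insert y T).card < 5 ^ Module.finrank ℝ X - T.card
  rw [Finset.card_insert_of_notMem hyT]
  omega

/-- A square summable family of seminorms on a finite-dimensional normed space is uniformly small
outside a set whose size depends only on the dimension and the tolerance. -/
theorem exists_small_seminorms {X : Type*} [NormedAddCommGroup X] [NormedSpace ℝ X]
    [FiniteDimensional ℝ X] (s : Finset ℕ) (φ : ℕ → X → ℝ)
    (hadd : ∀ k ∈ s, ∀ x y, φ k (x + y) ≤ φ k x + φ k y)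
    (hsmul : ∀ k ∈ s, ∀ (c : ℝ) x, φ k (c • x) = |c| * φ k x)
    (hsum : ∀ x, ∑ k ∈ s, φ k x ^ 2 ≤ ‖x‖ ^ 2) {η : ℝ} (hη : 0 < η) :
    ∃ bad ⊆ s, (bad.card : ℝ) * η ^ 2 ≤ 4 * 5 ^ Module.finrank ℝ X ∧
      ∀ k ∈ s, k ∉ bad → ∀ x, φ k x ≤ η * ‖x‖ := by
  classical
  obtain ⟨T, hTcard, hT, hnet⟩ := exists_maximal_separated X
  refine ⟨T.biUnion fun c => {k ∈ s | η < φ k c}, ?_, ?_, ?_⟩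
  · exact Finset.biUnion_subset.2 fun c _ => Finset.filter_subset _ _
  · have hc : ∀ c ∈ T, (({k ∈ s | η < φ k c}.card : ℕ) : ℝ) * η ^ 2 ≤ 4 := by
      intro c hc
      calc (({k ∈ s | η < φ k c}.card : ℕ) : ℝ) * η ^ 2
          = ∑ k ∈ s with η < φ k c, η ^ 2 := by rw [Finset.sum_const, nsmul_eq_mul]
        _ ≤ ∑ k ∈ s with η < φ k c, φ k c ^ 2 := by
            refine Finset.sum_le_sum fun k hk => ?_
            have := (Finset.mem_filter.1 hk).2
            gcongr
        _ ≤ ∑ k ∈ s, φ k c ^ 2 :=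
            Finset.sum_le_sum_of_subset_of_nonneg (Finset.filter_subset _ _)
              fun _ _ _ => sq_nonneg _
        _ ≤ ‖c‖ ^ 2 := hsum c
        _ ≤ 4 := by nlinarith [hT c hc, norm_nonneg c]
    calc (((T.biUnion fun c => {k ∈ s | η < φ k c}).card : ℕ) : ℝ) * η ^ 2
        ≤ (∑ c ∈ T, (({k ∈ s | η < φ k c}.card : ℕ) : ℝ)) * η ^ 2 := by
          gcongr
          exact_mod_cast Finset.card_biUnion_le
      _ = ∑ c ∈ T, (({k ∈ s | η < φ k c}.card : ℕ) : ℝ) * η ^ 2 := Finset.sum_mul _ _ _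
      _ ≤ ∑ _c ∈ T, (4 : ℝ) := Finset.sum_le_sum hc
      _ = 4 * (T.card : ℝ) := by rw [Finset.sum_const, nsmul_eq_mul, mul_comm]
      _ ≤ 4 * 5 ^ Module.finrank ℝ X := by
          gcongr
          exact_mod_cast hTcard
  · intro k hk hbad x
    have hgood : ∀ c ∈ T, φ k c ≤ η := by
      intro c hc
      by_contra! h
      exact hbad (Finset.mem_biUnion.2 ⟨c, hc, Finset.mem_filter.2 ⟨hk, h⟩⟩)
    have hunit : ∀ j : ℕ, ∀ y : X, ‖y‖ ≤ 1 → φ k y ≤ η + (1 / 2) ^ j := by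
      intro j
      induction j with
      | zero =>
        intro y hy
        have h1 := (Finset.single_le_sum (f := fun k => φ k y ^ 2)
          (fun k _ => sq_nonneg _) hk).trans (hsum y)
        have h2 := abs_le_of_sq_le_sq h1 (norm_nonneg y)
        simp only [pow_zero]
        linarith [le_abs_self (φ k y)]
      | succ j ih =>
        intro y hy
        have h2y : ‖(2 : ℝ) • y‖ ≤ 2 := by
          rw [norm_smul, Real.norm_ofNat]; linarith
        obtain ⟨c, hc, hyc⟩ := hnet _ h2y
        have h1 := hadd k hk c ((2 : ℝ) • y - c)
        rw [add_sub_cancel, hsmul k hk, abs_two] at h1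
        have h2 := ih _ hyc
        have h3 := hgood c hc
        rw [pow_succ]
        linarith
    have hlim : ∀ y : X, ‖y‖ ≤ 1 → φ k y ≤ η := by
      intro y hy
      refine ge_of_tendsto' (f := fun j : ℕ => η + (1 / 2 : ℝ) ^ j) (x := Filter.atTop) ?_
        fun j => hunit j y hy
      simpa using (tendsto_pow_atTop_nhds_zero_of_lt_one (r := (1 / 2 : ℝ)) (by norm_num)
        (by norm_num)).const_add η
    rcases eq_or_ne x 0 with rfl | hx
    · have := hsmul k hk 0 0
      simp at this
      simp [this]
    · have hx' : 0 < ‖x‖ := norm_pos_iff.2 hx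
      have h1 := hlim (‖x‖⁻¹ • x) (by rw [norm_smul, norm_inv, norm_norm, inv_mul_cancel₀ hx'.ne'])
      rw [hsmul k hk, abs_of_pos (by positivity), inv_mul_le_iff₀ hx'] at h1
      linarith

theorem exists_small_levels {N : ℕ} {E : Submodule ℝ (ℝ → ℝ)} (hE : E ≤ haarSpanLe N) {η : ℝ}
    (hη : 0 < η) :
    ∃ bad ⊆ Finset.range (N + 1), (bad.card : ℝ) * η ^ 2 ≤ 4 * 5 ^ Module.finrank ℝ E ∧
      ∀ k ∈ Finset.range (N + 1), k ∉ bad → ∀ x ∈ E, levelNorm k x ≤ η * H1norm x := by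
  have hfd : FiniteDimensional ℝ E := Submodule.finiteDimensional_of_le hE
  let _ : Norm E := ⟨fun x => H1norm x⟩
  have core : NormedSpace.Core ℝ E :=
    { norm_nonneg := fun x => H1norm_nonneg x
      norm_smul := fun c x => H1norm_smul (hE x.2) c
      norm_triangle := fun x y => H1norm_add_le (hE x.2) (hE y.2)
      norm_eq_zero_iff := fun x => by
        refine ⟨fun h => Subtype.ext (eq_zero_of_H1norm_eq_zero (hE x.2) h), ?_⟩
        rintro rfl
        have := H1norm_smul (hE (0 : E).2) 0
        change H1norm 0 = 0
        simpa using this }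
  let _ : NormedAddCommGroup E := NormedAddCommGroup.ofCore core
  let _ : NormedSpace ℝ E := NormedSpace.ofCore core
  obtain ⟨bad, hsub, hcard, hgood⟩ := exists_small_seminorms (X := E) (Finset.range (N + 1))
    (fun k x => levelNorm k x)
    (fun k hk x y => levelNorm_add_le (hE x.2) (hE y.2) hk)
    (fun k _ c x => levelNorm_smul c k)
    (fun x => sum_sq_levelNorm_le (hE x.2)) hη
  exact ⟨bad, hsub, hcard, fun k hk hb x hx => hgood k hk hb ⟨x, hx⟩⟩

end DyadicH

namespace DyadicH

/-- The number whose binary digits are the digits of `t` at the places `K 0, …, K (i - 1)`. -/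
def digitCode (K : ℕ → ℕ) : ℕ → ℝ → ℕ
  | 0, _ => 0
  | i + 1, t => 2 * digitCode K i t + ⌊(2 : ℝ) ^ (K i + 1) * t⌋₊ % 2

section DigitCode

variable {K : ℕ → ℕ}

theorem digitCode_succ_div_two (K : ℕ → ℕ) (i : ℕ) (t : ℝ) :
    digitCode K (i + 1) t / 2 = digitCode K i t := by
  rw [digitCode]; omega

theorem digitCode_lt (K : ℕ → ℕ) (i : ℕ) (t : ℝ) : digitCode K i t < 2 ^ i := by
  induction i with
  | zero => simp [digitCode]
  | succ i ih => rw [digitCode, pow_succ]; omega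

theorem digitCode_add_div (K : ℕ → ℕ) (i d : ℕ) (t : ℝ) :
    digitCode K (i + d) t / 2 ^ d = digitCode K i t := by
  induction d with
  | zero => simp
  | succ d ih => rw [pow_succ', ← Nat.div_div_eq_div_mul, ← add_assoc, digitCode_succ_div_two, ih]

theorem constAtLevel_digitCode (hK : StrictMono K) (i : ℕ) :
    ConstAtLevel (K i) (digitCode K i) := by
  induction i with
  | zero => exact ConstAtLevel.const 0
  | succ i ih =>
    have h : K i + 1 ≤ K (i + 1) := hK i.lt_succ_self
    exact (ih.mono (Nat.le_of_succ_le h)).map₂ ((constAtLevel_floor (K i + 1)).mono h)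
      fun a b => 2 * a + b % 2

/-- The indicator function of the set where `digitCode K i` equals `m`. -/
def codeInd (K : ℕ → ℕ) (i m : ℕ) (t : ℝ) : ℝ := if digitCode K i t = m then 1 else 0

theorem constAtLevel_codeInd (hK : StrictMono K) (i m : ℕ) :
    ConstAtLevel (K i) (codeInd K i m) :=
  (constAtLevel_digitCode hK i).map fun j => if j = m then (1 : ℝ) else 0

theorem codeInd_nonneg (K : ℕ → ℕ) (i m : ℕ) (t : ℝ) : 0 ≤ codeInd K i m t := by
  unfold codeInd; split_ifs <;> norm_num

theorem codeInd_le_one (K : ℕ → ℕ) (i m : ℕ) (t : ℝ) : codeInd K i m t ≤ 1 := by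
  unfold codeInd; split_ifs <;> norm_num

theorem codeInd_mul_self (K : ℕ → ℕ) (i m : ℕ) (t : ℝ) :
    codeInd K i m t * codeInd K i m t = codeInd K i m t := by
  unfold codeInd; split_ifs <;> norm_num

theorem sum_codeInd (K : ℕ → ℕ) (i : ℕ) (t : ℝ) :
    ∑ m ∈ Finset.range (2 ^ i), codeInd K i m t = 1 := by
  unfold codeInd
  rw [Finset.sum_ite_eq, if_pos (Finset.mem_range.2 (digitCode_lt K i t))]

theorem codeInd_succ (K : ℕ → ℕ) (i m : ℕ) (t : ℝ) :
    codeInd K (i + 1) m t = 1 / 2 * codeInd K i (m / 2) t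
      + (-1) ^ m / 2 * (codeInd K i (m / 2) t * rademacher (K i) t) := by
  unfold codeInd rademacher
  rw [digitCode]
  set c := ⌊(2 : ℝ) ^ (K i + 1) * t⌋₊
  rcases Nat.even_or_odd m with hm | hm
  · rw [hm.neg_one_pow]
    have := Nat.even_iff.1 hm
    split_ifs <;> first | omega | norm_num
  · rw [hm.neg_one_pow]
    have := Nat.odd_iff.1 hm
    split_ifs <;> first | omega | norm_num

theorem setIntegral_mul_codeInd_succ (hK : StrictMono K) {i : ℕ} {u : ℝ → ℝ}
    (hu : ConstAtLevel (K i) u) (m : ℕ) :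
    ∫ t in Set.Ico (0 : ℝ) 1, u t * codeInd K (i + 1) m t
      = 1 / 2 * ∫ t in Set.Ico (0 : ℝ) 1, u t * codeInd K i (m / 2) t := by
  have hv := hu.mul (constAtLevel_codeInd hK i (m / 2))
  have h0 := hv.setIntegral_mul_rademacher
  have hr := ((hv.mono (K i).le_succ).mul (constAtLevel_rademacher (K i))).integrableOn
  calc ∫ t in Set.Ico (0 : ℝ) 1, u t * codeInd K (i + 1) m t
      = ∫ t in Set.Ico (0 : ℝ) 1, (1 / 2 * (u t * codeInd K i (m / 2) t)
          + (-1) ^ m / 2 * (u t * codeInd K i (m / 2) t * rademacher (K i) t)) := by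
        congr 1; ext t; rw [codeInd_succ]; ring
    _ = _ := by
        rw [integral_add (hv.integrableOn.const_mul _) (hr.const_mul _), integral_const_mul,
          integral_const_mul, h0, mul_zero, add_zero]

theorem setIntegral_mul_codeInd_add (hK : StrictMono K) {i : ℕ} {u : ℝ → ℝ}
    (hu : ConstAtLevel (K i) u) (d m : ℕ) :
    ∫ t in Set.Ico (0 : ℝ) 1, u t * codeInd K (i + d) m t
      = (1 / 2) ^ d * ∫ t in Set.Ico (0 : ℝ) 1, u t * codeInd K i (m / 2 ^ d) t := by
  induction d generalizing m with
  | zero => simp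
  | succ d ih =>
    rw [← add_assoc, setIntegral_mul_codeInd_succ hK
      (hu.mono (hK.monotone (Nat.le_add_right i d))), ih, Nat.div_div_eq_div_mul, pow_succ',
      pow_succ', mul_assoc]

theorem setIntegral_codeInd (hK : StrictMono K) {i m : ℕ} (hm : m < 2 ^ i) :
    ∫ t in Set.Ico (0 : ℝ) 1, codeInd K i m t = (1 / 2) ^ i := by
  have := setIntegral_mul_codeInd_add hK (i := 0) (u := fun _ => 1) (ConstAtLevel.const 1) i m
  simpa [Nat.div_eq_of_lt hm, codeInd, digitCode] using this

/-- The collections of dyadic intervals of length `2^{-K i}` that are determined by the digits at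
the places `K 0, …, K (i - 1)`. -/
def codeBlocks (K : ℕ → ℕ) (J : ℕ × ℕ) : Finset (ℕ × ℕ) :=
  ((Finset.range (2 ^ K J.1)).filter fun j : ℕ => digitCode K J.1 ((j : ℝ) / 2 ^ K J.1) = J.2).image
    fun j => (K J.1, j)

theorem mem_codeBlocks {J I : ℕ × ℕ} : I ∈ codeBlocks K J ↔
    I.1 = K J.1 ∧ I.2 < 2 ^ K J.1 ∧ digitCode K J.1 ((I.2 : ℝ) / 2 ^ K J.1) = J.2 := by
  obtain ⟨k, j⟩ := I
  simp only [codeBlocks, Finset.mem_image, Finset.mem_filter, Finset.mem_range, Prod.mk.injEq]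
  constructor
  · rintro ⟨j, ⟨h1, h2⟩, rfl, rfl⟩
    exact ⟨rfl, h1, h2⟩
  · rintro ⟨rfl, h1, h2⟩
    exact ⟨j, ⟨h1, h2⟩, rfl, rfl⟩

theorem floor_mem_codeBlocks_iff (hK : StrictMono K) {J : ℕ × ℕ} {t : ℝ}
    (ht : t ∈ Set.Ico (0 : ℝ) 1) :
    (K J.1, ⌊(2 : ℝ) ^ K J.1 * t⌋₊) ∈ codeBlocks K J ↔ digitCode K J.1 t = J.2 := by
  have := constAtLevel_digitCode hK J.1 t ht
  rw [snap] at this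
  simp [mem_codeBlocks, floor_lt_two_pow _ ht, this]

theorem mem_blockSet_codeBlocks (hK : StrictMono K) {J : ℕ × ℕ} {t : ℝ} :
    t ∈ blockSet (codeBlocks K) J ↔ t ∈ Set.Ico (0 : ℝ) 1 ∧ digitCode K J.1 t = J.2 := by
  simp only [blockSet, Set.mem_iUnion, exists_prop]
  constructor
  · rintro ⟨⟨k, j⟩, hI, ht⟩
    obtain ⟨h1, h2, -⟩ := mem_codeBlocks.1 hI
    simp only at h1 h2
    subst h1
    have ht' := dint_subset h2 ht
    refine ⟨ht', ?_⟩
    rw [← floor_mem_codeBlocks_iff hK ht', (mem_dint_iff.1 ht).2]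
    exact hI
  · rintro ⟨ht, h⟩
    exact ⟨_, (floor_mem_codeBlocks_iff hK ht).2 h, mem_dint_iff.2 ⟨ht.1, rfl⟩⟩

theorem blockFn_codeBlocks_eqOn (hK : StrictMono K) (J : ℕ × ℕ) :
    Set.EqOn (blockFn (codeBlocks K) J)
      (fun t => codeInd K J.1 J.2 t * rademacher (K J.1) t) (Set.Ico 0 1) := by
  intro t ht
  have hz : ∀ I ∈ codeBlocks K J, I ≠ (K J.1, ⌊(2 : ℝ) ^ K J.1 * t⌋₊) → haarFn I t = 0 := by
    intro I hI hne
    rw [haarFn_apply I ht.1, if_neg, zero_mul]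
    rintro h
    have h1 := (mem_codeBlocks.1 hI).1
    exact hne (Prod.ext h1 (by rw [← h, h1]))
  simp only [blockFn]
  by_cases h : digitCode K J.1 t = J.2
  · rw [Finset.sum_eq_single_of_mem _ ((floor_mem_codeBlocks_iff hK ht).2 h) hz,
      haarFn_apply _ ht.1, codeInd, if_pos rfl, if_pos h]
  · rw [codeInd, if_neg h, zero_mul]
    refine Finset.sum_eq_zero fun I hI => hz I hI ?_
    rintro rfl
    exact h ((floor_mem_codeBlocks_iff hK ht).1 hI)

theorem volume_blockSet_codeBlocks (hK : StrictMono K) {J : ℕ × ℕ} (hJ : IsDyadic J) :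
    (volume (blockSet (codeBlocks K) J)).toReal = (1 / 2) ^ J.1 := by
  have hmeas : MeasurableSet (blockSet (codeBlocks K) J) :=
    Finset.measurableSet_biUnion _ fun I _ => measurableSet_dint I
  have hsub : blockSet (codeBlocks K) J ⊆ Set.Ico 0 1 :=
    fun t ht => ((mem_blockSet_codeBlocks hK).1 ht).1
  have h1 : ∫ t in Set.Ico (0 : ℝ) 1, (blockSet (codeBlocks K) J).indicator (fun _ => (1 : ℝ)) t
      = (volume (blockSet (codeBlocks K) J)).toReal := by
    rw [setIntegral_indicator hmeas, Set.inter_eq_right.2 hsub, setIntegral_const, smul_eq_mul,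
      mul_one]
    rfl
  rw [← h1, ← setIntegral_codeInd hK hJ]
  refine setIntegral_congr_fun measurableSet_Ico fun t ht => ?_
  have hiff : t ∈ blockSet (codeBlocks K) J ↔ digitCode K J.1 t = J.2 := by
    rw [mem_blockSet_codeBlocks hK, and_iff_right ht]
  by_cases h : digitCode K J.1 t = J.2
  · simp [Set.indicator_of_mem (hiff.2 h), codeInd, h]
  · simp [Set.indicator_of_notMem (hiff.not.2 h), codeInd, h]

theorem mem_dFinset {n : ℕ} {J : ℕ × ℕ} : J ∈ dFinset n ↔ J.1 ≤ n ∧ J.2 < 2 ^ J.1 := by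
  obtain ⟨i, m⟩ := J
  simp [dFinset]

theorem sum_dFinset (n : ℕ) (F : ℕ × ℕ → ℝ) :
    ∑ J ∈ dFinset n, F J = ∑ i ∈ Finset.range (n + 1), ∑ m ∈ Finset.range (2 ^ i), F (i, m) := by
  rw [Finset.sum_sigma']
  refine Finset.sum_bij' (fun J _ => ⟨J.1, J.2⟩) (fun p _ => (p.1, p.2)) ?_ ?_ ?_ ?_ ?_
  · intro J hJ
    simpa [Nat.lt_succ_iff] using mem_dFinset.1 hJ
  · rintro ⟨i, m⟩ h
    exact mem_dFinset.2 (by simpa [Nat.lt_succ_iff] using h)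
  all_goals simp

/-- The average of the level-`K i` part of `f` over the set where `digitCode K i` equals `m`. -/
def blockAvg (K : ℕ → ℕ) (f : ℝ → ℝ) (i m : ℕ) : ℝ :=
  2 ^ i * ∫ t in Set.Ico (0 : ℝ) 1, coef (K i) f t * codeInd K i m t

theorem abs_blockAvg_le (hK : StrictMono K) (f : ℝ → ℝ) (i m : ℕ) :
    |blockAvg K f i m| ≤ 2 ^ i * levelNorm (K i) f := by
  rw [blockAvg, abs_mul, abs_of_pos (by positivity : (0 : ℝ) < 2 ^ i)]
  refine mul_le_mul_of_nonneg_left ?_ (by positivity)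
  refine (abs_integral_le_integral_abs).trans ?_
  have hc := constAtLevel_coef (K i) f
  refine integral_mono ((hc.mul (constAtLevel_codeInd hK i m)).map abs).integrableOn
    (hc.map abs).integrableOn fun t => ?_
  simp only [abs_mul, abs_of_nonneg (codeInd_nonneg K i m t)]
  exact mul_le_of_le_one_right (abs_nonneg _) (codeInd_le_one K i m t)

section Projection

variable {N n : ℕ} {f : ℝ → ℝ}

theorem ip_blockFn_div (hK : StrictMono K) (hf : f ∈ haarSpanLe N) {J : ℕ × ℕ}
    (hJ : IsDyadic J) (hJN : K J.1 ≤ N) :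
    ip f (blockFn (codeBlocks K) J) / ip (blockFn (codeBlocks K) J) (blockFn (codeBlocks K) J)
      = blockAvg K f J.1 J.2 := by
  have hb := blockFn_codeBlocks_eqOn hK J
  have hc := constAtLevel_codeInd hK J.1 J.2
  rw [ip_sum_rademacher_of_mem (K := fun k => k) Function.injective_id
    (fun k => constAtLevel_coef k f) (eqOn_sum_coef hf)
    (Finset.mem_range.2 (Nat.lt_succ_iff.2 hJN)) hc hb]
  have hself : ip (blockFn (codeBlocks K) J) (blockFn (codeBlocks K) J) = (1 / 2) ^ J.1 := by
    rw [ip_congr hb hb, ip, ← setIntegral_codeInd hK hJ]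
    congr 1; ext t
    linear_combination codeInd K J.1 J.2 t * codeInd K J.1 J.2 t * rademacher_mul_self (K J.1) t
      + codeInd_mul_self K J.1 J.2 t
  rw [hself, blockAvg, one_div, inv_pow, div_inv_eq_mul, mul_comm]

theorem Qproj_eqOn (hK : StrictMono K) (hf : f ∈ haarSpanLe N) (hn : K n ≤ N) :
    Set.EqOn (Qproj (codeBlocks K) n f)
      (fun t => ∑ i ∈ Finset.range (n + 1),
        blockAvg K f i (digitCode K i t) * rademacher (K i) t) (Set.Ico 0 1) := by
  intro t ht
  simp only [Qproj]
  rw [sum_dFinset]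
  refine Finset.sum_congr rfl fun i hi => ?_
  have hiN : K i ≤ N :=
    (hK.monotone (Nat.lt_succ_iff.1 (Finset.mem_range.1 hi))).trans hn
  rw [Finset.sum_eq_single_of_mem _ (Finset.mem_range.2 (digitCode_lt K i t))]
  · rw [ip_blockFn_div hK hf (J := (i, digitCode K i t)) (digitCode_lt K i t) hiN,
      blockFn_codeBlocks_eqOn hK _ ht]
    simp [codeInd]
  · intro m _ hm
    rw [blockFn_codeBlocks_eqOn hK _ ht]
    simp [codeInd, hm.symm]

theorem H1norm_Qproj (hK : StrictMono K) (hf : f ∈ haarSpanLe N) (hn : K n ≤ N) :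
    H1norm (Qproj (codeBlocks K) n f) = ∫ t in Set.Ico (0 : ℝ) 1,
      Real.sqrt (∑ i ∈ Finset.range (n + 1), blockAvg K f i (digitCode K i t) ^ 2) :=
  H1norm_sum_rademacher hK.injective
    (fun i => (constAtLevel_digitCode hK i).map (blockAvg K f i)) (Qproj_eqOn hK hf hn)

theorem H1norm_Qproj_le_of_levelNorm_le (hK : StrictMono K) (hf : f ∈ haarSpanLe N)
    (hn : K n ≤ N) {c : ℝ} (hc : ∀ i ≤ n, levelNorm (K i) f ≤ c) :
    H1norm (Qproj (codeBlocks K) n f) ≤ (n + 1) * 2 ^ n * c := by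
  rw [H1norm_Qproj hK hf hn]
  have hc0 : 0 ≤ c := (levelNorm_nonneg _ _).trans (hc 0 (Nat.zero_le n))
  have hbound : ∀ t, Real.sqrt (∑ i ∈ Finset.range (n + 1),
      blockAvg K f i (digitCode K i t) ^ 2) ≤ (n + 1) * 2 ^ n * c := by
    intro t
    have hs : ∑ i ∈ Finset.range (n + 1), |blockAvg K f i (digitCode K i t)|
        ≤ (n + 1) * 2 ^ n * c := by
      calc ∑ i ∈ Finset.range (n + 1), |blockAvg K f i (digitCode K i t)|
          ≤ ∑ _i ∈ Finset.range (n + 1), 2 ^ n * c := by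
            refine Finset.sum_le_sum fun i hi => (abs_blockAvg_le hK f i _).trans ?_
            have hi' := Nat.lt_succ_iff.1 (Finset.mem_range.1 hi)
            exact mul_le_mul (pow_le_pow_right₀ one_le_two hi') (hc i hi')
              (levelNorm_nonneg _ _) (by positivity)
        _ = (n + 1) * 2 ^ n * c := by
            rw [Finset.sum_const, Finset.card_range, nsmul_eq_mul]; push_cast; ring
    refine le_trans (Real.sqrt_le_iff.2 ⟨Finset.sum_nonneg fun i _ => abs_nonneg _, ?_⟩) hs
    have := Finset.sum_sq_le_sq_sum_of_nonneg (s := Finset.range (n + 1))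
      (f := fun i => |blockAvg K f i (digitCode K i t)|) fun i _ => abs_nonneg _
    simpa only [sq_abs] using this
  have hint := (constAtLevel_sqrt_sum_sq (s := Finset.range (n + 1)) (K := K n)
    (a := fun i t => blockAvg K f i (digitCode K i t)) fun i hi =>
      ((constAtLevel_digitCode hK i).map (blockAvg K f i)).mono
        (hK.monotone (Nat.lt_succ_iff.1 (Finset.mem_range.1 hi)))).integrableOn
  refine (integral_mono hint (integrable_const _) hbound).trans ?_
  simp

theorem blockAvg_div (hK : StrictMono K) (f : ℝ → ℝ) {i : ℕ} (hi : i ≤ n) (m : ℕ) :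
    blockAvg K f i (m / 2 ^ (n - i))
      = 2 ^ n * ∫ t in Set.Ico (0 : ℝ) 1, coef (K i) f t * codeInd K n m t := by
  obtain ⟨d, rfl⟩ := Nat.exists_eq_add_of_le hi
  rw [setIntegral_mul_codeInd_add hK (constAtLevel_coef (K i) f), Nat.add_sub_cancel_left,
    blockAvg, pow_add, ← mul_assoc, mul_assoc ((2 : ℝ) ^ i), ← mul_pow]
  norm_num

theorem H1norm_Qproj_le (hK : StrictMono K) (hf : f ∈ haarSpanLe N) (hn : K n ≤ N) :
    H1norm (Qproj (codeBlocks K) n f) ≤ H1norm f := by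
  set G : ℝ → ℝ := fun t => Real.sqrt (∑ i ∈ Finset.range (n + 1), coef (K i) f t ^ 2)
  have hile : ∀ i ∈ Finset.range (n + 1), i ≤ n := fun i hi =>
    Nat.lt_succ_iff.1 (Finset.mem_range.1 hi)
  have hcoef : ∀ i ∈ Finset.range (n + 1), ConstAtLevel (K n) (coef (K i) f) := fun i hi =>
    (constAtLevel_coef (K i) f).mono (hK.monotone (hile i hi))
  have hG : ConstAtLevel (K n) G := constAtLevel_sqrt_sum_sq hcoef
  have hGm : ∀ m, ConstAtLevel (K n) (fun t => codeInd K n m t * G t) := fun m =>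
    (constAtLevel_codeInd hK n m).mul hG
  set C : ℕ → ℝ := fun m =>
    Real.sqrt (∑ i ∈ Finset.range (n + 1), blockAvg K f i (m / 2 ^ (n - i)) ^ 2)
  have hC : ∀ m, C m * (1 / 2) ^ n ≤ ∫ t in Set.Ico (0 : ℝ) 1, codeInd K n m t * G t := by
    intro m
    have h1 := sqrt_sum_sq_setIntegral_le (s := Finset.range (n + 1))
      (g := fun i t => coef (K i) f t * codeInd K n m t) fun i hi =>
        (hcoef i hi).mul (constAtLevel_codeInd hK n m)
    have h2 : C m = 2 ^ n * Real.sqrt (∑ i ∈ Finset.range (n + 1),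
        (∫ t in Set.Ico (0 : ℝ) 1, coef (K i) f t * codeInd K n m t) ^ 2) := by
      simp only [C]
      rw [Finset.sum_congr rfl fun i hi => by rw [blockAvg_div hK f (hile i hi), mul_pow],
        ← Finset.mul_sum, Real.sqrt_mul (by positivity), Real.sqrt_sq (by positivity)]
    have h3 : (2 : ℝ) ^ n * (1 / 2) ^ n = 1 := by rw [← mul_pow]; norm_num
    rw [h2, mul_right_comm, h3, one_mul]
    refine h1.trans_eq ?_
    congr 1; ext t
    simp only [mul_pow, ← Finset.sum_mul]
    rw [Real.sqrt_mul (Finset.sum_nonneg fun _ _ => sq_nonneg _),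
      Real.sqrt_sq (codeInd_nonneg K n m t), mul_comm]
  have hstep : H1norm (Qproj (codeBlocks K) n f)
      = ∑ m ∈ Finset.range (2 ^ n), C m * (1 / 2) ^ n := by
    have hpt : ∀ t, Real.sqrt (∑ i ∈ Finset.range (n + 1),
        blockAvg K f i (digitCode K i t) ^ 2)
          = ∑ m ∈ Finset.range (2 ^ n), C m * codeInd K n m t := by
      intro t
      rw [Finset.sum_eq_single_of_mem _ (Finset.mem_range.2 (digitCode_lt K n t))]
      · simp only [C, codeInd, if_true, mul_one]
        congr 1
        refine Finset.sum_congr rfl fun i hi => ?_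
        have := digitCode_add_div K i (n - i) t
        rw [Nat.add_sub_cancel' (hile i hi)] at this
        rw [this]
      · intro m _ hm
        rw [codeInd, if_neg hm.symm, mul_zero]
    rw [H1norm_Qproj hK hf hn]
    simp only [hpt]
    rw [integral_finsetSum _ fun m _ =>
      (constAtLevel_codeInd hK n m).integrableOn.const_mul _]
    refine Finset.sum_congr rfl fun m hm => ?_
    rw [integral_const_mul, setIntegral_codeInd hK (Finset.mem_range.1 hm)]
  rw [hstep, H1norm_eq hf]
  refine (Finset.sum_le_sum fun m _ => hC m).trans ?_
  rw [← integral_finsetSum _ fun m _ => (hGm m).integrableOn]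
  simp only [← Finset.sum_mul, sum_codeInd, one_mul]
  refine integral_mono hG.integrableOn
    (constAtLevel_sqrt_sum_sq (constAtLevel_coef_of_mem (N := N) f)).integrableOn fun t => ?_
  refine Real.sqrt_le_sqrt ?_
  rw [← Finset.sum_image (f := fun k => coef k f t ^ 2) (g := K)
    fun i _ j _ h => hK.injective h]
  refine Finset.sum_le_sum_of_subset_of_nonneg ?_ fun _ _ _ => sq_nonneg _
  intro k hk
  obtain ⟨i, hi, rfl⟩ := Finset.mem_image.1 hk
  exact Finset.mem_range.2 (Nat.lt_succ_iff.2 ((hK.monotone (hile i hi)).trans hn))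

end Projection

end DigitCode

theorem exists_strictMono_avoiding {N n : ℕ} {bad : Finset ℕ} (h : bad.card + n ≤ N) :
    ∃ K : ℕ → ℕ, StrictMono K ∧ K n ≤ N ∧ ∀ i, K i ∉ bad := by
  classical
  have hinf : (Set.ofPred fun k => k ∉ bad).Infinite := bad.finite_toSet.infinite_compl
  refine ⟨Nat.nth fun k => k ∉ bad, Nat.nth_strictMono hinf, ?_,
    fun i => Nat.nth_mem_of_infinite hinf i⟩
  refine Nat.lt_succ_iff.1 (Nat.nth_lt_of_lt_count ?_)
  rw [Nat.count_eq_card_filter_range]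
  rw [Nat.succ_eq_add_one]
  have h1 : Finset.range (N + 1) ⊆ {k ∈ Finset.range (N + 1) | k ∉ bad} ∪ bad := by
    intro k hk
    by_cases hb : k ∈ bad <;> simp [hb, Finset.mem_range.1 hk]
  have h2 := (Finset.card_le_card h1).trans (Finset.card_union_le _ _)
  rw [Finset.card_range] at h2
  omega

end DyadicH

open DyadicH in
/-- To every `ε > 0` and `n` there is `N = N(ε, n)`: for every `n`-dimensional subspace `E` of
`H¹_N(δ)` there are pairwise disjoint collections `{ℬ_J : J ∈ 𝒟_n}` of dyadic intervals from
`𝒟_N`, each consisting of pairwise disjoint intervals, such that the sets `B_J` form a dyadic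
tree with `|J|/2 ≤ |B_J|/|B_{[0,1)}| ≤ |J|`, the orthogonal projection `Q` onto the block basis
`b_J = ∑_{I ∈ ℬ_J} h_I` has `H¹` norm at most `4`, and `‖Q x‖_{H¹} ≤ ε ‖x‖_{H¹}` on `E`. -/
theorem annihilating_projection_exists (ε : ℝ) (hε : 0 < ε) (n : ℕ) :
    ∃ N : ℕ, ∀ E : Submodule ℝ (ℝ → ℝ), E ≤ haarSpanLe N → Module.finrank ℝ E = n →
      ∃ B : (ℕ × ℕ) → Finset (ℕ × ℕ),
        (∀ J ∈ dFinset n, ∀ I ∈ B J, IsDyadic I ∧ I.1 ≤ N) ∧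
        (∀ J ∈ dFinset n, ∀ J' ∈ dFinset n, J ≠ J' → Disjoint (B J) (B J')) ∧
        (∀ J ∈ dFinset n, ∀ I ∈ B J, ∀ I' ∈ B J, I ≠ I' → Disjoint (dint I) (dint I')) ∧
        (∀ I : ℕ × ℕ, IsDyadic I → I.1 < n →
          blockSet B (I.1 + 1, 2 * I.2) ∪ blockSet B (I.1 + 1, 2 * I.2 + 1) ⊆ blockSet B I ∧
          blockSet B (I.1 + 1, 2 * I.2) ∩ blockSet B (I.1 + 1, 2 * I.2 + 1) = ∅) ∧
        (∀ J ∈ dFinset n,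
          len J / 2 ≤
              (MeasureTheory.volume (blockSet B J)).toReal /
                (MeasureTheory.volume (blockSet B (0, 0))).toReal ∧
            (MeasureTheory.volume (blockSet B J)).toReal /
                (MeasureTheory.volume (blockSet B (0, 0))).toReal ≤ len J) ∧
        (∀ f : ℝ → ℝ, f ∈ haarSpanLe N → H1norm (Qproj B n f) ≤ 4 * H1norm f) ∧
        (∀ x : ℝ → ℝ, x ∈ E → H1norm (Qproj B n x) ≤ ε * H1norm x) := by
  classical
  set η : ℝ := ε / ((n + 1) * 2 ^ n) with hη
  have hη0 : 0 < η := by positivity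
  obtain ⟨C, hC⟩ := exists_nat_ge (4 * 5 ^ n / η ^ 2)
  refine ⟨C + n, fun E hE hrank => ?_⟩
  obtain ⟨bad, -, hcard, hgood⟩ := exists_small_levels hE hη0
  rw [hrank, ← le_div_iff₀ (by positivity)] at hcard
  have hbad : bad.card ≤ C := by exact_mod_cast hcard.trans hC
  obtain ⟨K, hK, hKn, hKbad⟩ := exists_strictMono_avoiding (n := n) (Nat.add_le_add_right hbad n)
  have hKle : ∀ i ≤ n, K i ≤ C + n := fun i hi => (hK.monotone hi).trans hKn
  refine ⟨codeBlocks K, ?_, ?_, ?_, ?_, ?_, ?_, ?_⟩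
  · intro J hJ I hI
    obtain ⟨h1, h2, -⟩ := mem_codeBlocks.1 hI
    exact ⟨by rw [IsDyadic, h1]; exact h2, h1 ▸ hKle J.1 (mem_dFinset.1 hJ).1⟩
  · intro J _ J' _ hne
    refine Finset.disjoint_left.2 fun I hI hI' => hne ?_
    obtain ⟨h1, -, h2⟩ := mem_codeBlocks.1 hI
    obtain ⟨h1', -, h2'⟩ := mem_codeBlocks.1 hI'
    have h : J.1 = J'.1 := hK.injective (h1.symm.trans h1')
    exact Prod.ext h (by rw [← h2, ← h2', h])
  · intro J _ I hI I' hI' hne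
    refine Set.disjoint_left.2 fun t ht ht' => hne ?_
    have h : I.1 = I'.1 := (mem_codeBlocks.1 hI).1.trans (mem_codeBlocks.1 hI').1.symm
    exact Prod.ext h (by rw [← (mem_dint_iff.1 ht).2, ← (mem_dint_iff.1 ht').2, h])
  · intro I _ _
    constructor
    · rintro t (ht | ht) <;>
      · rw [mem_blockSet_codeBlocks hK] at ht ⊢
        refine ⟨ht.1, ?_⟩
        rw [← digitCode_succ_div_two, ht.2]
        omega
    · ext t
      simp only [Set.mem_inter_iff, mem_blockSet_codeBlocks hK, Set.mem_empty_iff_false, iff_false]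
      rintro ⟨⟨-, h⟩, -, h'⟩
      omega
  · intro J hJ
    rw [volume_blockSet_codeBlocks hK (mem_dFinset.1 hJ).2,
      volume_blockSet_codeBlocks hK (by simp [IsDyadic])]
    simp only [len, pow_zero, div_one, one_div, inv_pow]
    exact ⟨half_le_self (by positivity), le_rfl⟩
  · intro f hf
    linarith [H1norm_Qproj_le hK hf hKn, H1norm_nonneg f]
  · intro x hx
    refine (H1norm_Qproj_le_of_levelNorm_le hK (hE hx) hKn fun i hi =>
      hgood (K i) (Finset.mem_range.2 (Nat.lt_succ_iff.2 (hKle i hi))) (hKbad i) x hx).trans_eq ?_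
    rw [hη]
    field_simp

end
end

section
/- For every 1 < p < ∞ there exists a constant C_p > 0 with the following property: for every bounded linear operator T on ℓ^∞(L^p(𝕋)) with ‖T‖ ≤ 1 there exist bounded linear operators E : ℓ^∞(L^p(𝕋)) → ℓ^∞(L^p(𝕋)) and P : ℓ^∞(L^p(𝕋)) → ℓ^∞(L^p(𝕋)) such that ‖E‖·‖P‖ ≤ C_p and P ∘ H ∘ E is the identity on ℓ^∞(L^p(𝕋)), where H = T or H = Id − T. -/
open MeasureTheory
open scoped ENNReal

noncomputable section

instance fact_two_pi_pos : Fact (0 < 2 * Real.pi) := ⟨by positivity⟩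

/-- `L^p(𝕋)`: the complex Lebesgue space on the circle `𝕋 = ℝ / 2πℤ`. -/
abbrev LpCircle (p : ℝ≥0∞) := ↥(Lp ℂ p (volume : Measure (AddCircle (2 * Real.pi))))

/-- `ℓ^∞(L^p(𝕋))`: bounded `L^p(𝕋)`-valued sequences with the sup norm. -/
abbrev lInftyLp (p : ℝ≥0∞) [Fact (1 ≤ p)] := ↥(lp (fun _ : ℕ => LpCircle p) ∞)

open Filter Topology Function

section Rosenthal

/-- A form of **Rosenthal's disjointification lemma**: if, for each `i`, the set function `μ i`
exceeds `ε` on at most a bounded number of pairwise disjoint sets, then there is an infinite set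
`B` such that `μ i (B \ {i}) ≤ ε` for all `i ∈ B`. -/
theorem exists_injective_forall_diff_singleton_le (μ : ℕ → Set ℕ → ℝ) (ε : ℝ) (m : ℕ)
    (a : ℕ → ℕ) (ha : Injective a)
    (h : ∀ i, ¬ ∃ A : Fin m → Set ℕ, Pairwise (Disjoint on A) ∧
      (∀ s, A s ⊆ Set.range a) ∧ ∀ s, ε < μ (a i) (A s)) :
    ∃ b : ℕ → ℕ, Injective b ∧ Set.range b ⊆ Set.range a ∧
      ∀ i, μ (b i) (Set.range b \ {b i}) ≤ ε := by
  induction m generalizing a with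
  | zero => exact absurd ⟨Fin.elim0, fun i => i.elim0, fun i => i.elim0, fun i => i.elim0⟩ (h 0)
  | succ m ih =>
    let col : ℕ → ℕ → ℕ := fun k l => a (Nat.pair k l)
    have hcol_eq : ∀ {k l k' l'}, col k l = col k' l' → k = k' ∧ l = l' := fun hkl =>
      Nat.pair_eq_pair.1 (ha hkl)
    have hcol_sub : ∀ k, Set.range (col k) ⊆ Set.range a := by
      rintro k _ ⟨l, rfl⟩
      exact ⟨_, rfl⟩
    by_cases hk : ∃ k, ∀ l, μ (col k l) (Set.range (col k) \ {col k l}) ≤ ε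
    · obtain ⟨k, hk⟩ := hk
      exact ⟨col k, fun l l' hl => (hcol_eq hl).2, hcol_sub k, hk⟩
    · push Not at hk
      choose l hl using hk
      have hsub : Set.range (fun k => col k (l k)) ⊆ Set.range a := by
        rintro _ ⟨k, rfl⟩
        exact ⟨_, rfl⟩
      obtain ⟨b, hb, hba, hb'⟩ := ih (fun k => col k (l k)) (fun k k' hkk => (hcol_eq hkk).1) <| by
        rintro k ⟨A, hA, hAsub, hAμ⟩
        have hdisj : ∀ s, Disjoint (Set.range (col k) \ {col k (l k)}) (A s) := by
          intro s
          rw [Set.disjoint_left]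
          rintro _ ⟨⟨l', rfl⟩, hne⟩ hmem
          obtain ⟨k', hk'⟩ := hAsub s hmem
          obtain ⟨rfl, rfl⟩ := hcol_eq hk'
          exact hne rfl
        refine h (Nat.pair k (l k)) ⟨Fin.cons (Set.range (col k) \ {col k (l k)}) A, ?_, ?_, ?_⟩
        · intro s t hst
          induction s using Fin.cases with
          | zero =>
            induction t using Fin.cases with
            | zero => exact absurd rfl hst
            | succ t => simpa [Function.onFun] using hdisj t
          | succ s =>
            induction t using Fin.cases with
            | zero => simpa [Function.onFun] using (hdisj s).symm
            | succ t => simpa [Function.onFun] using hA (fun hst' => hst (by rw [hst']))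
        · intro s
          induction s using Fin.cases with
          | zero => exact Set.sdiff_subset.trans (hcol_sub k)
          | succ s => exact (hAsub s).trans hsub
        · intro s
          induction s using Fin.cases with
          | zero => exact hl k
          | succ s => exact hAμ s
      exact ⟨b, hb, hba.trans hsub, hb'⟩

end Rosenthal

section BoundedSequences

variable {X Y : Type*} [NormedAddCommGroup X] [NormedSpace ℂ X]
  [NormedAddCommGroup Y] [NormedSpace ℂ Y]

/-- The operator into `ℓ^∞(X)` with prescribed uniformly bounded coordinates. -/
def lpInftyLift (L : ℕ → Y →L[ℂ] X) (C : ℝ) (hL : ∀ i, ‖L i‖ ≤ C) :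
    Y →L[ℂ] lp (fun _ : ℕ => X) ∞ :=
  LinearMap.mkContinuous
    { toFun := fun y => ⟨fun i => L i y, memℓp_infty ⟨C * ‖y‖, by
        rintro _ ⟨i, rfl⟩
        exact (L i).le_of_opNorm_le (hL i) y⟩⟩
      map_add' := fun y z => by ext i; exact (L i).map_add y z
      map_smul' := fun c y => by ext i; exact (L i).map_smul c y } C
    (fun y => lp.norm_le_of_forall_le
      (mul_nonneg ((norm_nonneg _).trans (hL 0)) (norm_nonneg y))
      fun i => (L i).le_of_opNorm_le (hL i) y)

@[simp]
theorem lpInftyLift_apply (L : ℕ → Y →L[ℂ] X) (C : ℝ) (hL : ∀ i, ‖L i‖ ≤ C) (y : Y) (i : ℕ) :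
    lpInftyLift L C hL y i = L i y := rfl

theorem norm_lpInftyLift_le (L : ℕ → Y →L[ℂ] X) (C : ℝ) (hL : ∀ i, ‖L i‖ ≤ C) :
    ‖lpInftyLift L C hL‖ ≤ C :=
  LinearMap.mkContinuous_norm_le _ ((norm_nonneg _).trans (hL 0)) _

/-- Evaluation of a bounded sequence at an index. -/
def lpInftyEval (i : ℕ) : lp (fun _ : ℕ => X) ∞ →L[ℂ] X := lp.evalCLM ℂ (fun _ : ℕ => X) ∞ i

@[simp]
theorem lpInftyEval_apply (i : ℕ) (x : lp (fun _ : ℕ => X) ∞) : lpInftyEval i x = x i := rfl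

theorem norm_lpInftyEval_le (i : ℕ) : ‖lpInftyEval (X := X) i‖ ≤ 1 :=
  ContinuousLinearMap.opNorm_le_bound _ zero_le_one fun x => by
    simpa using lp.norm_apply_le_norm ENNReal.top_ne_zero x i

open Classical in
/-- The coordinate projection of `ℓ^∞(X)` onto the sequences supported in `A`. -/
def lpInftyRestrict (A : Set ℕ) : lp (fun _ : ℕ => X) ∞ →L[ℂ] lp (fun _ : ℕ => X) ∞ :=
  lpInftyLift (fun i => if i ∈ A then lpInftyEval i else 0) 1 fun i => by
    split_ifs
    · exact norm_lpInftyEval_le i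
    · simp

open Classical in
theorem lpInftyRestrict_apply (A : Set ℕ) (x : lp (fun _ : ℕ => X) ∞) (i : ℕ) :
    lpInftyRestrict A x i = if i ∈ A then x i else 0 := by
  rw [lpInftyRestrict, lpInftyLift_apply]
  split_ifs <;> simp

theorem norm_sum_smul_lpInftyRestrict_le {K : ℕ} {A : Fin K → Set ℕ}
    (hA : Pairwise (Disjoint on A)) (x : Fin K → lp (fun _ : ℕ => X) ∞) (hx : ∀ s, ‖x s‖ ≤ 1)
    (r : Fin K → ℤˣ) : ‖∑ s, r s • lpInftyRestrict (A s) (x s)‖ ≤ 1 := by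
  refine lp.norm_le_of_forall_le zero_le_one fun i => ?_
  have hval : (∑ s, r s • lpInftyRestrict (A s) (x s)) i
      = ∑ s, r s • lpInftyRestrict (A s) (x s) i := by
    change lpInftyEval i _ = _
    rw [map_sum]
    refine Finset.sum_congr rfl fun s _ => ?_
    rcases Int.units_eq_one_or (r s) with h | h <;> simp [h]
  rw [hval]
  by_cases hi : ∃ s, i ∈ A s
  · obtain ⟨s, hs⟩ := hi
    rw [Finset.sum_eq_single s]
    · rw [lpInftyRestrict_apply, if_pos hs]
      have : ‖r s • x s i‖ = ‖x s i‖ := by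
        rcases Int.units_eq_one_or (r s) with h | h <;> simp [h]
      rw [this]
      exact (lp.norm_apply_le_norm ENNReal.top_ne_zero _ _).trans (hx s)
    · intro t _ hts
      rw [lpInftyRestrict_apply, if_neg, smul_zero]
      exact fun hit => Set.disjoint_left.1 (hA hts) hit hs
    · simp
  · rw [Finset.sum_eq_zero]
    · simp
    · intro s _
      rw [lpInftyRestrict_apply, if_neg, smul_zero]
      exact fun h => hi ⟨s, h⟩

end BoundedSequences

section Rademacher

theorem sum_units_fin_succ {E : Type*} [AddCommGroup E] (F : E → ℝ) {K : ℕ} (a : Fin (K + 1) → E) :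
    ∑ r : Fin (K + 1) → ℤˣ, F (∑ s, r s • a s) = ∑ r : Fin K → ℤˣ,
      (F (∑ s, r s • a s.succ + a 0) + F (∑ s, r s • a s.succ - a 0)) := by
  rw [← (Fin.consEquiv fun _ => ℤˣ).sum_comp, Fintype.sum_prod_type_right]
  refine Finset.sum_congr rfl fun r _ => ?_
  rw [UnitsInt.univ, Finset.sum_pair (by decide)]
  simp [Fin.consEquiv, Fin.sum_univ_succ, add_comm, sub_eq_add_neg]

theorem sum_units_norm_sq {K : ℕ} (a : Fin K → ℂ) :
    ∑ r : Fin K → ℤˣ, ‖∑ s, r s • a s‖ ^ 2 = 2 ^ K * ∑ s, ‖a s‖ ^ 2 := by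
  induction K with
  | zero => simp
  | succ K ih =>
    have key : ∀ z w : ℂ, ‖z + w‖ ^ 2 + ‖z - w‖ ^ 2 = 2 * ‖z‖ ^ 2 + 2 * ‖w‖ ^ 2 := fun z w => by
      have := parallelogram_law_with_norm ℝ z w
      nlinarith
    rw [sum_units_fin_succ (fun z => ‖z‖ ^ 2)]
    simp only [key, Finset.sum_add_distrib, ← Finset.mul_sum, ih, Fin.sum_univ_succ]
    simp
    ring

theorem sum_units_norm_pow_four_le {K : ℕ} (a : Fin K → ℂ) :
    ∑ r : Fin K → ℤˣ, ‖∑ s, r s • a s‖ ^ 4 ≤ 2 ^ K * (3 * (∑ s, ‖a s‖ ^ 2) ^ 2) := by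
  induction K with
  | zero => simp
  | succ K ih =>
    have key : ∀ z w : ℂ, ‖z + w‖ ^ 4 + ‖z - w‖ ^ 4
        ≤ 2 * ‖z‖ ^ 4 + 12 * ‖w‖ ^ 2 * ‖z‖ ^ 2 + 2 * ‖w‖ ^ 4 := fun z w => by
      have h1 := norm_add_sq_real z w
      have h2 := norm_sub_sq_real z w
      have h3 : (inner ℝ z w) ^ 2 ≤ (‖z‖ * ‖w‖) ^ 2 :=
        sq_le_sq' (neg_le_of_abs_le (abs_real_inner_le_norm z w)) (real_inner_le_norm z w)
      have e1 : ‖z + w‖ ^ 4 = (‖z + w‖ ^ 2) ^ 2 := by ring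
      have e2 : ‖z - w‖ ^ 4 = (‖z - w‖ ^ 2) ^ 2 := by ring
      rw [e1, e2, h1, h2]
      nlinarith
    have h2 := sum_units_norm_sq (fun s => a (Fin.succ s))
    have h4 := ih (fun s => a (Fin.succ s))
    rw [sum_units_fin_succ (fun z => ‖z‖ ^ 4)]
    refine (Finset.sum_le_sum fun r _ => key _ _).trans ?_
    simp only [Finset.sum_add_distrib, ← Finset.mul_sum, Fin.sum_univ_succ (n := K), h2]
    simp only [Finset.sum_const, Finset.card_univ, Fintype.card_pi, Fintype.card_units_int,
      Finset.prod_const, Fintype.card_fin, nsmul_eq_mul, Nat.cast_pow, Nat.cast_ofNat]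
    have h2K : (0 : ℝ) < 2 ^ K := by positivity
    have h0 := mul_nonneg h2K.le (pow_nonneg (norm_nonneg (a 0)) 4)
    set S := ∑ s : Fin K, ‖a s.succ‖ ^ 2
    have hR : (2 : ℝ) ^ (K + 1) * (3 * (‖a 0‖ ^ 2 + S) ^ 2) = 2 * (2 ^ K * (3 * S ^ 2))
        + 12 * ‖a 0‖ ^ 2 * (2 ^ K * S) + 6 * (2 ^ K * ‖a 0‖ ^ 4) := by ring
    rw [hR]
    linarith

/-- The lower **Khintchine inequality**. -/
theorem exists_mul_rpow_le_sum_units_norm_rpow (p : ℝ) (hp : 0 < p) :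
    ∃ c : ℝ, 0 < c ∧ ∀ (K : ℕ) (a : Fin K → ℂ),
      2 ^ K * (c * (∑ s, ‖a s‖ ^ 2) ^ (p / 2)) ≤ ∑ r : Fin K → ℤˣ, ‖∑ s, r s • a s‖ ^ p := by
  have hcard : ∀ K : ℕ, ∀ c : ℝ, ∑ _r : Fin K → ℤˣ, c = 2 ^ K * c := fun K c => by
    simp
  -- it suffices to bound `u ^ p` below by a combination of `1`, `u ^ 2` and `u ^ 4`
  have main : ∀ (δ c₀ α β γ : ℝ), 0 < δ → 0 ≤ γ →
      (∀ u : ℝ, 0 ≤ u → α + β * u ^ 2 - γ * u ^ 4 ≤ u ^ p) →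
      c₀ ≤ α + β * δ ^ 2 - γ * (3 * δ ^ 4) → ∀ (K : ℕ) (a : Fin K → ℂ),
      2 ^ K * (c₀ * (δ ^ p)⁻¹ * (∑ s, ‖a s‖ ^ 2) ^ (p / 2))
        ≤ ∑ r : Fin K → ℤˣ, ‖∑ s, r s • a s‖ ^ p := by
    intro δ c₀ α β γ hδ hγ hu hc K a
    set S : ℝ := ∑ s, ‖a s‖ ^ 2 with hS
    have hS0 : 0 ≤ S := by positivity
    rcases hS0.eq_or_lt with h0 | h0
    · rw [← h0, Real.zero_rpow (by positivity)]
      simp only [mul_zero]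
      positivity
    set t : ℝ := δ / √S with ht
    have hsq : 0 < √S := Real.sqrt_pos.2 h0
    have htpos : 0 < t := by positivity
    have ht2 : t ^ 2 * S = δ ^ 2 := by
      rw [ht, div_pow, Real.sq_sqrt hS0]
      field_simp
    have htp : t ^ p = δ ^ p * (S ^ (p / 2))⁻¹ := by
      rw [ht, Real.div_rpow hδ.le hsq.le, Real.sqrt_eq_rpow, ← Real.rpow_mul hS0, div_eq_mul_inv]
      congr 3
      ring
    have hsum : 2 ^ K * c₀ ≤ t ^ p * ∑ r : Fin K → ℤˣ, ‖∑ s, r s • a s‖ ^ p := by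
      calc 2 ^ K * c₀ ≤ 2 ^ K * (α + β * δ ^ 2 - γ * (3 * δ ^ 4)) := by gcongr
        _ = 2 ^ K * α + β * t ^ 2 * (2 ^ K * S) - γ * t ^ 4 * (2 ^ K * (3 * S ^ 2)) := by
          have : δ ^ 4 = t ^ 4 * S ^ 2 := by
            rw [show δ ^ 4 = (δ ^ 2) ^ 2 by ring, ← ht2]; ring
          rw [this, ← ht2]; ring
        _ ≤ 2 ^ K * α + β * t ^ 2 * (∑ r : Fin K → ℤˣ, ‖∑ s, r s • a s‖ ^ 2)
            - γ * t ^ 4 * (∑ r : Fin K → ℤˣ, ‖∑ s, r s • a s‖ ^ 4) := by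
          rw [sum_units_norm_sq]
          gcongr
          exact sum_units_norm_pow_four_le a
        _ = ∑ r : Fin K → ℤˣ, (α + β * (t * ‖∑ s, r s • a s‖) ^ 2
              - γ * (t * ‖∑ s, r s • a s‖) ^ 4) := by
          rw [Finset.sum_sub_distrib, Finset.sum_add_distrib, hcard]
          simp only [mul_pow, ← Finset.mul_sum, mul_assoc]
        _ ≤ ∑ r : Fin K → ℤˣ, (t * ‖∑ s, r s • a s‖) ^ p :=
          Finset.sum_le_sum fun r _ => hu _ (by positivity)
        _ = _ := by
          rw [Finset.mul_sum]
          refine Finset.sum_congr rfl fun r _ => Real.mul_rpow htpos.le (norm_nonneg _)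
    rw [htp] at hsum
    have hSp : 0 < S ^ (p / 2) := Real.rpow_pos_of_pos h0 _
    have hδp : 0 < δ ^ p := Real.rpow_pos_of_pos hδ _
    calc 2 ^ K * (c₀ * (δ ^ p)⁻¹ * S ^ (p / 2))
        = (2 ^ K * c₀) * ((δ ^ p)⁻¹ * S ^ (p / 2)) := by ring
      _ ≤ (δ ^ p * (S ^ (p / 2))⁻¹ * ∑ r : Fin K → ℤˣ, ‖∑ s, r s • a s‖ ^ p)
          * ((δ ^ p)⁻¹ * S ^ (p / 2)) := by gcongr
      _ = _ := by field_simp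
  rcases le_total p 2 with h | h
  · refine ⟨1 / 12 * ((√(1 / 6)) ^ p)⁻¹, by positivity,
      main (√(1 / 6)) (1 / 12) 0 1 1 (by positivity) zero_le_one (fun u hu => ?_) ?_⟩
    · rcases le_total u 1 with h1 | h1
      · have : u ^ 2 ≤ u ^ p := by
          rcases hu.eq_or_lt with h0 | h0
          · rw [← h0, Real.zero_rpow hp.ne']; norm_num
          · rw [← Real.rpow_natCast]
            exact Real.rpow_le_rpow_of_exponent_ge h0 h1 (by exact_mod_cast h)
        nlinarith [pow_nonneg hu 4]
      · have : u ^ 2 ≤ u ^ 4 := pow_le_pow_right₀ h1 (by norm_num)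
        nlinarith [Real.rpow_nonneg hu p]
    · rw [show √(1 / 6 : ℝ) ^ 4 = (√(1 / 6 : ℝ) ^ 2) ^ 2 by ring, Real.sq_sqrt (by norm_num)]
      norm_num
  · refine ⟨1 * ((√2) ^ p)⁻¹, by positivity,
      main (√2) 1 (-1) 1 0 (by positivity) le_rfl (fun u hu => ?_) ?_⟩
    · rcases le_total u 1 with h1 | h1
      · have : u ^ 2 ≤ 1 := pow_le_one₀ hu h1
        nlinarith [Real.rpow_nonneg hu p]
      · have : u ^ 2 ≤ u ^ p := by
          rw [← Real.rpow_natCast]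
          exact Real.rpow_le_rpow_of_exponent_le h1 (by exact_mod_cast h)
        linarith
    · rw [Real.sq_sqrt (by norm_num)]
      norm_num

end Rademacher

section Cotype

theorem exists_sum_rpow_le_card_rpow_mul (p : ℝ) (hp : 0 < p) :
    ∃ θ : ℝ, 0 < θ ∧ ∀ (K : ℕ) (b : Fin K → ℝ), 0 < K → (∀ s, 0 ≤ b s) →
      (K : ℝ) ^ (θ - 1) * ∑ s, b s ^ p ≤ (∑ s, b s ^ 2) ^ (p / 2) := by
  rcases le_total p 2 with h | h
  · refine ⟨p / 2, by positivity, fun K b hK hb => ?_⟩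
    have hK' : (0 : ℝ) < K := by exact_mod_cast hK
    have h1 : 1 ≤ 2 / p := by rw [le_div_iff₀ hp]; linarith
    have h2 := Real.rpow_sum_le_const_mul_sum_rpow_of_nonneg (Finset.univ : Finset (Fin K)) h1
      (f := fun s => b s ^ p) fun s _ => Real.rpow_nonneg (hb s) p
    have h3 : ∀ s, (b s ^ p) ^ (2 / p) = b s ^ 2 := fun s => by
      rw [← Real.rpow_mul (hb s), mul_div_cancel₀ _ hp.ne', ← Real.rpow_natCast]; norm_num
    simp only [h3, Finset.card_univ, Fintype.card_fin] at h2
    have h0 : 0 ≤ ∑ s, b s ^ p := Finset.sum_nonneg fun s _ => Real.rpow_nonneg (hb s) p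
    have h4 := Real.rpow_le_rpow (Real.rpow_nonneg h0 _) h2 (z := p / 2) (by positivity)
    rw [← Real.rpow_mul h0, show 2 / p * (p / 2) = 1 by field_simp, Real.rpow_one,
      Real.mul_rpow (Real.rpow_nonneg hK'.le _) (Finset.sum_nonneg fun s _ => sq_nonneg _),
      ← Real.rpow_mul hK'.le] at h4
    calc (K : ℝ) ^ (p / 2 - 1) * ∑ s, b s ^ p
        ≤ (K : ℝ) ^ (p / 2 - 1) *
            ((K : ℝ) ^ ((2 / p - 1) * (p / 2)) * (∑ s, b s ^ 2) ^ (p / 2)) := by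
          gcongr
      _ = _ := by
          rw [← mul_assoc, ← Real.rpow_add hK',
            show p / 2 - 1 + (2 / p - 1) * (p / 2) = 0 by field_simp; ring, Real.rpow_zero, one_mul]
  · refine ⟨1, one_pos, fun K b hK hb => ?_⟩
    rw [sub_self, Real.rpow_zero, one_mul]
    set S := ∑ s, b s ^ 2 with hS
    have hS0 : 0 ≤ S := Finset.sum_nonneg fun s _ => sq_nonneg _
    have hp2 : (0 : ℝ) ≤ p / 2 - 1 := by linarith
    have key : ∀ s, b s ^ p ≤ b s ^ 2 * S ^ (p / 2 - 1) := fun s => by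
      have h1 : b s ^ p = (b s ^ 2) ^ (p / 2) := by
        rw [← Real.rpow_natCast, ← Real.rpow_mul (hb s)]; congr 1; push_cast; ring
      have h2 : b s ^ 2 ≤ S :=
        Finset.single_le_sum (f := fun s => b s ^ 2) (fun t _ => sq_nonneg _) (Finset.mem_univ s)
      rw [h1, show p / 2 = 1 + (p / 2 - 1) by ring,
        Real.rpow_add_of_nonneg (sq_nonneg _) zero_le_one hp2, Real.rpow_one]
      simp only [add_sub_cancel_left]
      gcongr
    calc ∑ s, b s ^ p ≤ ∑ s, b s ^ 2 * S ^ (p / 2 - 1) := Finset.sum_le_sum fun s _ => key s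
      _ = S * S ^ (p / 2 - 1) := by rw [← Finset.sum_mul]
      _ = S ^ (p / 2) := by
        nth_rewrite 1 [← Real.rpow_one S]
        rw [← Real.rpow_add_of_nonneg hS0 zero_le_one hp2]; congr 1; ring

variable {α : Type*} {mα : MeasurableSpace α} {μ : Measure α}

theorem Lp_norm_rpow_eq_integral {p : ℝ≥0∞} (hp : p ≠ 0) (hp_top : p ≠ ∞) (f : Lp ℂ p μ) :
    ‖f‖ ^ p.toReal = ∫ t, ‖f t‖ ^ p.toReal ∂μ := by
  have hP : 0 < p.toReal := ENNReal.toReal_pos hp hp_top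
  have h0 : 0 ≤ ∫ t, ‖f t‖ ^ p.toReal ∂μ := integral_nonneg fun t => by positivity
  rw [Lp.norm_def, (Lp.memLp f).eLpNorm_eq_integral_rpow_norm hp hp_top,
    ENNReal.toReal_ofReal (by positivity), ← Real.rpow_mul h0, inv_mul_cancel₀ hP.ne',
    Real.rpow_one]

theorem Lp_integrable_norm_rpow {p : ℝ≥0∞} (hp : p ≠ 0) (hp_top : p ≠ ∞) (f : Lp ℂ p μ) :
    Integrable (fun t => ‖f t‖ ^ p.toReal) μ :=
  (Lp.memLp f).integrable_norm_rpow hp hp_top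

/-- `L^p` has finite cotype, in the weak form: sufficiently many vectors bounded below have a
signed sum of norm more than `1`. -/
theorem exists_card_forall_exists_units_one_lt_norm {p : ℝ≥0∞} [Fact (1 ≤ p)] (hp_top : p ≠ ∞)
    {ε : ℝ} (hε : 0 < ε) :
    ∃ K : ℕ, ∀ x : Fin K → Lp ℂ p μ, (∀ s, ε < ‖x s‖) →
      ∃ r : Fin K → ℤˣ, 1 < ‖∑ s, r s • x s‖ := by
  have hp0 : p ≠ 0 := (zero_lt_one.trans_le Fact.out).ne'
  set P := p.toReal with hPdef
  have hP : 0 < P := ENNReal.toReal_pos hp0 hp_top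
  obtain ⟨c, hc, hk⟩ := exists_mul_rpow_le_sum_units_norm_rpow P hP
  obtain ⟨θ, hθ, hsum⟩ := exists_sum_rpow_le_card_rpow_mul P hP
  obtain ⟨K, hK0, hK⟩ : ∃ K : ℕ, 0 < K ∧ 1 < c * ε ^ P * (K : ℝ) ^ θ := by
    have h1 : Tendsto (fun K : ℕ => c * ε ^ P * (K : ℝ) ^ θ) atTop atTop :=
      ((tendsto_rpow_atTop hθ).comp tendsto_natCast_atTop_atTop).const_mul_atTop (by positivity)
    obtain ⟨K, h2, h3⟩ := ((h1.eventually_gt_atTop 1).and (eventually_gt_atTop 0)).exists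
    exact ⟨K, h3, h2⟩
  refine ⟨K, fun x hx => ?_⟩
  by_contra! hcon
  have hK' : (0 : ℝ) < K := by exact_mod_cast hK0
  have hcoe : ∀ r : Fin K → ℤˣ, ∀ᵐ t ∂μ,
      (∑ s, r s • x s : Lp ℂ p μ) t = ∑ s, r s • x s t := fun r => by
    have h1 : ∀ s, ∀ᵐ t ∂μ, (r s • x s : Lp ℂ p μ) t = r s • x s t := fun s => by
      rcases Int.units_eq_one_or (r s) with h | h
      · simp [h]
      · filter_upwards [Lp.coeFn_neg (x s)] with t ht
        simpa [h, Units.smul_def] using ht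
    have h2 : ∀ S : Finset (Fin K), ∀ᵐ t ∂μ,
        (∑ s ∈ S, r s • x s : Lp ℂ p μ) t = ∑ s ∈ S, r s • x s t := fun S => by
      induction S using Finset.induction_on with
      | empty =>
        filter_upwards [Lp.coeFn_zero ℂ p μ] with t ht
        simpa using ht
      | insert a S ha ih =>
        rw [Finset.sum_insert ha]
        filter_upwards [Lp.coeFn_add (r a • x a) (∑ s ∈ S, r s • x s), ih, h1 a] with t k1 k2 k3
        rw [k1, Pi.add_apply, k2, k3, Finset.sum_insert ha]
    exact h2 Finset.univ
  have hpt : ∀ t, 2 ^ K * c * K ^ (θ - 1) * ∑ s, ‖x s t‖ ^ P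
      ≤ ∑ r : Fin K → ℤˣ, ‖∑ s, r s • x s t‖ ^ P := fun t => by
    refine le_trans ?_ (hk K fun s => x s t)
    rw [mul_assoc, mul_assoc]
    gcongr
    exact hsum K (fun s => ‖x s t‖) hK0 fun s => norm_nonneg _
  have h_integrable : ∀ r : Fin K → ℤˣ, Integrable (fun t => ‖∑ s, r s • x s t‖ ^ P) μ := fun r =>
    (Lp_integrable_norm_rpow hp0 hp_top (∑ s, r s • x s)).congr <| by
      filter_upwards [hcoe r] with t ht
      rw [ht]
  have hI := integral_mono
    ((integrable_finsetSum _ fun s _ => Lp_integrable_norm_rpow hp0 hp_top (x s)).const_mul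
      (2 ^ K * c * K ^ (θ - 1)))
    (integrable_finsetSum _ fun r _ => h_integrable r) hpt
  rw [integral_const_mul, integral_finsetSum _ fun s _ => Lp_integrable_norm_rpow hp0 hp_top (x s),
    integral_finsetSum _ fun r _ => h_integrable r] at hI
  have hR : ∀ r : Fin K → ℤˣ, ∫ t, ‖∑ s, r s • x s t‖ ^ P ∂μ ≤ 1 := fun r => by
    have : ∫ t, ‖∑ s, r s • x s t‖ ^ P ∂μ = ‖∑ s, r s • x s‖ ^ P := by
      rw [Lp_norm_rpow_eq_integral hp0 hp_top]
      refine integral_congr_ae ?_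
      filter_upwards [hcoe r] with t ht
      rw [ht]
    rw [this]
    exact Real.rpow_le_one (norm_nonneg _) (hcon r) hP.le
  have hL : (K : ℝ) * ε ^ P ≤ ∑ s, ∫ t, ‖x s t‖ ^ P ∂μ := by
    have : ∀ s, ε ^ P ≤ ∫ t, ‖x s t‖ ^ P ∂μ := fun s => by
      rw [← Lp_norm_rpow_eq_integral hp0 hp_top]
      exact Real.rpow_le_rpow hε.le (hx s).le hP.le
    simpa using Finset.sum_le_sum fun s (_ : s ∈ Finset.univ) => this s
  have hR' : ∑ r : Fin K → ℤˣ, ∫ t, ‖∑ s, r s • x s t‖ ^ P ∂μ ≤ 2 ^ K := by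
    simpa using Finset.sum_le_sum fun r (_ : r ∈ Finset.univ) => hR r
  have hfin : (2 : ℝ) ^ K * (c * ε ^ P * (K : ℝ) ^ θ) ≤ 2 ^ K := by
    calc (2 : ℝ) ^ K * (c * ε ^ P * (K : ℝ) ^ θ)
        = 2 ^ K * c * K ^ (θ - 1) * (K * ε ^ P) := by
          rw [Real.rpow_sub_one hK'.ne']; field_simp
      _ ≤ _ := by gcongr
      _ ≤ _ := hI.trans hR'
  have : (0 : ℝ) < 2 ^ K := by positivity
  nlinarith

end Cotype

section Disjointification

variable {X : Type*} [NormedAddCommGroup X] [NormedSpace ℂ X]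

theorem exists_injective_norm_comp_restrict_le
    (hX : ∀ ε : ℝ, 0 < ε → ∃ K : ℕ, ∀ x : Fin K → X, (∀ s, ε < ‖x s‖) →
      ∃ r : Fin K → ℤˣ, 1 < ‖∑ s, r s • x s‖)
    (T : lp (fun _ : ℕ => X) ∞ →L[ℂ] lp (fun _ : ℕ => X) ∞) (hT : ‖T‖ ≤ 1) {ε : ℝ} (hε : 0 < ε)
    (a : ℕ → ℕ) (ha : Injective a) :
    ∃ b : ℕ → ℕ, Injective b ∧ Set.range b ⊆ Set.range a ∧ ∀ i,
      ‖lpInftyEval (b i) ∘L T ∘L lpInftyRestrict (Set.range b \ {b i})‖ ≤ ε := by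
  obtain ⟨K, hK⟩ := hX ε hε
  refine exists_injective_forall_diff_singleton_le
    (fun i A => ‖lpInftyEval i ∘L T ∘L lpInftyRestrict A‖) ε K a ha ?_
  rintro i ⟨A, hA, -, hlt⟩
  have hx : ∀ s, ∃ x : lp (fun _ : ℕ => X) ∞, ‖x‖ ≤ 1 ∧
      ε < ‖(lpInftyEval (a i) ∘L T ∘L lpInftyRestrict (A s)) x‖ := fun s => by
    by_contra! hcon
    refine (hlt s).not_ge (ContinuousLinearMap.opNorm_le_of_unit_norm hε.le fun x hx => ?_)
    exact hcon x hx.le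
  choose x hx1 hx2 using hx
  obtain ⟨r, hr⟩ := hK _ hx2
  refine hr.not_ge ?_
  have : ∑ s, r s • (lpInftyEval (a i) ∘L T ∘L lpInftyRestrict (A s)) (x s)
      = lpInftyEval (a i) (T (∑ s, r s • lpInftyRestrict (A s) (x s))) := by
    rw [map_sum, map_sum]
    refine Finset.sum_congr rfl fun s _ => ?_
    rcases Int.units_eq_one_or (r s) with h | h <;> simp [h]
  rw [this]
  calc _ ≤ 1 * ‖T (∑ s, r s • lpInftyRestrict (A s) (x s))‖ :=
        ContinuousLinearMap.le_of_opNorm_le _ (norm_lpInftyEval_le _) _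
    _ ≤ 1 * (1 * ‖∑ s, r s • lpInftyRestrict (A s) (x s)‖) := by
        gcongr; exact T.le_of_opNorm_le hT _
    _ ≤ 1 * (1 * 1) := by gcongr; exact norm_sum_smul_lpInftyRestrict_le hA x hx1 r
    _ = 1 := by norm_num

end Disjointification

section LpDuality

variable {α : Type*} {mα : MeasurableSpace α} {μ : Measure α} [IsFiniteMeasure μ]
variable {q : ℝ≥0∞} [Fact (1 ≤ q)]

theorem hasSum_indicatorConstLp_iUnion (hq : q ≠ ∞) {A : ℕ → Set α}
    (hA : ∀ i, MeasurableSet (A i)) (hd : Pairwise (Disjoint on A)) (c : ℂ) :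
    HasSum (fun i => indicatorConstLp q (hA i) (measure_ne_top μ (A i)) c)
      (indicatorConstLp q (MeasurableSet.iUnion hA) (measure_ne_top μ (⋃ i, A i)) c) := by
  have hS : ∀ S : Finset ℕ, MeasurableSet (⋃ i ∈ S, A i) := fun S =>
    S.measurableSet_biUnion fun i _ => hA i
  have hsum : ∀ S : Finset ℕ, ∑ i ∈ S, indicatorConstLp q (hA i) (measure_ne_top μ (A i)) c
      = indicatorConstLp q (hS S) (measure_ne_top μ _) c := fun S => by
    induction S using Finset.induction_on with
    | empty => simp
    | insert a S ha ih =>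
      rw [Finset.sum_insert ha, ih, ← indicatorConstLp_disjoint_union (hA a) (hS S)]
      · congr 1
        simp
      · rw [Set.disjoint_iUnion₂_right]
        exact fun i hi => hd fun h => ha (h ▸ hi)
  unfold HasSum
  simp only [hsum, SummationFilter.unconditional_filter]
  refine tendsto_indicatorConstLp_set hq ?_
  have h1 : ∀ S : Finset ℕ, symmDiff (⋃ i ∈ S, A i) (⋃ i, A i) = (⋃ i, A i) \ ⋃ i ∈ S, A i :=
    fun S => symmDiff_of_le (Set.iUnion₂_subset_iUnion _ _)
  simp only [h1]
  have h2 : ⋂ S : Finset ℕ, ((⋃ i, A i) \ ⋃ i ∈ S, A i) = ∅ := by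
    rw [Set.eq_empty_iff_forall_notMem]
    intro t ht
    rw [Set.mem_iInter] at ht
    obtain ⟨i, hi⟩ := Set.mem_iUnion.1 (ht ∅).1
    exact (ht {i}).2 (by simpa using hi)
  have h3 := tendsto_measure_iInter_atTop (μ := μ) (s := fun S : Finset ℕ =>
    (⋃ i, A i) \ ⋃ i ∈ S, A i)
    (fun S => ((MeasurableSet.iUnion hA).diff (hS S)).nullMeasurableSet)
    (fun S T hST => sdiff_le_sdiff_left (Set.biUnion_subset_biUnion_left hST))
    ⟨∅, measure_ne_top _ _⟩
  rwa [h2, measure_empty] at h3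

theorem exists_integrable_setIntegral_eq_real (hq : q ≠ ∞) (Λ : Lp ℂ q μ →L[ℝ] ℝ) :
    ∃ f : α → ℝ, Integrable f μ ∧ ∀ A (hA : MeasurableSet A),
      ∫ t in A, f t ∂μ = Λ (indicatorConstLp q hA (measure_ne_top μ A) 1) := by
  classical
  let ν : SignedMeasure α :=
    { measureOf' := fun A => if hA : MeasurableSet A then
        Λ (indicatorConstLp q hA (measure_ne_top μ A) 1) else 0
      empty' := by simp
      not_measurable' := fun A hA => by rw [dif_neg hA]
      m_iUnion' := fun A hA hd => by
        simp only [dif_pos (hA _), dif_pos (MeasurableSet.iUnion hA)]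
        exact Λ.hasSum (hasSum_indicatorConstLp_iUnion hq hA hd 1) }
  have hν : ∀ A (hA : MeasurableSet A),
      ν A = Λ (indicatorConstLp q hA (measure_ne_top μ A) 1) := fun A hA => dif_pos hA
  have hac : ν ≪ᵥ μ.toENNRealVectorMeasure := by
    refine VectorMeasure.AbsolutelyContinuous.mk fun A hA h0 => ?_
    rw [Measure.toENNRealVectorMeasure_apply_measurable hA] at h0
    rw [hν A hA]
    have : indicatorConstLp q hA (measure_ne_top μ A) (1 : ℂ) = 0 := by
      rw [← norm_eq_zero, norm_indicatorConstLp (zero_lt_one.trans_le Fact.out).ne' hq]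
      have hq' : 1 / q.toReal ≠ 0 := by
        have := ENNReal.toReal_pos (zero_lt_one.trans_le (Fact.out : 1 ≤ q)).ne' hq
        positivity
      rw [measureReal_def, h0, ENNReal.toReal_zero, Real.zero_rpow hq', mul_zero]
    rw [this, map_zero]
  have hrn := SignedMeasure.withDensityᵥ_rnDeriv_eq ν μ hac
  refine ⟨ν.rnDeriv μ, SignedMeasure.integrable_rnDeriv _ _, fun A hA => ?_⟩
  rw [← hν A hA, ← withDensityᵥ_apply (SignedMeasure.integrable_rnDeriv _ _) hA, hrn]

theorem exists_integrable_setIntegral_eq (hq : q ≠ ∞) (Λ : Lp ℂ q μ →L[ℂ] ℂ) :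
    ∃ f : α → ℂ, Integrable f μ ∧ ∀ A (hA : MeasurableSet A),
      ∫ t in A, f t ∂μ = Λ (indicatorConstLp q hA (measure_ne_top μ A) 1) := by
  obtain ⟨f, hf, hf'⟩ := exists_integrable_setIntegral_eq_real hq
    (Complex.reCLM ∘L Λ.restrictScalars ℝ)
  obtain ⟨g, hg, hg'⟩ := exists_integrable_setIntegral_eq_real hq
    (Complex.imCLM ∘L Λ.restrictScalars ℝ)
  refine ⟨fun t => (f t : ℂ) + (g t : ℂ) * Complex.I, hf.ofReal.add (hg.ofReal.mul_const _),
    fun A hA => ?_⟩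
  have h1 := integral_add (μ := μ.restrict A) (f := fun t => (f t : ℂ))
    (g := fun t => (g t : ℂ) * Complex.I) hf.ofReal.integrableOn
    (hg.ofReal.mul_const _).integrableOn
  refine h1.trans ?_
  rw [integral_mul_const, integral_complex_ofReal, integral_complex_ofReal, hf' A hA, hg' A hA]
  simp

theorem Lp_clm_ext (hq : q ≠ ∞) {F : Type*} [NormedAddCommGroup F] [NormedSpace ℂ F]
    {Φ Ψ : Lp ℂ q μ →L[ℂ] F}
    (h : ∀ A (hA : MeasurableSet A), Φ (indicatorConstLp q hA (measure_ne_top μ A) 1)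
      = Ψ (indicatorConstLp q hA (measure_ne_top μ A) 1)) : Φ = Ψ := by
  ext g
  induction g using Lp.induction hq with
  | @indicatorConst c s hs hμs =>
    rw [Lp.simpleFunc.coe_indicatorConst]
    have : indicatorConstLp q hs hμs.ne c = c • indicatorConstLp q hs hμs.ne (1 : ℂ) := by
      rw [indicatorConstLp, indicatorConstLp, ← MemLp.toLp_const_smul]
      refine MemLp.toLp_congr _ _ (Eventually.of_forall fun t => ?_)
      by_cases ht : t ∈ s <;> simp [ht]
    rw [this, map_smul, map_smul, h]
  | add hf hg _ h1 h2 => rw [map_add, map_add, h1, h2]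
  | isClosed => exact isClosed_eq Φ.continuous Ψ.continuous

end LpDuality

section LpRiesz

variable {α : Type*} {mα : MeasurableSpace α} (μ : Measure α)
variable (p q : ℝ≥0∞) [Fact (1 ≤ p)] [Fact (1 ≤ q)] [p.HolderConjugate q]

/-- The bilinear pairing `(f, g) ↦ ∫ f g` of `L^p` and `L^q`. -/
abbrev lpDuality : Lp ℂ p μ →L[ℂ] Lp ℂ q μ →L[ℂ] ℂ :=
  (ContinuousLinearMap.mul ℂ ℂ).lpPairing μ p q

variable {μ p q}

theorem lpDuality_apply (f : Lp ℂ p μ) (g : Lp ℂ q μ) :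
    lpDuality μ p q f g = ∫ t, f t * g t ∂μ := by
  simp [lpDuality, ContinuousLinearMap.lpPairing_eq_integral]

theorem exists_lpDuality_eq_norm_rpow (hp : p ≠ ∞) (hq : q ≠ ∞) (f : Lp ℂ p μ) :
    ∃ g : Lp ℂ q μ, lpDuality μ p q f g = (‖f‖ ^ p.toReal : ℝ) ∧ ‖g‖ ≤ ‖f‖ ^ (p.toReal - 1) := by
  have hp0 : p ≠ 0 := (zero_lt_one.trans_le Fact.out).ne'
  have hpq : p.toReal.HolderConjugate q.toReal := ENNReal.HolderConjugate.toReal_of_ne_top hp hq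
  have hP : 0 < p.toReal - 1 := hpq.sub_one_pos
  have hexp : q * ENNReal.ofReal (p.toReal - 1) = p := by
    rw [← ENNReal.ofReal_toReal hq, ← ENNReal.ofReal_mul ENNReal.toReal_nonneg, mul_comm,
      hpq.sub_one_mul_conj, ENNReal.ofReal_toReal hp]
  set G : α → ℂ := fun t => starRingEnd ℂ (f t) * ((‖f t‖ ^ (p.toReal - 2) : ℝ) : ℂ) with hG
  have hfm := (Lp.memLp f).1
  have hGm : AEStronglyMeasurable G μ := by
    refine AEMeasurable.aestronglyMeasurable ?_
    have := hfm.aemeasurable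
    fun_prop
  have hGn : ∀ t, ‖G t‖ = ‖f t‖ ^ (p.toReal - 1) := fun t => by
    rw [hG]
    simp only [norm_mul, RCLike.norm_conj, Complex.norm_real, Real.norm_eq_abs]
    rw [abs_of_nonneg (Real.rpow_nonneg (norm_nonneg _) _)]
    rcases (norm_nonneg (f t)).eq_or_lt with h | h
    · rw [← h, zero_mul, Real.zero_rpow hP.ne']
    · nth_rewrite 1 [← Real.rpow_one ‖f t‖]
      rw [← Real.rpow_add h]; congr 1; ring
  have hGnorm : eLpNorm G q μ = eLpNorm f p μ ^ (p.toReal - 1) := by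
    rw [← eLpNorm_norm]
    simp only [hGn]
    rw [eLpNorm_norm_rpow _ hP, hexp]
  have hGmem : MemLp G q μ :=
    ⟨hGm, by rw [hGnorm]; exact ENNReal.rpow_lt_top_of_nonneg hP.le (Lp.eLpNorm_ne_top f)⟩
  refine ⟨hGmem.toLp, ?_, ?_⟩
  · rw [lpDuality_apply, Lp_norm_rpow_eq_integral hp0 hp, ← integral_complex_ofReal]
    refine integral_congr_ae ?_
    filter_upwards [hGmem.coeFn_toLp] with t ht
    rw [ht, hG]
    simp only
    rw [← mul_assoc, Complex.mul_conj, Complex.normSq_eq_norm_sq, ← Complex.ofReal_mul]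
    congr 1
    rcases (norm_nonneg (f t)).eq_or_lt with h | h
    · rw [← h, Real.zero_rpow hpq.pos.ne']; simp
    · rw [← Real.rpow_natCast, ← Real.rpow_add h]; congr 1; push_cast; ring
  · rw [Lp.norm_toLp, hGnorm, ← ENNReal.toReal_rpow, Lp.norm_def]

theorem norm_le_norm_lpDuality (hp : p ≠ ∞) (hq : q ≠ ∞) (f : Lp ℂ p μ) :
    ‖f‖ ≤ ‖lpDuality μ p q f‖ := by
  obtain ⟨g, hg, hg'⟩ := exists_lpDuality_eq_norm_rpow (q := q) hp hq f
  rcases (norm_nonneg f).eq_or_lt with h | h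
  · rw [← h]; positivity
  have h1 : ‖f‖ ^ p.toReal ≤ ‖lpDuality μ p q f‖ * ‖f‖ ^ (p.toReal - 1) := by
    calc ‖f‖ ^ p.toReal = ‖lpDuality μ p q f g‖ := by
          rw [hg, Complex.norm_real, Real.norm_of_nonneg (by positivity)]
      _ ≤ ‖lpDuality μ p q f‖ * ‖g‖ := ContinuousLinearMap.le_opNorm _ _
      _ ≤ _ := by gcongr
  have h2 : ‖f‖ ^ p.toReal = ‖f‖ * ‖f‖ ^ (p.toReal - 1) := by
    rw [Real.rpow_sub_one h.ne']; field_simp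
  rw [h2] at h1
  exact le_of_mul_le_mul_right h1 (by positivity)

/-- Multiplication by the indicator of a set, as an operator on `L^q`. -/
def lpIndicator [IsFiniteMeasure μ] {A : Set α} (hA : MeasurableSet A) : Lp ℂ q μ →L[ℂ] Lp ℂ q μ :=
  (ContinuousLinearMap.mul ℂ ℂ).holderL μ ∞ q q (indicatorConstLp ∞ hA (measure_ne_top μ A) 1)

theorem lpIndicator_coeFn [IsFiniteMeasure μ] {A : Set α} (hA : MeasurableSet A) (g : Lp ℂ q μ) :
    lpIndicator hA g =ᵐ[μ] A.indicator g := by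
  have h1 := (ContinuousLinearMap.mul ℂ ℂ).coeFn_holder (r := q)
    (indicatorConstLp ∞ hA (measure_ne_top μ A) (1 : ℂ)) g
  filter_upwards [h1, indicatorConstLp_coeFn (p := ∞) (hs := hA) (hμs := measure_ne_top μ A)
    (c := (1 : ℂ))] with t ht ht'
  change (ContinuousLinearMap.holder q (ContinuousLinearMap.mul ℂ ℂ) _ g : Lp ℂ q μ) t = _
  rw [ht, ht']
  by_cases h : t ∈ A <;> simp [h]

theorem norm_lpIndicator_le [IsFiniteMeasure μ] {A : Set α} (hA : MeasurableSet A) (g : Lp ℂ q μ) :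
    ‖lpIndicator hA g‖ ≤ ‖g‖ := by
  refine Lp.norm_le_norm_of_ae_le ?_
  filter_upwards [lpIndicator_coeFn hA g] with t ht
  rw [ht]
  exact norm_indicator_le_norm_self _ _

theorem lpIndicator_indicatorConstLp [IsFiniteMeasure μ] {A B : Set α} (hA : MeasurableSet A)
    (hB : MeasurableSet B) :
    lpIndicator hA (indicatorConstLp q hB (measure_ne_top μ B) (1 : ℂ))
      = indicatorConstLp q (hB.inter hA) (measure_ne_top μ _) 1 := by
  refine Lp.ext ?_
  filter_upwards [lpIndicator_coeFn hA (indicatorConstLp q hB (measure_ne_top μ B) (1 : ℂ)),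
    indicatorConstLp_coeFn (p := q) (hs := hB) (hμs := measure_ne_top μ B) (c := (1 : ℂ)),
    indicatorConstLp_coeFn (p := q) (hs := hB.inter hA) (hμs := measure_ne_top μ _)
      (c := (1 : ℂ))] with t h1 h2 h3
  rw [h1, h3]
  by_cases ha : t ∈ A <;> by_cases hb : t ∈ B <;> simp [ha, hb, h2]

theorem lpDuality_indicatorConstLp [IsFiniteMeasure μ] (f : Lp ℂ p μ) {A : Set α}
    (hA : MeasurableSet A) :
    lpDuality μ p q f (indicatorConstLp q hA (measure_ne_top μ A) 1) = ∫ t in A, f t ∂μ := by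
  rw [lpDuality_apply, ← integral_indicator hA]
  refine integral_congr_ae ?_
  filter_upwards [indicatorConstLp_coeFn (p := q) (hs := hA) (hμs := measure_ne_top μ A)
    (c := (1 : ℂ))] with t ht
  rw [ht]
  by_cases h : t ∈ A <;> simp [h]

/-- **Riesz representation** of the functionals on `L^q`, for a finite measure. -/
theorem exists_lpDuality_eq [IsFiniteMeasure μ] (hp : p ≠ ∞) (hq : q ≠ ∞)
    (Λ : Lp ℂ q μ →L[ℂ] ℂ) : ∃ f : Lp ℂ p μ, lpDuality μ p q f = Λ := by
  obtain ⟨f₀, hf₀, hfΛ₀⟩ := exists_integrable_setIntegral_eq hq Λ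
  obtain ⟨f, hfm, hf, hfΛ⟩ : ∃ f : α → ℂ, StronglyMeasurable f ∧ Integrable f μ ∧
      ∀ A (hA : MeasurableSet A),
        ∫ t in A, f t ∂μ = Λ (indicatorConstLp q hA (measure_ne_top μ A) 1) :=
    ⟨hf₀.1.mk f₀, hf₀.1.stronglyMeasurable_mk, hf₀.congr hf₀.1.ae_eq_mk, fun A hA => by
      rw [← hfΛ₀ A hA]
      exact integral_congr_ae (ae_restrict_of_ae hf₀.1.ae_eq_mk.symm)⟩
  set A : ℕ → Set α := fun M => {t | ‖f t‖ ≤ M} with hAdef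
  have hA : ∀ M, MeasurableSet (A M) := fun M => measurableSet_le hfm.norm.measurable
    measurable_const
  have hmem : ∀ M, MemLp ((A M).indicator f) p μ := fun M =>
    MemLp.of_bound (hfm.indicator (hA M)).aestronglyMeasurable M <| Eventually.of_forall fun t => by
      by_cases h : t ∈ A M
      · rw [Set.indicator_of_mem h]
        exact h
      · simp [h]
  have htrunc : ∀ M, lpDuality μ p q (hmem M).toLp = Λ ∘L lpIndicator (hA M) := fun M => by
    refine Lp_clm_ext hq fun B hB => ?_
    rw [lpDuality_indicatorConstLp, ContinuousLinearMap.comp_apply, lpIndicator_indicatorConstLp,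
      ← hfΛ, ← setIntegral_indicator (hA M)]
    exact integral_congr_ae (ae_restrict_of_ae (hmem M).coeFn_toLp)
  have hbound : ∀ M, eLpNorm ((A M).indicator f) p μ ≤ ENNReal.ofReal ‖Λ‖ := fun M => by
    have h1 : ‖(hmem M).toLp‖ ≤ ‖Λ‖ := by
      refine (norm_le_norm_lpDuality (q := q) hp hq _).trans ?_
      rw [htrunc]
      refine ContinuousLinearMap.opNorm_le_bound _ (norm_nonneg _) fun g => ?_
      exact (Λ.le_opNorm _).trans (by gcongr; exact norm_lpIndicator_le _ _)
    rw [Lp.norm_toLp] at h1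
    exact (ENNReal.le_ofReal_iff_toReal_le (hmem M).2.ne (norm_nonneg _)).2 h1
  have hlim : eLpNorm f p μ ≤ ENNReal.ofReal ‖Λ‖ := by
    refine Lp.eLpNorm_le_of_ae_tendsto (u := atTop) (Eventually.of_forall hbound)
      (fun M => (hmem M).1) (Eventually.of_forall fun t => tendsto_const_nhds.congr' ?_)
    obtain ⟨M₀, hM₀⟩ := exists_nat_ge ‖f t‖
    filter_upwards [eventually_ge_atTop M₀] with M hM
    have : t ∈ A M := hM₀.trans (by exact_mod_cast hM)
    simp [this]
  have hfp : MemLp f p μ := ⟨hf.1, hlim.trans_lt ENNReal.ofReal_lt_top⟩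
  refine ⟨hfp.toLp, Lp_clm_ext hq fun B hB => ?_⟩
  rw [lpDuality_indicatorConstLp, ← hfΛ]
  exact integral_congr_ae (ae_restrict_of_ae hfp.coeFn_toLp)

end LpRiesz

section Mean

/-- `HasMean u v`: the Cesàro averages of `u` converge to `v` along a fixed free ultrafilter. -/
def HasMean (u : ℕ → ℂ) (v : ℂ) : Prop :=
  Tendsto (fun N : ℕ => (N : ℝ)⁻¹ • ∑ n ∈ Finset.range N, u n) (hyperfilter ℕ) (𝓝 v)

variable {u w : ℕ → ℂ} {v v' : ℂ}

theorem HasMean.unique (h : HasMean u v) (h' : HasMean u v') : v = v' :=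
  tendsto_nhds_unique h h'

theorem HasMean.add (h : HasMean u v) (h' : HasMean w v') :
    HasMean (fun n => u n + w n) (v + v') := by
  refine (Tendsto.add h h').congr fun N => ?_
  rw [Finset.sum_add_distrib, smul_add]

theorem HasMean.const_mul (c : ℂ) (h : HasMean u v) : HasMean (fun n => c * u n) (c * v) := by
  refine (Tendsto.const_mul c h).congr fun N => ?_
  rw [← Finset.mul_sum, mul_smul_comm]

theorem hasMean_of_tendsto (h : Tendsto u atTop (𝓝 v)) : HasMean u v :=
  h.cesaro_smul.mono_left Nat.hyperfilter_le_atTop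

theorem hasMean_const (v : ℂ) : HasMean (fun _ => v) v := hasMean_of_tendsto tendsto_const_nhds

theorem norm_cesaro_le {C : ℝ} (hu : ∀ n, ‖u n‖ ≤ C) (N : ℕ) :
    ‖(N : ℝ)⁻¹ • ∑ n ∈ Finset.range N, u n‖ ≤ C := by
  have hC : 0 ≤ C := (norm_nonneg _).trans (hu 0)
  rcases Nat.eq_zero_or_pos N with rfl | hN
  · simpa using hC
  have hN' : (0 : ℝ) < N := by exact_mod_cast hN
  rw [norm_smul, norm_inv, Real.norm_natCast, inv_mul_le_iff₀ hN']
  exact (norm_sum_le_of_le _ fun n _ => hu n).trans_eq (by simp)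

theorem exists_hasMean {C : ℝ} (hu : ∀ n, ‖u n‖ ≤ C) : ∃ v, ‖v‖ ≤ C ∧ HasMean u v := by
  obtain ⟨v, hv, hlim⟩ := (isCompact_closedBall (0 : ℂ) C).ultrafilter_le_nhds
    ((hyperfilter ℕ).map fun N : ℕ => (N : ℝ)⁻¹ • ∑ n ∈ Finset.range N, u n) (by
      rw [le_principal_iff, Ultrafilter.coe_map, mem_map]
      exact Eventually.of_forall fun N => by simpa using norm_cesaro_le hu N)
  exact ⟨v, by simpa using hv, hlim⟩

theorem HasMean.succ {C : ℝ} (hu : ∀ n, ‖u n‖ ≤ C) (h : HasMean u v) :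
    HasMean (fun n => u (n + 1)) v := by
  have h0 : Tendsto (fun N : ℕ => (N : ℝ)⁻¹ • (u N - u 0)) atTop (𝓝 0) := by
    rw [tendsto_zero_iff_norm_tendsto_zero]
    have h1 : Tendsto (fun N : ℕ => (N : ℝ)⁻¹ * (C + C)) atTop (𝓝 0) := by
      simpa using tendsto_inv_atTop_nhds_zero_nat.mul_const (C + C)
    refine squeeze_zero (fun _ => norm_nonneg _) (fun N => ?_) h1
    rw [norm_smul, norm_inv, Real.norm_natCast]
    gcongr
    exact norm_sub_le_of_le (hu N) (hu 0)
  have := Tendsto.add h (h0.mono_left Nat.hyperfilter_le_atTop)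
  rw [add_zero] at this
  refine this.congr fun N => ?_
  rw [← smul_add]
  congr 1
  rw [add_sub, ← Finset.sum_range_succ, Finset.sum_range_succ', add_sub_cancel_right]

theorem hasMean_pow_eq_zero {ω : ℂ} (hω : ‖ω‖ = 1) (h1 : ω ≠ 1) : HasMean (fun n => ω ^ n) 0 := by
  have hb : ∀ n : ℕ, ‖ω ^ n‖ ≤ 1 := fun n => by rw [norm_pow, hω, one_pow]
  obtain ⟨v, -, hv⟩ := exists_hasMean hb
  have h2 : HasMean (fun n => ω ^ (n + 1)) (ω * v) := by
    simpa only [pow_succ'] using hv.const_mul ω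
  have h3 : (ω - 1) * v = 0 := by
    rw [sub_mul, one_mul, h2.unique (hv.succ hb), sub_self]
  rcases mul_eq_zero.1 h3 with h | h
  · exact absurd (sub_eq_zero.1 h) h1
  · rwa [h] at hv

end Mean

section MeanOperator

variable {α : Type*} {mα : MeasurableSpace α} {μ : Measure α}
variable {p q : ℝ≥0∞} [Fact (1 ≤ p)] [Fact (1 ≤ q)] [p.HolderConjugate q]

theorem norm_lpDuality_apply_le (f : Lp ℂ p μ) (g : Lp ℂ q μ) :
    ‖lpDuality μ p q f g‖ ≤ ‖f‖ * ‖g‖ := by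
  have h1 : ‖lpDuality μ p q f g‖ ≤
      ‖(ContinuousLinearMap.mul ℂ ℂ).holder 1 f g‖ := by
    simpa [ContinuousLinearMap.lpPairing, ← L1.integral_eq'] using L1.norm_integral_le _
  refine h1.trans (((ContinuousLinearMap.mul ℂ ℂ).norm_holder_apply_apply_le f g).trans ?_)
  have := ContinuousLinearMap.opNorm_mul_le ℂ ℂ
  calc _ ≤ 1 * ‖f‖ * ‖g‖ := by gcongr
    _ = _ := by rw [one_mul]

theorem lpDuality_injective (hp : p ≠ ∞) (hq : q ≠ ∞) {f f' : Lp ℂ p μ}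
    (h : ∀ g, lpDuality μ p q f g = lpDuality μ p q f' g) : f = f' := by
  have h1 := norm_le_norm_lpDuality (q := q) hp hq (f - f')
  have h2 : lpDuality μ p q (f - f') = 0 := by
    ext g
    rw [map_sub, _root_.sub_apply, h g, sub_self, _root_.zero_apply]
  rw [h2, norm_zero, norm_le_zero_iff, sub_eq_zero] at h1
  exact h1

variable [IsFiniteMeasure μ]

theorem exists_weak_mean (hp : p ≠ ∞) (hq : q ≠ ∞) (y : lp (fun _ : ℕ => Lp ℂ p μ) ∞) :
    ∃ f : Lp ℂ p μ, ‖f‖ ≤ ‖y‖ ∧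
      ∀ g, HasMean (fun n => lpDuality μ p q (y n) g) (lpDuality μ p q f g) := by
  have hb : ∀ (g : Lp ℂ q μ) (n : ℕ), ‖lpDuality μ p q (y n) g‖ ≤ ‖y‖ * ‖g‖ := fun g n =>
    (norm_lpDuality_apply_le _ _).trans (by
      gcongr
      exact lp.norm_apply_le_norm ENNReal.top_ne_zero y n)
  choose Λ hΛ hΛ' using fun g => exists_hasMean (hb g)
  let L : Lp ℂ q μ →L[ℂ] ℂ := LinearMap.mkContinuous
    { toFun := Λ
      map_add' := fun g g' => (hΛ' (g + g')).unique <| by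
        simpa only [map_add] using (hΛ' g).add (hΛ' g')
      map_smul' := fun c g => (hΛ' (c • g)).unique <| by
        simpa only [map_smul, smul_eq_mul, RingHom.id_apply] using (hΛ' g).const_mul c } ‖y‖ hΛ
  obtain ⟨f, hf⟩ := exists_lpDuality_eq hp hq L
  refine ⟨f, ?_, fun g => ?_⟩
  · refine (norm_le_norm_lpDuality hp hq f).trans ?_
    rw [hf]
    exact LinearMap.mkContinuous_norm_le _ (norm_nonneg _) _
  · rw [hf]
    exact hΛ' g

variable (μ p q) in
/-- A contraction from `ℓ^∞(L^p)` to `L^p` assigning to a bounded sequence a weak limit of its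
Cesàro averages. -/
theorem exists_mean_operator (hp : p ≠ ∞) (hq : q ≠ ∞) :
    ∃ m : lp (fun _ : ℕ => Lp ℂ p μ) ∞ →L[ℂ] Lp ℂ p μ, ‖m‖ ≤ 1 ∧
      ∀ y g, HasMean (fun n => lpDuality μ p q (y n) g) (lpDuality μ p q (m y) g) := by
  choose m hm hm' using fun y => exists_weak_mean (q := q) (μ := μ) hp hq y
  refine ⟨LinearMap.mkContinuous
    { toFun := m
      map_add' := fun y z => lpDuality_injective hp hq fun g => (hm' (y + z) g).unique <| by
        simpa using (hm' y g).add (hm' z g)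
      map_smul' := fun c y => lpDuality_injective hp hq fun g => (hm' (c • y) g).unique <| by
        simpa using (hm' y g).const_mul c } 1 (fun y => by simpa using hm y),
    LinearMap.mkContinuous_norm_le _ zero_le_one _, hm'⟩

end MeanOperator

section Circle

variable (p q : ℝ≥0∞) [Fact (1 ≤ p)] [Fact (1 ≤ q)]

/-- The exponential `t ↦ exp (i a t)` as an element of `L^p(𝕋)`. -/
def circleExp (a : ℤ) : LpCircle p := ContinuousMap.toLp p volume ℂ (fourier a)

/-- Translation by `s` on `L^p(𝕋)`. -/
def circleTranslate (s : AddCircle (2 * Real.pi)) : LpCircle p →L[ℂ] LpCircle p :=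
  (Lp.compMeasurePreservingₗᵢ ℂ (· + s)
    (measurePreserving_add_right volume s)).toContinuousLinearMap

/-- Multiplication by the exponential of frequency `n` on `L^p(𝕋)`. -/
def circleModulate (n : ℤ) : LpCircle p →L[ℂ] LpCircle p :=
  (ContinuousLinearMap.mul ℂ ℂ).holderL volume ∞ p p (circleExp ∞ n)

/-- The (unnormalized) Fourier coefficient `f ↦ ∫ f(t) exp (-i b t) dt` on `L^p(𝕋)`. -/
def circleCoeff [p.HolderConjugate q] (b : ℤ) : LpCircle p →L[ℂ] ℂ :=
  (lpDuality volume p q).flip (circleExp q (-b))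

variable {p q}

theorem circleExp_coeFn (a : ℤ) : circleExp p a =ᵐ[volume] fourier a :=
  ContinuousMap.coeFn_toLp volume _

theorem circleTranslate_coeFn (s : AddCircle (2 * Real.pi)) (f : LpCircle p) :
    circleTranslate p s f =ᵐ[volume] fun t => f (t + s) :=
  Lp.coeFn_compMeasurePreserving f (measurePreserving_add_right volume s)

theorem circleModulate_coeFn (n : ℤ) (f : LpCircle p) :
    circleModulate p n f =ᵐ[volume] fun t => fourier n t * f t := by
  have h1 := (ContinuousLinearMap.mul ℂ ℂ).coeFn_holder (r := p) (circleExp ∞ n) f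
  filter_upwards [h1, circleExp_coeFn (p := ∞) n] with t h2 h3
  change (ContinuousLinearMap.holder p (ContinuousLinearMap.mul ℂ ℂ) _ f : LpCircle p) t = _
  rw [h2, h3]
  simp

theorem norm_circleTranslate_le (s : AddCircle (2 * Real.pi)) : ‖circleTranslate p s‖ ≤ 1 :=
  LinearIsometry.norm_toContinuousLinearMap_le _

theorem norm_circleModulate_le (n : ℤ) : ‖circleModulate p n‖ ≤ 1 := by
  refine ContinuousLinearMap.opNorm_le_bound _ zero_le_one fun f => ?_
  rw [one_mul]
  refine Lp.norm_le_norm_of_ae_le ?_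
  filter_upwards [circleModulate_coeFn n f] with t ht
  rw [ht, norm_mul, fourier_apply, Circle.norm_coe, one_mul]

theorem circleTranslate_neg_comp (s : AddCircle (2 * Real.pi)) (f : LpCircle p) :
    circleTranslate p (-s) (circleTranslate p s f) = f := by
  refine Lp.ext ?_
  have h := (measurePreserving_add_right (volume : Measure (AddCircle (2 * Real.pi)))
    (-s)).quasiMeasurePreserving.ae (circleTranslate_coeFn s f)
  filter_upwards [circleTranslate_coeFn (-s) (circleTranslate p s f), h] with t h1 h2
  rw [h1, h2, neg_add_cancel_right]

theorem circleModulate_neg_comp (n : ℤ) (f : LpCircle p) :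
    circleModulate p (-n) (circleModulate p n f) = f := by
  refine Lp.ext ?_
  filter_upwards [circleModulate_coeFn (-n) (circleModulate p n f), circleModulate_coeFn n f]
    with t h1 h2
  rw [h1, h2, ← mul_assoc, ← fourier_add, neg_add_cancel, fourier_zero, one_mul]

theorem circleTranslate_circleExp (s : AddCircle (2 * Real.pi)) (a : ℤ) :
    circleTranslate p s (circleExp p a) = fourier a s • circleExp p a := by
  refine Lp.ext ?_
  have h := (measurePreserving_add_right (volume : Measure (AddCircle (2 * Real.pi)))
    s).quasiMeasurePreserving.ae (circleExp_coeFn (p := p) a)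
  filter_upwards [circleTranslate_coeFn s (circleExp p a), h, circleExp_coeFn (p := p) a,
    Lp.coeFn_smul (fourier a s) (circleExp p a)] with t h1 h2 h3 h4
  rw [h1, h2, h4, Pi.smul_apply, h3, fourier_apply, smul_add, AddCircle.toCircle_add,
    Circle.coe_mul, smul_eq_mul, mul_comm]
  rfl

theorem circleModulate_circleExp (n a : ℤ) :
    circleModulate p n (circleExp p a) = circleExp p (a + n) := by
  refine Lp.ext ?_
  filter_upwards [circleModulate_coeFn n (circleExp p a), circleExp_coeFn (p := p) a,
    circleExp_coeFn (p := p) (a + n)] with t h1 h2 h3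
  rw [h1, h2, h3, fourier_add, mul_comm]

variable [p.HolderConjugate q]

theorem circleCoeff_apply (b : ℤ) (f : LpCircle p) :
    circleCoeff p q b f = ∫ t, f t * fourier (-b) t := by
  rw [circleCoeff, ContinuousLinearMap.flip_apply, lpDuality_apply]
  refine integral_congr_ae ?_
  filter_upwards [circleExp_coeFn (p := q) (-b)] with t ht
  rw [ht]

theorem circleCoeff_circleTranslate (s : AddCircle (2 * Real.pi)) (b : ℤ) (f : LpCircle p) :
    circleCoeff p q b (circleTranslate p s f) = fourier b s * circleCoeff p q b f := by
  rw [circleCoeff_apply, circleCoeff_apply, ← integral_const_mul,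
    ← integral_add_right_eq_self (fun t => fourier b s * (f t * fourier (-b) t)) s]
  refine integral_congr_ae ?_
  filter_upwards [circleTranslate_coeFn s f] with t ht
  have h : (fourier (-b) (t + s) : ℂ) = fourier (-b) t * fourier (-b) s := by
    rw [fourier_apply, smul_add, AddCircle.toCircle_add, Circle.coe_mul]; rfl
  have h' : (fourier b s : ℂ) * fourier (-b) s = 1 := by
    rw [← fourier_add, add_neg_cancel, fourier_zero]
  rw [ht, h]
  linear_combination (-(f (t + s) * fourier (-b) t)) * h'

theorem circleCoeff_circleModulate (n b : ℤ) (f : LpCircle p) :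
    circleCoeff p q b (circleModulate p n f) = circleCoeff p q (b - n) f := by
  rw [circleCoeff_apply, circleCoeff_apply]
  refine integral_congr_ae ?_
  filter_upwards [circleModulate_coeFn n f] with t ht
  rw [ht, show -(b - n) = n + -b by ring, fourier_add]
  ring

theorem fourier_one_ne_one {m : ℤ} (hm : m ≠ 0) :
    fourier m ((1 : ℝ) : AddCircle (2 * Real.pi)) ≠ 1 := by
  rw [fourier_coe_apply, Ne, Complex.exp_eq_one_iff]
  rintro ⟨n, hn⟩
  have h1 : (m : ℂ) = n * (2 * Real.pi : ℝ) := by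
    have hpi : (Real.pi : ℂ) ≠ 0 := by exact_mod_cast Real.pi_ne_zero
    have hI := Complex.I_ne_zero
    push_cast at hn ⊢
    field_simp at hn
    rw [hn]
    ring
  have h2 : (m : ℝ) = n * (2 * Real.pi) := by exact_mod_cast h1
  have hn0 : n ≠ 0 := by
    rintro rfl
    simp at h2
    exact hm h2
  refine irrational_pi ⟨m / (n * 2), ?_⟩
  have : (n : ℝ) ≠ 0 := by exact_mod_cast hn0
  push_cast
  rw [h2]
  field_simp

theorem circleCoeff_circleExp_of_ne {a b : ℤ} (h : a ≠ b) :
    circleCoeff p q b (circleExp p a) = 0 := by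
  have h1 := circleCoeff_circleTranslate (q := q) ((1 : ℝ) : AddCircle (2 * Real.pi)) b
    (circleExp p a)
  rw [circleTranslate_circleExp, map_smul, smul_eq_mul, show a = b + (a - b) by ring, fourier_add,
    mul_assoc] at h1
  have h2 := mul_left_cancel₀ (by rw [fourier_apply]; exact Circle.coe_ne_zero _) h1
  by_contra h3
  refine fourier_one_ne_one (sub_ne_zero.2 h) (mul_right_cancel₀ h3 ?_)
  rw [one_mul]
  simpa using h2

theorem circleCoeff_circleExp_self (a : ℤ) :
    circleCoeff p q a (circleExp p a) = (2 * Real.pi : ℝ) := by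
  rw [circleCoeff_apply]
  have : ∫ t : AddCircle (2 * Real.pi), circleExp p a t * fourier (-a) t
      = ∫ t : AddCircle (2 * Real.pi), (1 : ℂ) := by
    refine integral_congr_ae ?_
    filter_upwards [circleExp_coeFn (p := p) a] with t ht
    rw [ht, ← fourier_add, add_neg_cancel, fourier_zero]
  rw [this, integral_const, measureReal_def, AddCircle.measure_univ,
    ENNReal.toReal_ofReal (by positivity)]
  simp

theorem circle_clm_ext (hp : p ≠ ∞) {F : Type*} [NormedAddCommGroup F] [NormedSpace ℂ F]
    {Φ Ψ : LpCircle p →L[ℂ] F} (h : ∀ a, Φ (circleExp p a) = Ψ (circleExp p a)) : Φ = Ψ := by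
  have h1 : Φ ∘L ContinuousMap.toLp p volume ℂ = Ψ ∘L ContinuousMap.toLp p volume ℂ := by
    refine ContinuousLinearMap.ext_on (s := Set.range (fourier (T := 2 * Real.pi))) ?_ ?_
    · exact Submodule.dense_iff_topologicalClosure_eq_top.2 span_fourier_closure_eq_top
    · rintro _ ⟨a, rfl⟩
      exact h a
  refine DFunLike.coe_injective ((ContinuousMap.toLp_denseRange ℂ volume ℂ hp).equalizer
    Φ.continuous Ψ.continuous ?_)
  ext1 g
  exact DFunLike.congr_fun h1 g

theorem eq_of_circleCoeff_eq (hp : p ≠ ∞) (hq : q ≠ ∞) {f g : LpCircle p}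
    (h : ∀ b, circleCoeff p q b f = circleCoeff p q b g) : f = g := by
  have h1 : lpDuality volume p q f = lpDuality volume p q g :=
    circle_clm_ext hq fun a => by simpa [circleCoeff] using h (-a)
  exact lpDuality_injective hp hq fun u => by rw [h1]

end Circle

section Averaging

theorem exists_strictMono_forall_tendsto {κ : Type*} [Countable κ] (s : ℕ → κ → ℂ) {C : ℝ}
    (hs : ∀ n i, ‖s n i‖ ≤ C) :
    ∃ (d : κ → ℂ) (φ : ℕ → ℕ), (∀ i, ‖d i‖ ≤ C) ∧ StrictMono φ ∧
      ∀ i, Tendsto (fun n => s (φ n) i) atTop (𝓝 (d i)) := by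
  have hcpt : IsCompact (Set.univ.pi fun _ : κ => Metric.closedBall (0 : ℂ) C) :=
    isCompact_univ_pi fun _ => isCompact_closedBall 0 C
  obtain ⟨d, hd, φ, hφ, hlim⟩ := hcpt.tendsto_subseq (x := s)
    fun n i _ => by simpa using hs n i
  exact ⟨d, φ, fun i => by simpa using hd i trivial, hφ, fun i => tendsto_pi_nhds.1 hlim i⟩

section MeanComp

variable {X Y Y' : Type*} [NormedAddCommGroup X] [NormedSpace ℂ X]
  [NormedAddCommGroup Y] [NormedSpace ℂ Y] [NormedAddCommGroup Y'] [NormedSpace ℂ Y']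

/-- The average, with respect to `m`, of a sequence of contractions. -/
def averageClm (m : lp (fun _ : ℕ => X) ∞ →L[ℂ] X) (L : ℕ → Y →L[ℂ] X) (hL : ∀ n, ‖L n‖ ≤ 1) :
    Y →L[ℂ] X :=
  m ∘L lpInftyLift L 1 hL

variable {m : lp (fun _ : ℕ => X) ∞ →L[ℂ] X}

theorem norm_averageClm_le (hm : ‖m‖ ≤ 1) (L : ℕ → Y →L[ℂ] X) (hL : ∀ n, ‖L n‖ ≤ 1) :
    ‖averageClm m L hL‖ ≤ 1 := by
  refine (ContinuousLinearMap.opNorm_comp_le _ _).trans ?_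
  have := norm_lpInftyLift_le L 1 hL
  calc _ ≤ 1 * (1 : ℝ) := by gcongr
    _ = 1 := one_mul 1

theorem averageClm_congr {L : ℕ → Y →L[ℂ] X} {hL : ∀ n, ‖L n‖ ≤ 1} {L' : ℕ → Y' →L[ℂ] X}
    {hL' : ∀ n, ‖L' n‖ ≤ 1} {y : Y} {y' : Y'} (h : ∀ n, L n y = L' n y') :
    averageClm m L hL y = averageClm m L' hL' y' := by
  simp only [averageClm, ContinuousLinearMap.comp_apply]
  congr 1
  ext n : 2
  exact h n

/-- The iterated average, with respect to `m`, of a triple sequence of contractions. -/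
def tripleAverageClm (hm : ‖m‖ ≤ 1) (L : ℕ → ℕ → ℕ → Y →L[ℂ] X)
    (hL : ∀ n k l, ‖L n k l‖ ≤ 1) : Y →L[ℂ] X :=
  averageClm m (fun n => averageClm m (fun k => averageClm m (L n k) (hL n k))
    fun k => norm_averageClm_le hm (L n k) (hL n k)) fun _ => norm_averageClm_le hm _ _

theorem norm_tripleAverageClm_le (hm : ‖m‖ ≤ 1) (L : ℕ → ℕ → ℕ → Y →L[ℂ] X)
    (hL : ∀ n k l, ‖L n k l‖ ≤ 1) : ‖tripleAverageClm hm L hL‖ ≤ 1 :=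
  norm_averageClm_le hm _ _

theorem tripleAverageClm_congr (hm : ‖m‖ ≤ 1) {L : ℕ → ℕ → ℕ → Y →L[ℂ] X}
    {hL : ∀ n k l, ‖L n k l‖ ≤ 1} {L' : ℕ → ℕ → ℕ → Y' →L[ℂ] X}
    {hL' : ∀ n k l, ‖L' n k l‖ ≤ 1} {y : Y} {y' : Y'} (h : ∀ n k l, L n k l y = L' n k l y') :
    tripleAverageClm hm L hL y = tripleAverageClm hm L' hL' y' :=
  averageClm_congr fun n => averageClm_congr fun k => averageClm_congr fun l => h n k l

end MeanComp

variable (p q : ℝ≥0∞) [Fact (1 ≤ p)] [Fact (1 ≤ q)]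

/-- The isometry `f ↦ (t ↦ exp (i n t) f (t + k))` of `L^p(𝕋)`. -/
def circleShift (n k : ℕ) : LpCircle p →L[ℂ] LpCircle p :=
  circleModulate p n ∘L circleTranslate p (k • ((1 : ℝ) : AddCircle (2 * Real.pi)))

/-- The inverse of `circleShift`. -/
def circleUnshift (n k : ℕ) : LpCircle p →L[ℂ] LpCircle p :=
  circleTranslate p (-(k • ((1 : ℝ) : AddCircle (2 * Real.pi)))) ∘L circleModulate p (-n)

variable {p q}

theorem norm_circleShift_le (n k : ℕ) : ‖circleShift p n k‖ ≤ 1 :=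
  (ContinuousLinearMap.opNorm_comp_le _ _).trans
    (mul_le_one₀ (norm_circleModulate_le _) (norm_nonneg _) (norm_circleTranslate_le _))

theorem norm_circleUnshift_le (n k : ℕ) : ‖circleUnshift p n k‖ ≤ 1 :=
  (ContinuousLinearMap.opNorm_comp_le _ _).trans
    (mul_le_one₀ (norm_circleTranslate_le _) (norm_nonneg _) (norm_circleModulate_le _))

theorem circleUnshift_circleShift (n k : ℕ) (f : LpCircle p) :
    circleUnshift p n k (circleShift p n k f) = f := by
  simp only [circleUnshift, circleShift, ContinuousLinearMap.comp_apply]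
  rw [circleModulate_neg_comp, circleTranslate_neg_comp]

variable [p.HolderConjugate q]

theorem circleCoeff_unshift_shift (n k : ℕ) (a b : ℤ) (D : LpCircle p →L[ℂ] LpCircle p) :
    circleCoeff p q b (circleUnshift p n k (D (circleShift p n k (circleExp p a))))
      = fourier (a - b) ((1 : ℝ) : AddCircle (2 * Real.pi)) ^ k *
        circleCoeff p q (b + n) (D (circleExp p (a + n))) := by
  simp only [circleUnshift, circleShift, ContinuousLinearMap.comp_apply]
  rw [circleTranslate_circleExp, map_smul, circleModulate_circleExp, map_smul,
    circleCoeff_circleTranslate, circleCoeff_circleModulate, map_smul, smul_eq_mul, sub_neg_eq_add,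
    ← mul_assoc]
  congr 1
  have h1 : ∀ s : AddCircle (2 * Real.pi), (fourier b (-s) : ℂ) = fourier (-b) s := fun s => by
    rw [fourier_apply, fourier_apply, smul_neg, neg_smul]
  have h2 : ∀ (c : ℤ) (s : AddCircle (2 * Real.pi)), (fourier c (k • s) : ℂ) = fourier c s ^ k :=
    fun c s => by
      rw [fourier_apply, fourier_apply, smul_comm, AddCircle.toCircle_nsmul, Circle.coe_pow]
  rw [h1, h2, h2, ← mul_pow, ← fourier_add, neg_add_eq_sub]

theorem norm_circleCoeff_apply_circleExp_le {D : LpCircle p →L[ℂ] LpCircle p} (hD : ‖D‖ ≤ 1)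
    (a b : ℤ) : ‖circleCoeff p q b (D (circleExp p a))‖ ≤
      ‖(ContinuousMap.toLp p (volume : Measure (AddCircle (2 * Real.pi))) ℂ :
          C(AddCircle (2 * Real.pi), ℂ) →L[ℂ] Lp ℂ p volume)‖ *
        ‖(ContinuousMap.toLp q (volume : Measure (AddCircle (2 * Real.pi))) ℂ :
          C(AddCircle (2 * Real.pi), ℂ) →L[ℂ] Lp ℂ q volume)‖ := by
  refine (norm_lpDuality_apply_le (D (circleExp p a)) (circleExp q (-b))).trans ?_
  gcongr
  · refine (D.le_of_opNorm_le hD _).trans ?_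
    rw [one_mul]
    refine (ContinuousLinearMap.le_opNorm _ _).trans_eq ?_
    rw [fourier_norm, mul_one]
  · refine (ContinuousLinearMap.le_opNorm _ _).trans_eq ?_
    rw [fourier_norm, mul_one]

variable {m : lp (fun _ : ℕ => LpCircle p) ∞ →L[ℂ] LpCircle p}

theorem hasMean_circleCoeff_averageClm {Y : Type*} [NormedAddCommGroup Y] [NormedSpace ℂ Y]
    (hm : ∀ y g, HasMean (fun n => lpDuality volume p q (y n) g) (lpDuality volume p q (m y) g))
    (L : ℕ → Y →L[ℂ] LpCircle p) (hL : ∀ n, ‖L n‖ ≤ 1) (b : ℤ) (y : Y) :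
    HasMean (fun n => circleCoeff p q b (L n y)) (circleCoeff p q b (averageClm m L hL y)) :=
  hm (lpInftyLift L 1 hL y) (circleExp q (-b))

theorem HasMean.int_shift {u : ℤ → ℂ} {v : ℂ} {C : ℝ} (hu : ∀ a, ‖u a‖ ≤ C)
    (h : HasMean (fun n : ℕ => u n) v) (a : ℤ) : HasMean (fun n : ℕ => u (a + n)) v := by
  induction a with
  | zero => simpa using h
  | succ i ih =>
    have := ih.succ fun _ => hu _
    push_cast at this
    simpa only [add_assoc, add_comm (1 : ℤ)] using this
  | pred i ih =>
    obtain ⟨w, -, hw⟩ := exists_hasMean fun n : ℕ => hu (-i - 1 + n)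
    have h1 := hw.succ fun _ => hu _
    have h2 : HasMean (fun n : ℕ => u (-i + n)) w := by
      convert h1 using 3 with n
      rw [Nat.cast_add, Nat.cast_one, sub_add_add_cancel]
    rwa [ih.unique h2]

/-- Averaging the conjugates of operators whose matrix coefficients converge
yields a multiple of the identity. -/
theorem tripleAverageClm_unshift_comp_shift (hp : p ≠ ∞) (hq : q ≠ ∞) (hm1 : ‖m‖ ≤ 1)
    (hm : ∀ y g, HasMean (fun n => lpDuality volume p q (y n) g) (lpDuality volume p q (m y) g))
    (D : ℕ → ℕ → ℕ → LpCircle p →L[ℂ] LpCircle p)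
    (hL : ∀ n k l, ‖circleUnshift p n k ∘L D n k l ∘L circleShift p n k‖ ≤ 1)
    {d : ℤ × ℤ → ℂ} {C : ℝ} (hd : ∀ i, ‖d i‖ ≤ C)
    (hD : ∀ n k a b,
      Tendsto (fun l => circleCoeff p q b (D n k l (circleExp p a))) atTop (𝓝 (d (a, b))))
    {c : ℂ} (hc : HasMean (fun n : ℕ => d (n, n)) (c * (2 * Real.pi : ℝ))) :
    tripleAverageClm hm1 (fun n k l => circleUnshift p n k ∘L D n k l ∘L circleShift p n k) hL
      = c • ContinuousLinearMap.id ℂ (LpCircle p) := by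
  refine circle_clm_ext hp fun a => eq_of_circleCoeff_eq (q := q) hp hq fun b => ?_
  have h1 : ∀ n k, HasMean
      (fun l => circleCoeff p q b
        ((circleUnshift p n k ∘L D n k l ∘L circleShift p n k) (circleExp p a)))
      (fourier (a - b) ((1 : ℝ) : AddCircle (2 * Real.pi)) ^ k * d (a + n, b + n)) := fun n k => by
    refine hasMean_of_tendsto ?_
    simp only [ContinuousLinearMap.comp_apply, circleCoeff_unshift_shift]
    exact (hD n k (a + n) (b + n)).const_mul _
  have h2 : ∀ n, HasMean
      (fun k : ℕ => fourier (a - b) ((1 : ℝ) : AddCircle (2 * Real.pi)) ^ k * d (a + n, b + n))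
      (if a = b then d (a + n, a + n) else 0) := fun n => by
    split_ifs with hab
    · subst hab
      simpa using hasMean_const (d (a + n, a + n))
    · have := (hasMean_pow_eq_zero (by rw [fourier_apply, Circle.norm_coe])
        (fourier_one_ne_one (sub_ne_zero.2 hab))).const_mul (d (a + n, b + n))
      rw [mul_zero] at this
      simpa only [mul_comm] using this
  have h3 : HasMean (fun n : ℕ => if a = b then d (a + n, a + n) else 0)
      (circleCoeff p q b ((c • ContinuousLinearMap.id ℂ (LpCircle p)) (circleExp p a))) := by
    rw [_root_.smul_apply, ContinuousLinearMap.id_apply, map_smul, smul_eq_mul]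
    split_ifs with hab
    · subst hab
      rw [circleCoeff_circleExp_self]
      exact HasMean.int_shift (u := fun a => d (a, a)) (fun a => hd _) hc a
    · rw [circleCoeff_circleExp_of_ne hab, mul_zero]
      exact hasMean_const 0
  refine (hasMean_circleCoeff_averageClm hm _ _ b (circleExp p a)).unique ?_
  convert h3 using 2 with n
  refine (hasMean_circleCoeff_averageClm hm _ _ b (circleExp p a)).unique ?_
  convert h2 n using 2 with k
  exact (hasMean_circleCoeff_averageClm hm _ _ b (circleExp p a)).unique (h1 n k)

theorem tripleAverageClm_const (hp : p ≠ ∞) (hq : q ≠ ∞) (hm1 : ‖m‖ ≤ 1)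
    (hm : ∀ y g, HasMean (fun n => lpDuality volume p q (y n) g) (lpDuality volume p q (m y) g))
    {Y : Type*} [NormedAddCommGroup Y] [NormedSpace ℂ Y] {L : ℕ → ℕ → ℕ → Y →L[ℂ] LpCircle p}
    {hL : ∀ n k l, ‖L n k l‖ ≤ 1} {y : Y} {f : LpCircle p} (h : ∀ n k l, L n k l y = f) :
    tripleAverageClm hm1 L hL y = f := by
  have key : ∀ (K : ℕ → Y →L[ℂ] LpCircle p) (hK : ∀ n, ‖K n‖ ≤ 1), (∀ n, K n y = f) →
      averageClm m K hK y = f := fun K hK hKf =>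
    eq_of_circleCoeff_eq (q := q) hp hq fun b =>
      (hasMean_circleCoeff_averageClm hm K hK b y).unique <| by
        simpa only [hKf] using hasMean_const _
  exact key _ _ fun n => key _ _ fun k => key _ _ fun l => h n k l

end Averaging

section Factorization

theorem exists_mul_smul_one_add_eq_one {𝕜 A : Type*} [NormedField 𝕜] [NormedRing A]
    [CompleteSpace A] [NormedAlgebra 𝕜 A] (h1 : ‖(1 : A)‖ ≤ 1) {c : 𝕜} (hc : 1 / 2 ≤ ‖c‖) {f : A}
    (hf : ‖f‖ ≤ 1 / 4) : ∃ v : A, ‖v‖ ≤ 4 ∧ v * (c • 1 + f) = 1 := by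
  have hc0 : c ≠ 0 := by
    rintro rfl
    norm_num at hc
  have hcinv : ‖c⁻¹‖ ≤ 2 := by
    rw [norm_inv]
    exact inv_le_of_inv_le₀ two_pos (by simpa using hc)
  have ht : ‖-(c⁻¹ • f)‖ ≤ 1 / 2 := by
    rw [norm_neg, norm_smul]
    calc _ ≤ 2 * (1 / 4 : ℝ) := by gcongr
      _ = 1 / 2 := by norm_num
  set u := Units.oneSub (-(c⁻¹ • f)) (by linarith) with hu
  have hw : (↑u⁻¹ : A) * (1 - -(c⁻¹ • f)) = 1 := u.inv_mul
  have hw2 : ‖(↑u⁻¹ : A)‖ ≤ 2 := by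
    have h2 : (↑u⁻¹ : A) = 1 + ↑u⁻¹ * -(c⁻¹ • f) := by
      rw [mul_sub, mul_one] at hw
      exact sub_eq_iff_eq_add.1 hw
    have h3 : ‖(↑u⁻¹ : A)‖ ≤ 1 + ‖(↑u⁻¹ : A)‖ * (1 / 2) := by
      conv_lhs => rw [h2]
      refine (norm_add_le _ _).trans (add_le_add h1 ((norm_mul_le _ _).trans ?_))
      gcongr
    linarith
  refine ⟨c⁻¹ • ↑u⁻¹, ?_, ?_⟩
  · rw [norm_smul]
    calc _ ≤ 2 * (2 : ℝ) := by gcongr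
      _ = 4 := by norm_num
  · rw [smul_mul_assoc, ← mul_smul_comm, smul_add, smul_smul, inv_mul_cancel₀ hc0, one_smul,
      ← sub_neg_eq_add, hw]

section Spread

variable {X Y : Type*} [NormedAddCommGroup X] [NormedSpace ℂ X]
  [NormedAddCommGroup Y] [NormedSpace ℂ Y]

/-- The operator into `ℓ^∞(X)` whose coordinate `b t` is `L t`, and whose coordinates outside the
range of `b` vanish. -/
def lpInftySpread (b : ℕ → ℕ) (L : ℕ → Y →L[ℂ] X) (C : ℝ) (hL : ∀ t, ‖L t‖ ≤ C) :
    Y →L[ℂ] lp (fun _ : ℕ => X) ∞ :=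
  lpInftyLift (extend b L 0) C fun i => by
    classical
    rw [Function.extend_def]
    split_ifs
    · exact hL _
    · simpa using (norm_nonneg _).trans (hL 0)

variable {b : ℕ → ℕ} {L : ℕ → Y →L[ℂ] X} {C : ℝ} {hL : ∀ t, ‖L t‖ ≤ C}

theorem norm_lpInftySpread_le : ‖lpInftySpread b L C hL‖ ≤ C := norm_lpInftyLift_le _ _ _

theorem lpInftySpread_apply (hb : Injective b) (y : Y) (t : ℕ) :
    lpInftySpread b L C hL y (b t) = L t y := by
  rw [lpInftySpread, lpInftyLift_apply, hb.extend_apply]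

theorem lpInftySpread_apply_of_notMem (y : Y) {i : ℕ} (hi : i ∉ Set.range b) :
    lpInftySpread b L C hL y i = 0 := by
  rw [lpInftySpread, lpInftyLift_apply, Function.extend_apply' _ _ _ hi]
  rfl

/-- The embedding of `X` as the `i`-th coordinate of `ℓ^∞(X)`. -/
def lpInftySingle (i : ℕ) : X →L[ℂ] lp (fun _ : ℕ => X) ∞ :=
  lpInftyLift (fun j => if j = i then ContinuousLinearMap.id ℂ X else 0) 1 fun j => by
    split_ifs
    · exact ContinuousLinearMap.norm_id_le
    · simp

theorem norm_lpInftySingle_le (i : ℕ) : ‖lpInftySingle (X := X) i‖ ≤ 1 :=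
  norm_lpInftyLift_le _ _ _

theorem lpInftySingle_add_lpInftyRestrict {A : Set ℕ} {i : ℕ} (hi : i ∈ A)
    {x : lp (fun _ : ℕ => X) ∞} (hx : ∀ j ∉ A, x j = 0) :
    lpInftySingle i (x i) + lpInftyRestrict (A \ {i}) x = x := by
  ext j : 2
  change lpInftySingle i (x i) j + lpInftyRestrict (A \ {i}) x j = x j
  rw [lpInftyRestrict_apply, lpInftySingle, lpInftyLift_apply]
  by_cases hji : j = i
  · subst hji
    simp
  · by_cases hj : j ∈ A
    · simp [hji, hj]
    · simp [hji, hj, hx j hj]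

/-- The diagonal entry of an operator on `ℓ^∞(X)`. -/
def lpInftyDiag (T : lp (fun _ : ℕ => X) ∞ →L[ℂ] lp (fun _ : ℕ => X) ∞) (i : ℕ) : X →L[ℂ] X :=
  lpInftyEval i ∘L T ∘L lpInftySingle i

theorem norm_comp_le_one {Z : Type*} [NormedAddCommGroup Z] [NormedSpace ℂ Z] {U : Y →L[ℂ] Z}
    {V : X →L[ℂ] Y} (hU : ‖U‖ ≤ 1) (hV : ‖V‖ ≤ 1) : ‖U ∘L V‖ ≤ 1 :=
  (ContinuousLinearMap.opNorm_comp_le _ _).trans (mul_le_one₀ hU (norm_nonneg _) hV)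

theorem norm_lpInftyDiag_le {T : lp (fun _ : ℕ => X) ∞ →L[ℂ] lp (fun _ : ℕ => X) ∞}
    (hT : ‖T‖ ≤ 1) (i : ℕ) : ‖lpInftyDiag T i‖ ≤ 1 :=
  norm_comp_le_one (norm_lpInftyEval_le i) (norm_comp_le_one hT (norm_lpInftySingle_le i))

end Spread

/-- Every contraction of `ℓ^∞(L^p(𝕋))` can be compressed to a small perturbation of a multiple of
the identity. -/
theorem exists_comp_comp_eq_smul_id_add {p : ℝ≥0∞} [Fact (1 ≤ p)] (hp : 1 < p) (hp_top : p ≠ ∞)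
    {ε : ℝ} (hε : 0 < ε) (T : lInftyLp p →L[ℂ] lInftyLp p) (hT : ‖T‖ ≤ 1) :
    ∃ (c : ℂ) (E P F : lInftyLp p →L[ℂ] lInftyLp p), ‖E‖ ≤ 1 ∧ ‖P‖ ≤ 1 ∧ ‖F‖ ≤ ε ∧
      P ∘L E = ContinuousLinearMap.id ℂ (lInftyLp p) ∧
      P ∘L T ∘L E = c • ContinuousLinearMap.id ℂ (lInftyLp p) + F := by
  let q := ENNReal.conjExponent p
  have hpq : p.HolderConjugate q := inferInstance
  have : Fact (1 ≤ q) := ⟨ENNReal.HolderConjugate.one_le q p⟩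
  have hq : q ≠ ∞ := ((ENNReal.HolderConjugate.lt_top_iff_one_lt q p).2 hp).ne
  obtain ⟨m, hm1, hm⟩ := exists_mean_operator
    (volume : Measure (AddCircle (2 * Real.pi))) p q hp_top hq
  obtain ⟨d, φ, hd, hφ, hlim⟩ := exists_strictMono_forall_tendsto
    (fun i (ab : ℤ × ℤ) => circleCoeff p q ab.2 (lpInftyDiag T i (circleExp p ab.1)))
    fun i ab => norm_circleCoeff_apply_circleExp_le (norm_lpInftyDiag_le hT i) ab.1 ab.2
  obtain ⟨b, hb, hbφ, hTb⟩ := exists_injective_norm_comp_restrict_le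
    (fun ε hε => exists_card_forall_exists_units_one_lt_norm hp_top hε) T hT hε φ hφ.injective
  choose β hβ using fun t => hbφ ⟨t, rfl⟩
  have hβ_inj : Injective β := fun s t hst => hb <| by rw [← hβ, ← hβ, hst]
  obtain ⟨c₀, -, hc₀⟩ := exists_hasMean fun n : ℕ => hd (n, n)
  have hpi : ((2 * Real.pi : ℝ) : ℂ) ≠ 0 := by exact_mod_cast fact_two_pi_pos.out.ne'
  let e : ℕ × ℕ × ℕ × ℕ ≃ ℕ := Denumerable.eqv _
  let E : lInftyLp p →L[ℂ] lInftyLp p := lpInftySpread b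
    (fun t => circleShift p (e.symm t).2.1 (e.symm t).2.2.1 ∘L lpInftyEval (e.symm t).1) 1
    fun t => norm_comp_le_one (norm_circleShift_le _ _) (norm_lpInftyEval_le _)
  let P : lInftyLp p →L[ℂ] lInftyLp p := lpInftyLift
    (fun j => tripleAverageClm hm1
      (fun n k l => circleUnshift p n k ∘L lpInftyEval (b (e (j, n, k, l))))
      fun n k l => norm_comp_le_one (norm_circleUnshift_le _ _) (norm_lpInftyEval_le _)) 1
    fun j => norm_tripleAverageClm_le _ _ _
  let W : lInftyLp p →L[ℂ] lInftyLp p := lpInftySpread b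
    (fun t => lpInftyEval (b t) ∘L T ∘L lpInftyRestrict (Set.range b \ {b t})) ε hTb
  let Δ : lInftyLp p →L[ℂ] lInftyLp p := lpInftyLift (fun i => lpInftyDiag T i ∘L lpInftyEval i) 1
    fun i => norm_comp_le_one (norm_lpInftyDiag_le hT i) (norm_lpInftyEval_le i)
  have hE1 : ‖E‖ ≤ 1 := norm_lpInftySpread_le
  have hP1 : ‖P‖ ≤ 1 := norm_lpInftyLift_le _ _ _
  have hW1 : ‖W‖ ≤ ε := norm_lpInftySpread_le
  have hE : ∀ x j n k l, E x (b (e (j, n, k, l))) = circleShift p n k (x j) := fun x j n k l => by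
    rw [lpInftySpread_apply hb]
    simp
  have hTE : ∀ x t, T (E x) (b t) = (Δ (E x) + W (E x)) (b t) := fun x t => by
    have h := lpInftySingle_add_lpInftyRestrict (x := E x) (Set.mem_range_self (f := b) t)
      fun i hi => lpInftySpread_apply_of_notMem x hi
    change _ = Δ (E x) (b t) + W (E x) (b t)
    rw [lpInftySpread_apply hb]
    conv_lhs => rw [← h, map_add]
    rfl
  have hPT : ∀ x, P (T (E x)) = P (Δ (E x)) + P (W (E x)) := fun x => by
    rw [← map_add]
    ext j : 2
    refine tripleAverageClm_congr hm1 fun n k l => ?_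
    rw [ContinuousLinearMap.comp_apply, ContinuousLinearMap.comp_apply, lpInftyEval_apply,
      lpInftyEval_apply, hTE]
  have hPΔ : ∀ x, P (Δ (E x)) = (c₀ / (2 * Real.pi : ℝ)) • x := fun x => by
    ext j : 2
    have h := tripleAverageClm_unshift_comp_shift hp_top hq hm1 hm
      (fun n k l => lpInftyDiag T (b (e (j, n, k, l))))
      (fun n k l => norm_comp_le_one (norm_circleUnshift_le n k)
        (norm_comp_le_one (norm_lpInftyDiag_le hT _) (norm_circleShift_le n k)))
      (d := d) hd (c := c₀ / (2 * Real.pi : ℝ)) ?_ ?_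
    · change _ = (c₀ / (2 * Real.pi : ℝ)) • x j
      rw [← ContinuousLinearMap.id_apply (R₁ := ℂ) (x j), ← _root_.smul_apply, ← h]
      refine tripleAverageClm_congr hm1 fun n k l => ?_
      simp only [ContinuousLinearMap.comp_apply, lpInftyEval_apply]
      rw [← hE]
      rfl
    · intro n k a b'
      have h2 : Injective fun l => β (e (j, n, k, l)) := fun l l' hl => by
        simpa using e.injective (hβ_inj hl)
      simpa only [comp_def, hβ] using (hlim (a, b')).comp h2.nat_tendsto_atTop
    · rwa [div_mul_cancel₀ _ hpi]
  refine ⟨c₀ / (2 * Real.pi : ℝ), E, P, P ∘L W ∘L E, hE1, hP1, ?_, ?_, ?_⟩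
  · calc _ ≤ ‖P‖ * (‖W‖ * ‖E‖) := (ContinuousLinearMap.opNorm_comp_le _ _).trans <| by
          gcongr
          exact ContinuousLinearMap.opNorm_comp_le _ _
      _ ≤ 1 * (ε * 1) := by gcongr
      _ = ε := by ring
  · ext x j : 3
    refine tripleAverageClm_const hp_top hq hm1 hm fun n k l => ?_
    change circleUnshift p n k (E x (b (e (j, n, k, l)))) = x j
    rw [hE, circleUnshift_circleShift]
  · ext1 x
    exact (hPT x).trans (congrArg (· + P (W (E x))) (hPΔ x))

end Factorization

/-- For every `1 < p < ∞` there is a constant `C_p > 0` such that for any bounded linear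
operator `T` on `ℓ^∞(L^p(𝕋))` with `‖T‖ ≤ 1`, the identity on `ℓ^∞(L^p(𝕋))` factors
through `T` or `Id - T`, with factorization constant `C_p`. -/
theorem identity_factors_through_operators_on_lInfty_Lp
    (p : ℝ≥0∞) [Fact (1 ≤ p)] (hp : 1 < p) (hp_top : p ≠ ∞) :
    ∃ C : ℝ, 0 < C ∧
      ∀ T : lInftyLp p →L[ℂ] lInftyLp p, ‖T‖ ≤ 1 →
        ∃ (H E P : lInftyLp p →L[ℂ] lInftyLp p),
          (H = T ∨ H = ContinuousLinearMap.id ℂ (lInftyLp p) - T) ∧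
          P.comp (H.comp E) = ContinuousLinearMap.id ℂ (lInftyLp p) ∧
          ‖E‖ * ‖P‖ ≤ C := by
  refine ⟨4, four_pos, fun T hT => ?_⟩
  obtain ⟨c, E, P, F, hE, hP, hF, hPE, hPTE⟩ :=
    exists_comp_comp_eq_smul_id_add hp hp_top (ε := 1 / 4) (by norm_num) T hT
  have key : ∀ (c' : ℂ) (F' H : lInftyLp p →L[ℂ] lInftyLp p), 1 / 2 ≤ ‖c'‖ → ‖F'‖ ≤ 1 / 4 →
      P ∘L H ∘L E = c' • ContinuousLinearMap.id ℂ (lInftyLp p) + F' →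
      ∃ E' P' : lInftyLp p →L[ℂ] lInftyLp p,
        P' ∘L H ∘L E' = ContinuousLinearMap.id ℂ (lInftyLp p) ∧ ‖E'‖ * ‖P'‖ ≤ 4 := by
    intro c' F' H hc' hF' hH
    obtain ⟨v, hv, hv1⟩ := exists_mul_smul_one_add_eq_one
      (A := lInftyLp p →L[ℂ] lInftyLp p) ContinuousLinearMap.norm_id_le hc' hF'
    refine ⟨E, v ∘L P, ?_, ?_⟩
    · rw [ContinuousLinearMap.comp_assoc, hH]
      exact hv1
    · calc _ ≤ 1 * (4 * 1 : ℝ) := by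
            gcongr
            refine (ContinuousLinearMap.opNorm_comp_le _ _).trans ?_
            gcongr
        _ = 4 := by norm_num
  by_cases hc : 1 / 2 ≤ ‖c‖
  · obtain ⟨E', P', h⟩ := key c F T hc hF hPTE
    exact ⟨T, E', P', Or.inl rfl, h⟩
  · have hc' : 1 / 2 ≤ ‖1 - c‖ := by
      have := norm_sub_norm_le (1 : ℂ) c
      rw [norm_one] at this
      linarith
    obtain ⟨E', P', h⟩ := key (1 - c) (-F) (ContinuousLinearMap.id ℂ _ - T) hc'
      (by rwa [norm_neg]) <| by
        rw [ContinuousLinearMap.sub_comp, ContinuousLinearMap.comp_sub, hPTE,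
          ContinuousLinearMap.id_comp, hPE, sub_smul, one_smul]
        abel
    exact ⟨_, E', P', Or.inr rfl, h⟩

end
end

section
/- For every 1 < p < ∞ there exists a constant C > 0 (depending only on p) such that for every n ∈ ℕ there exists N = N(n, p) ∈ ℕ with the following property: for every linear operator T : ℓ^p_N → ℓ^p_N there exist linear operators E : ℓ^p_n → ℓ^p_N and P : ℓ^p_N → ℓ^p_n such that P ∘ H ∘ E is the identity on ℓ^p_n, where H = T or H = Id_{ℓ^p_N} − T, and ‖E‖·‖P‖ ≤ C. -/
open scoped ENNReal

noncomputable section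

/-- `ℓ^p_N`: `ℂ^N` with the `p`-norm. -/
abbrev lpFin (p : ℝ≥0∞) (N : ℕ) := PiLp p (fun _ : Fin N => ℂ)

open Module

/-- A finite-dimensional complex normed space of dimension at least `d` contains `d` vectors of
norm at most `3 / 2` that are pairwise at distance at least `1`. -/
theorem exists_separated_finset {V : Type*} [NormedAddCommGroup V] [NormedSpace ℂ V]
    [FiniteDimensional ℂ V] (d : ℕ) (hd : d ≤ finrank ℂ V) :
    ∃ s : Finset V, s.card = d ∧ (∀ v ∈ s, ‖v‖ ≤ 3 / 2) ∧
      ∀ v ∈ s, ∀ w ∈ s, v ≠ w → 1 ≤ ‖v - w‖ := by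
  classical
  induction d with
  | zero => exact ⟨∅, by simp⟩
  | succ d ih =>
    obtain ⟨s, hcard, hnorm, hsep⟩ := ih (by omega)
    have hspan : finrank ℂ (Submodule.span ℂ (s : Set V)) ≤ d :=
      hcard ▸ finrank_span_finset_le_card s
    have hne : ∃ v, v ∉ Submodule.span ℂ (s : Set V) := by
      by_contra! h
      rw [(Submodule.eq_top_iff').2 h, finrank_top] at hspan
      omega
    obtain ⟨v, hv, hdist⟩ := riesz_lemma_of_norm_lt (c := (5 / 4 : ℂ)) (R := 3 / 2)
      (by norm_num) (by norm_num) (Submodule.closed_of_finiteDimensional _) hne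
    have hvs : ∀ w ∈ s, 1 ≤ ‖v - w‖ := fun w hw ↦ hdist w (Submodule.subset_span hw)
    have hnot : v ∉ s := fun h ↦ by
      have := hvs v h
      norm_num at this
    refine ⟨insert v s, by rw [Finset.card_insert_of_notMem hnot, hcard], ?_, ?_⟩
    · simpa [hv] using hnorm
    · intro a ha b hb hab
      rcases Finset.mem_insert.1 ha with rfl | has <;>
        rcases Finset.mem_insert.1 hb with rfl | hbs
      · exact absurd rfl hab
      · exact hvs b hbs
      · rw [norm_sub_rev]; exact hvs a has
      · exact hsep a has b hbs hab

/-- A subspace of dimension much larger than that of `F` contains a vector far away from `F`. -/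
theorem exists_mem_norm_mk_ge {V : Type*} [NormedAddCommGroup V] [NormedSpace ℂ V]
    [FiniteDimensional ℂ V] (X F : Submodule ℂ V)
    (h : 5 ^ (2 * finrank ℂ F) < finrank ℂ X) :
    ∃ x ∈ X, ‖x‖ ≤ 3 / 2 ∧ 1 / 12 ≤ ‖F.mkQ x‖ := by
  classical
  by_contra! hcon
  obtain ⟨s, hcard, hnorm, hsep⟩ := exists_separated_finset (V := X) _ le_rfl
  have happrox : ∀ v : X, ∃ z : F, v ∈ s → ‖(v : V) - z‖ < 1 / 12 := by
    intro v
    by_cases hv : v ∈ s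
    · obtain ⟨m, hm, hlt⟩ := QuotientAddGroup.norm_lt_iff.1 (hcon v v.2 (hnorm v hv))
      have hmem : (v : V) - m ∈ F := (Submodule.Quotient.eq F).1 hm.symm
      exact ⟨⟨_, hmem⟩, fun _ ↦ by simpa using hlt⟩
    · exact ⟨0, fun h ↦ absurd h hv⟩
  choose z hz using happrox
  have hzsep : ∀ v ∈ s, ∀ w ∈ s, v ≠ w → 5 / 6 ≤ ‖z v - z w‖ := by
    intro v hv w hw hvw
    have h1 : 1 ≤ ‖(v : V) - w‖ := hsep v hv w hw hvw
    have h2 : ‖(v : V) - w‖ ≤ ‖(v : V) - z v‖ + ‖(z v : V) - z w‖ + ‖(z w : V) - w‖ := by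
      refine le_trans (le_of_eq ?_) norm_add₃_le
      congr 1
      abel
    have h3 := hz v hv
    have h4 := hz w hw
    rw [norm_sub_rev] at h4
    have h5 : ‖z v - z w‖ = ‖(z v : V) - z w‖ := rfl
    linarith
  have hscale : ∀ a : F, ‖(6 / 5 : ℝ) • a‖ = 6 / 5 * ‖a‖ := fun a ↦ by
    rw [norm_smul]; norm_num
  have hinj : Set.InjOn (fun v ↦ (6 / 5 : ℝ) • z v) s := by
    intro v hv w hw hvw
    by_contra hne
    have h1 := hzsep v hv w hw hne
    have h2 : z v = z w := smul_right_injective F (by norm_num : (6 / 5 : ℝ) ≠ 0) hvw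
    norm_num [h2] at h1
  have hle := Besicovitch.card_le_of_separated (s.image fun v ↦ (6 / 5 : ℝ) • z v) ?_ ?_
  · rw [Finset.card_image_of_injOn hinj, hcard, finrank_real_of_complex] at hle
    omega
  · simp only [Finset.forall_mem_image]
    intro v hv
    have h1 := hz v hv
    have h2 : ‖(v : V)‖ ≤ 3 / 2 := hnorm v hv
    have h3 : ‖(z v : V)‖ ≤ ‖(v : V)‖ + ‖(v : V) - z v‖ := by
      simpa using norm_sub_le (v : V) (v - z v)
    have h4 : ‖z v‖ = ‖(z v : V)‖ := rfl
    rw [hscale]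
    linarith
  · simp only [Finset.forall_mem_image]
    intro v hv w hw hvw
    have h1 := hzsep v hv w hw (fun h ↦ hvw (by rw [h]))
    rw [← smul_sub, hscale]
    linarith

/-- If `dim X` is much larger than `dim F`, there are `x ∈ X` and a functional `y` vanishing on
`F`, both of controlled norm, with `y x = 1`. -/
theorem exists_mem_dual_apply_eq_one {V : Type*} [NormedAddCommGroup V] [NormedSpace ℂ V]
    [FiniteDimensional ℂ V] (X F : Submodule ℂ V)
    (h : 5 ^ (2 * finrank ℂ F) < finrank ℂ X) :
    ∃ x ∈ X, ∃ y : StrongDual ℂ V,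
      ‖x‖ ≤ 3 / 2 ∧ ‖y‖ ≤ 12 ∧ y x = 1 ∧ ∀ z ∈ F, y z = 0 := by
  obtain ⟨x, hx, hnorm, hmk⟩ := exists_mem_norm_mk_ge X F h
  obtain ⟨g, hg, hgx⟩ := exists_dual_vector'' ℂ (F.mkQ x)
  have hpos : 0 < ‖F.mkQ x‖ := by linarith
  let y₀ : StrongDual ℂ V := (g.toLinearMap ∘ₗ F.mkQ).mkContinuous 1 fun v ↦ by
    calc ‖g (F.mkQ v)‖ ≤ ‖g‖ * ‖F.mkQ v‖ := g.le_opNorm _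
      _ ≤ 1 * ‖v‖ := by gcongr; exact Submodule.Quotient.norm_mk_le F v
  have hy₀ : ∀ v, y₀ v = g (F.mkQ v) := fun _ ↦ rfl
  refine ⟨x, hx, ((‖F.mkQ x‖ : ℂ)⁻¹) • y₀, hnorm, ?_, ?_, ?_⟩
  · have h1 : ‖y₀‖ ≤ 1 := LinearMap.mkContinuous_norm_le _ zero_le_one _
    rw [norm_smul, norm_inv, Complex.norm_real, norm_norm]
    calc ‖F.mkQ x‖⁻¹ * ‖y₀‖ ≤ (1 / 12)⁻¹ * 1 := by gcongr
      _ = 12 := by norm_num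
  · rw [smul_apply, hy₀, hgx, smul_eq_mul]
    exact inv_mul_cancel₀ (by exact_mod_cast hpos.ne')
  · intro z hz
    have : F.mkQ z = 0 := by simpa using hz
    rw [smul_apply, hy₀, this, map_zero, smul_zero]

/-- For a matrix `B` of operators on a space of large dimension, there are vectors `x i` and
functionals `y i`, biorthogonal on the diagonal, that diagonalise `B`. -/
theorem exists_diagonalizing_system {ι V : Type*} [Fintype ι] [NormedAddCommGroup V]
    [NormedSpace ℂ V] [FiniteDimensional ℂ V] (B : ι → ι → V →ₗ[ℂ] V)
    (hV : 5 ^ (2 * Fintype.card ι) + Fintype.card ι < finrank ℂ V) :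
    ∃ (x : ι → V) (y : ι → StrongDual ℂ V), ∀ i,
      ‖x i‖ ≤ 3 / 2 ∧ ‖y i‖ ≤ 12 ∧ y i (x i) = 1 ∧ ∀ j, i ≠ j → y i (B i j (x j)) = 0 := by
  classical
  suffices H : ∀ s : Finset ι, ∃ (x : ι → V) (y : ι → StrongDual ℂ V), ∀ i ∈ s,
      ‖x i‖ ≤ 3 / 2 ∧ ‖y i‖ ≤ 12 ∧ y i (x i) = 1 ∧ ∀ j ∈ s, i ≠ j → y i (B i j (x j)) = 0 by
    simpa using H Finset.univ
  intro s
  induction s using Finset.induction_on with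
  | empty => exact ⟨0, 0, by simp⟩
  | insert a s ha ih =>
    obtain ⟨x, y, hxy⟩ := ih
    let φ : V →ₗ[ℂ] (s → ℂ) := LinearMap.pi fun i ↦ (y i).toLinearMap ∘ₗ B i a
    let F := Submodule.span ℂ ((s.image fun i ↦ B a i (x i) : Finset V) : Set V)
    have hs : s.card ≤ Fintype.card ι := s.card_le_univ
    have hF : finrank ℂ F ≤ Fintype.card ι :=
      (finrank_span_finset_le_card _).trans (Finset.card_image_le.trans hs)
    have hφ : finrank ℂ (LinearMap.range φ) ≤ Fintype.card ι :=
      (Submodule.finrank_le _).trans (by simpa using hs)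
    have hX : 5 ^ (2 * finrank ℂ F) < finrank ℂ (LinearMap.ker φ) := by
      have h1 := φ.finrank_range_add_finrank_ker
      have h2 : 5 ^ (2 * finrank ℂ F) ≤ 5 ^ (2 * Fintype.card ι) := by gcongr; norm_num
      omega
    obtain ⟨x', hx', y', hnx, hny, hone, hzero⟩ := exists_mem_dual_apply_eq_one _ F hX
    have hx'' : ∀ i ∈ s, y i (B i a x') = 0 := fun i hi ↦
      congrFun (LinearMap.mem_ker.1 hx') ⟨i, hi⟩
    have hy'' : ∀ i ∈ s, y' (B a i (x i)) = 0 := fun i hi ↦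
      hzero _ (Submodule.subset_span (by
        simpa using ⟨i, hi, rfl⟩))
    have hne : ∀ i ∈ s, i ≠ a := fun i hi h ↦ ha (h ▸ hi)
    refine ⟨Function.update x a x', Function.update y a y', fun i hi ↦ ?_⟩
    rcases Finset.mem_insert.1 hi with rfl | his
    · simp only [Function.update_self]
      refine ⟨hnx, hny, hone, fun j hj hij ↦ ?_⟩
      have hj' := (Finset.mem_insert.1 hj).resolve_left (Ne.symm hij)
      rw [Function.update_of_ne (Ne.symm hij)]
      exact hy'' j hj'
    · obtain ⟨h1, h2, h3, h4⟩ := hxy i his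
      simp only [Function.update_of_ne (hne i his)]
      refine ⟨h1, h2, h3, fun j hj hij ↦ ?_⟩
      rcases Finset.mem_insert.1 hj with rfl | hj
      · rw [Function.update_self]
        exact hx'' i his
      · rw [Function.update_of_ne (hne j hj)]
        exact h4 j hj hij

/-- Coordinatewise comparison of `p`-norms along an injection of the index sets. -/
theorem PiLp.norm_le_mul_norm_of_injective {p : ℝ≥0∞} [Fact (1 ≤ p)] (hp : p ≠ ∞)
    {ι κ : Type*} [Fintype ι] [Fintype κ] {α : ι → Type*} {β : κ → Type*}
    [∀ i, NormedAddCommGroup (α i)] [∀ k, NormedAddCommGroup (β k)]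
    {σ : ι → κ} (hσ : σ.Injective) {C : ℝ} (hC : 0 ≤ C) (f : PiLp p α) (g : PiLp p β)
    (h : ∀ i, ‖f i‖ ≤ C * ‖g (σ i)‖) : ‖f‖ ≤ C * ‖g‖ := by
  classical
  have hp0 : 0 < p.toReal := ENNReal.toReal_pos (zero_lt_one.trans_le Fact.out).ne' hp
  rw [← Real.rpow_le_rpow_iff (norm_nonneg _) (by positivity) hp0,
    Real.mul_rpow hC (norm_nonneg _), PiLp.norm_eq_sum hp0, PiLp.norm_eq_sum hp0,
    ← Real.rpow_mul (by positivity), ← Real.rpow_mul (by positivity),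
    one_div_mul_cancel hp0.ne', Real.rpow_one, Real.rpow_one, Finset.mul_sum]
  calc ∑ i, ‖f i‖ ^ p.toReal
      ≤ ∑ i, C ^ p.toReal * ‖g (σ i)‖ ^ p.toReal := by
        gcongr with i
        rw [← Real.mul_rpow hC (norm_nonneg _)]
        exact Real.rpow_le_rpow (norm_nonneg _) (h i) hp0.le
    _ = ∑ k ∈ Finset.univ.image σ, C ^ p.toReal * ‖g k‖ ^ p.toReal :=
        (Finset.sum_image (f := fun k ↦ C ^ p.toReal * ‖g k‖ ^ p.toReal) hσ.injOn).symm
    _ ≤ ∑ k, C ^ p.toReal * ‖g k‖ ^ p.toReal :=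
        Finset.sum_le_sum_of_subset_of_nonneg (Finset.subset_univ _)
          fun _ _ _ ↦ by positivity

/-- Coordinatewise comparison of `p`-norms for a vector supported on the range of an injection. -/
theorem PiLp.norm_le_mul_norm_of_support {p : ℝ≥0∞} [Fact (1 ≤ p)] (hp : p ≠ ∞)
    {ι κ : Type*} [Fintype ι] [Fintype κ] {α : ι → Type*} {β : κ → Type*}
    [∀ i, NormedAddCommGroup (α i)] [∀ k, NormedAddCommGroup (β k)]
    {σ : ι → κ} (hσ : σ.Injective) {C : ℝ} (hC : 0 ≤ C) (f : PiLp p α) (g : PiLp p β)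
    (h : ∀ i, ‖g (σ i)‖ ≤ C * ‖f i‖) (h0 : ∀ k ∉ Set.range σ, g k = 0) : ‖g‖ ≤ C * ‖f‖ := by
  have hp0 : 0 < p.toReal := ENNReal.toReal_pos (zero_lt_one.trans_le Fact.out).ne' hp
  rw [← Real.rpow_le_rpow_iff (norm_nonneg _) (by positivity) hp0,
    Real.mul_rpow hC (norm_nonneg _), PiLp.norm_eq_sum hp0, PiLp.norm_eq_sum hp0,
    ← Real.rpow_mul (by positivity), ← Real.rpow_mul (by positivity),
    one_div_mul_cancel hp0.ne', Real.rpow_one, Real.rpow_one, Finset.mul_sum,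
    ← Fintype.sum_of_injective σ hσ (fun i ↦ ‖g (σ i)‖ ^ p.toReal) (fun k ↦ ‖g k‖ ^ p.toReal)
      (fun k hk ↦ by simp [h0 k hk, hp0.ne']) fun _ ↦ rfl]
  gcongr with i
  rw [← Real.mul_rpow hC (norm_nonneg _)]
  exact Real.rpow_le_rpow (norm_nonneg _) (h i) hp0.le

/-- The identity on `ℓ^p_n` factors through an operator that is diagonalised, with diagonal
bounded below, by vectors and functionals supported on disjoint blocks. -/
theorem exists_factorization_of_diagonal {p : ℝ≥0∞} [Fact (1 ≤ p)] (hp : p ≠ ∞)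
    {n : ℕ} {κ V : Type*} [Fintype κ] [DecidableEq κ] [NormedAddCommGroup V] [NormedSpace ℂ V]
    (H : PiLp p (fun _ : κ ↦ V) →L[ℂ] PiLp p (fun _ : κ ↦ V))
    {σ : Fin n → κ} (hσ : σ.Injective) (x : Fin n → V) (y : Fin n → StrongDual ℂ V)
    {a b δ : ℝ} (ha : 0 ≤ a) (hb : 0 ≤ b) (hδ : 0 < δ)
    (hx : ∀ i, ‖x i‖ ≤ a) (hy : ∀ i, ‖y i‖ ≤ b)
    (hoff : ∀ i j, i ≠ j → y i (H (PiLp.single p (σ j) (x j)) (σ i)) = 0)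
    (hdiag : ∀ i, δ ≤ ‖y i (H (PiLp.single p (σ i) (x i)) (σ i))‖) :
    ∃ (E : lpFin p n →L[ℂ] PiLp p (fun _ : κ ↦ V)) (P : PiLp p (fun _ : κ ↦ V) →L[ℂ] lpFin p n),
      P.comp (H.comp E) = ContinuousLinearMap.id ℂ (lpFin p n) ∧ ‖E‖ ≤ a ∧ ‖P‖ ≤ δ⁻¹ * b := by
  classical
  let d : Fin n → ℂ := fun i ↦ y i (H (PiLp.single p (σ i) (x i)) (σ i))
  have hd : ∀ i, d i ≠ 0 := fun i ↦ norm_pos_iff.1 (hδ.trans_le (hdiag i))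
  let E₀ : lpFin p n →ₗ[ℂ] PiLp p (fun _ : κ ↦ V) :=
    { toFun := fun f ↦ ∑ j, f j • PiLp.single p (σ j) (x j)
      map_add' := fun f g ↦ by simp [add_smul, Finset.sum_add_distrib]
      map_smul' := fun c f ↦ by simp [mul_smul, Finset.smul_sum] }
  let P₀ : PiLp p (fun _ : κ ↦ V) →ₗ[ℂ] lpFin p n :=
    { toFun := fun w ↦ WithLp.toLp p fun i ↦ (d i)⁻¹ * y i (w (σ i))
      map_add' := fun v w ↦ by ext i; simp [mul_add]
      map_smul' := fun c w ↦ by ext i; simp [mul_left_comm] }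
  have hE₀ : ∀ f k, E₀ f k = ∑ j, f j • (PiLp.single p (σ j) (x j) : PiLp p fun _ : κ ↦ V) k := by
    intro f k
    simp [E₀, Pi.single_apply]
  have hE : ∀ f, ‖E₀ f‖ ≤ a * ‖f‖ := by
    intro f
    refine PiLp.norm_le_mul_norm_of_support hp hσ ha f (E₀ f) (fun i ↦ ?_) fun k hk ↦ ?_
    · have : E₀ f (σ i) = f i • x i := by
        rw [hE₀, Finset.sum_eq_single i]
        · simp
        · intro j _ hj
          simp [hσ.ne hj.symm]
        · simp
      rw [this, norm_smul, mul_comm]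
      gcongr
      exact hx i
    · rw [hE₀]
      refine Finset.sum_eq_zero fun j _ ↦ ?_
      have : k ≠ σ j := fun h ↦ hk ⟨j, h.symm⟩
      simp [this]
  have hP : ∀ w, ‖P₀ w‖ ≤ δ⁻¹ * b * ‖w‖ := by
    intro w
    refine PiLp.norm_le_mul_norm_of_injective hp hσ (by positivity) (P₀ w) w fun i ↦ ?_
    calc ‖(d i)⁻¹ * y i (w (σ i))‖ = ‖d i‖⁻¹ * ‖y i (w (σ i))‖ := by rw [norm_mul, norm_inv]
      _ ≤ δ⁻¹ * (b * ‖w (σ i)‖) := by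
        gcongr
        · exact hdiag i
        · exact (y i).le_of_opNorm_le (hy i) _
      _ = δ⁻¹ * b * ‖w (σ i)‖ := by ring
  refine ⟨E₀.mkContinuous a hE, P₀.mkContinuous _ hP, ?_,
    LinearMap.mkContinuous_norm_le _ ha _, LinearMap.mkContinuous_norm_le _ (by positivity) _⟩
  ext f i
  have hsum : y i (H (E₀ f) (σ i)) = f i * d i := by
    have h1 : H (E₀ f) (σ i) = ∑ j, f j • H (PiLp.single p (σ j) (x j)) (σ i) := by
      simp [E₀]
    rw [h1, map_sum, Finset.sum_eq_single i]
    · rw [map_smul, smul_eq_mul]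
    · intro j _ hj
      rw [map_smul, hoff i j hj.symm, smul_zero]
    · simp
  change (d i)⁻¹ * y i (H (E₀ f) (σ i)) = f i
  rw [hsum, mul_comm (f i), inv_mul_cancel_left₀ (hd i)]

/-- The identity on `ℓ^p_n` factors through `S` or `Id - S` for every operator `S` on the
`ℓ^p`-sum of `2 n` copies of a space of sufficiently large dimension. -/
theorem exists_factorization_piLp {p : ℝ≥0∞} [Fact (1 ≤ p)] (hp : p ≠ ∞) (n : ℕ)
    {V : Type*} [NormedAddCommGroup V] [NormedSpace ℂ V] [FiniteDimensional ℂ V]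
    (hV : 5 ^ (2 * (2 * n)) + 2 * n < finrank ℂ V)
    (S : PiLp p (fun _ : Fin (2 * n) ↦ V) →L[ℂ] PiLp p (fun _ : Fin (2 * n) ↦ V)) :
    ∃ (H : PiLp p (fun _ : Fin (2 * n) ↦ V) →L[ℂ] PiLp p (fun _ : Fin (2 * n) ↦ V))
      (E : lpFin p n →L[ℂ] PiLp p (fun _ : Fin (2 * n) ↦ V))
      (P : PiLp p (fun _ : Fin (2 * n) ↦ V) →L[ℂ] lpFin p n),
      (H = S ∨ H = ContinuousLinearMap.id ℂ _ - S) ∧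
      P.comp (H.comp E) = ContinuousLinearMap.id ℂ (lpFin p n) ∧ ‖E‖ ≤ 3 / 2 ∧ ‖P‖ ≤ 24 := by
  classical
  let B : Fin (2 * n) → Fin (2 * n) → V →ₗ[ℂ] V := fun i j ↦
    { toFun := fun v ↦ S (PiLp.single p j v) i
      map_add' := fun v w ↦ by rw [PiLp.single_add, map_add, PiLp.add_apply]
      map_smul' := fun c v ↦ by
        rw [← PiLp.toLp_single, Pi.single_smul', WithLp.toLp_smul, PiLp.toLp_single, map_smul,
          PiLp.smul_apply, RingHom.id_apply] }
  obtain ⟨x, y, hxy⟩ := exists_diagonalizing_system B (by simpa using hV)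
  choose hx hy hone hzero using hxy
  have hB : ∀ i j, i ≠ j → y i (S (PiLp.single p j (x j)) i) = 0 := hzero
  obtain ⟨t, ht⟩ := Fintype.exists_le_card_fiber_of_mul_le_card
    (f := fun i ↦ decide (1 / 2 ≤ ‖y i (S (PiLp.single p i (x i)) i)‖)) (n := n) (by simp)
  let σ := Finset.orderEmbOfCardLe _ ht
  have hσ : Function.Injective σ := σ.injective
  have hmem : ∀ i, decide (1 / 2 ≤ ‖y (σ i) (S (PiLp.single p (σ i) (x (σ i))) (σ i))‖) = t :=
    fun i ↦ (Finset.mem_filter.1 (Finset.orderEmbOfCardLe_mem _ ht i)).2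
  cases t with
  | true =>
    obtain ⟨E, P, h1, h2, h3⟩ := exists_factorization_of_diagonal hp S hσ (x ∘ σ) (y ∘ σ)
      (a := 3 / 2) (b := 12) (δ := 1 / 2) (by norm_num) (by norm_num) (by norm_num)
      (fun i ↦ hx _) (fun i ↦ hy _) (fun i j hij ↦ hB _ _ (hσ.ne hij))
      (fun i ↦ of_decide_eq_true (hmem i))
    exact ⟨S, E, P, Or.inl rfl, h1, h2, h3.trans (by norm_num)⟩
  | false =>
    obtain ⟨E, P, h1, h2, h3⟩ := exists_factorization_of_diagonal hp
      (ContinuousLinearMap.id ℂ _ - S) hσ (x ∘ σ) (y ∘ σ)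
      (a := 3 / 2) (b := 12) (δ := 1 / 2) (by norm_num) (by norm_num) (by norm_num)
      (fun i ↦ hx _) (fun i ↦ hy _)
      (fun i j hij ↦ by
        have h := hB _ _ (hσ.ne hij)
        simp [hσ.ne hij, h])
      (fun i ↦ by
        have h := of_decide_eq_false (hmem i)
        have h' := norm_sub_norm_le (1 : ℂ) (y (σ i) (S (PiLp.single p (σ i) (x (σ i))) (σ i)))
        simp only [Function.comp_apply, sub_apply, ContinuousLinearMap.id_apply,
          PiLp.sub_apply, map_sub, PiLp.single_eq_same, hone]
        rw [norm_one] at h'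
        linarith)
    exact ⟨_, E, P, Or.inr rfl, h1, h2, h3.trans (by norm_num)⟩

/-- For every `1 < p < ∞` there is a constant `C > 0` (depending only on `p`) such that for
every `n` there is `N = N(n, p)` so that for every linear operator `T` on `ℓ^p_N`, the identity
on `ℓ^p_n` factors through `T` or `Id - T`, with constant `C`. -/
theorem identity_on_lpn_factors (p : ℝ≥0∞) [Fact (1 ≤ p)] (hp : 1 < p) (hp_top : p ≠ ∞) :
    ∃ C : ℝ, 0 < C ∧
      ∀ n : ℕ, ∃ N : ℕ,
        ∀ T : lpFin p N →L[ℂ] lpFin p N,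
          ∃ (H : lpFin p N →L[ℂ] lpFin p N)
            (E : lpFin p n →L[ℂ] lpFin p N)
            (P : lpFin p N →L[ℂ] lpFin p n),
            (H = T ∨ H = ContinuousLinearMap.id ℂ (lpFin p N) - T) ∧
            P.comp (H.comp E) = ContinuousLinearMap.id ℂ (lpFin p n) ∧
            ‖E‖ * ‖P‖ ≤ C := by
  refine ⟨36, by norm_num, fun n ↦ ?_⟩
  let m := 5 ^ (2 * (2 * n)) + 2 * n + 1
  refine ⟨2 * n * m, fun T ↦ ?_⟩
  let Φ : lpFin p (2 * n * m) ≃ₗᵢ[ℂ] PiLp p (fun _ : Fin (2 * n) ↦ lpFin p m) :=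
    (LinearIsometryEquiv.piLpCongrLeft p ℂ ℂ
      (finProdFinEquiv.symm.trans (Equiv.sigmaEquivProd (Fin (2 * n)) (Fin m)).symm)).trans
      (LinearIsometryEquiv.piLpCurry ℂ p fun _ _ ↦ ℂ)
  let Φ₁ : lpFin p (2 * n * m) →L[ℂ] PiLp p (fun _ : Fin (2 * n) ↦ lpFin p m) :=
    Φ.toContinuousLinearEquiv
  let Φ₂ : PiLp p (fun _ : Fin (2 * n) ↦ lpFin p m) →L[ℂ] lpFin p (2 * n * m) :=
    Φ.symm.toContinuousLinearEquiv
  have hΦ₁ : ‖Φ₁‖ ≤ 1 := Φ₁.opNorm_le_bound zero_le_one fun v ↦ by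
    rw [one_mul]; exact (Φ.norm_map v).le
  have hΦ₂ : ‖Φ₂‖ ≤ 1 := Φ₂.opNorm_le_bound zero_le_one fun v ↦ by
    rw [one_mul]; exact (Φ.symm.norm_map v).le
  have h12 : ∀ v, Φ₁ (Φ₂ v) = v := Φ.apply_symm_apply
  have h21 : ∀ v, Φ₂ (Φ₁ v) = v := Φ.symm_apply_apply
  have hm : finrank ℂ (lpFin p m) = m := by
    rw [(WithLp.linearEquiv p ℂ (Fin m → ℂ)).finrank_eq, finrank_fin_fun]
  obtain ⟨H, E, P, hH, hid, hE, hP⟩ := exists_factorization_piLp hp_top n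
    (V := lpFin p m) (by rw [hm]; exact Nat.lt_succ_self _) (Φ₁.comp (T.comp Φ₂))
  refine ⟨Φ₂.comp (H.comp Φ₁), Φ₂.comp E, P.comp Φ₁, ?_, ?_, ?_⟩
  · refine hH.imp (fun h ↦ ?_) fun h ↦ ?_
    · ext1 v
      simp only [h, ContinuousLinearMap.comp_apply, h21]
    · ext1 v
      simp only [h, ContinuousLinearMap.comp_apply, sub_apply, ContinuousLinearMap.id_apply,
        map_sub, h21]
  · rw [← hid]
    ext1 v
    simp only [ContinuousLinearMap.comp_apply, h12]
  · have h1 : ‖Φ₂.comp E‖ ≤ 1 * (3 / 2) := (Φ₂.opNorm_comp_le E).trans (by gcongr)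
    have h2 : ‖P.comp Φ₁‖ ≤ 24 * 1 := (P.opNorm_comp_le Φ₁).trans (by gcongr)
    calc _ ≤ (1 * (3 / 2)) * (24 * 1 : ℝ) := by gcongr
      _ = 36 := by norm_num

end
end
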